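/- arXiv:2411.18563 — 2 statements merged into one kernel-verified Lean document; each statement's English description precedes it below -/
import Mathlib

section
/- Fix c > 0 and η ∈ [0,1) with c < c̄(η), and let ζ = ζ(c,η). Let p : ℕ → (0,1) be any sequence with √n·p(n) → c as n → ∞. Then lim_{n→∞} n^{-3/2}·log P_{p(n)}( X ≤ η·E X ) = (1/2)·[ ( W(2ζc²)^{3/2} + 3·W(2ζc²)^{1/2} ) / (3·√(2ζ)) − (log(1−ζ))·η·c³/3 − c ], where in the case η = 0 (so ζ = 1) the term (log(1−ζ))·η·c³/3 is interpreted as 0. -/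
open Filter
open scoped BigOperators symmDiff Classical

noncomputable section

/-- Number of edges of a labeled simple graph on `Fin n`. -/
def edgeCount {n : ℕ} (G : SimpleGraph (Fin n)) : ℕ := Nat.card G.edgeSet

/-- Number of triangles of a labeled simple graph on `Fin n`. -/
def triCount {n : ℕ} (G : SimpleGraph (Fin n)) : ℕ :=
  Nat.card {s : Finset (Fin n) // G.IsNClique 3 s}

/-- Probability of the event `A` under the Erdős–Rényi random graph `G(n,p)`. -/
def erProb (n : ℕ) (p : ℝ) (A : Set (SimpleGraph (Fin n))) : ℝ :=
  ∑ G : SimpleGraph (Fin n),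
    if G ∈ A then p ^ edgeCount G * (1 - p) ^ (n.choose 2 - edgeCount G) else 0

/-- Conditional probability `P_p(A | B)` for `G(n,p)`. -/
def erCondProb (n : ℕ) (p : ℝ) (A B : Set (SimpleGraph (Fin n))) : ℝ :=
  erProb n p (A ∩ B) / erProb n p B

/-- Probability of the event `A` under the uniform random graph `G(n,m)`. -/
def gnmProb (n m : ℕ) (A : Set (SimpleGraph (Fin n))) : ℝ :=
  (Nat.card {G : SimpleGraph (Fin n) // edgeCount G = m ∧ G ∈ A} : ℝ) /
    ((n.choose 2).choose m : ℝ)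

/-- Expected number of triangles of `G(n,m)`. -/
def gnmExpTri (n m : ℕ) : ℝ :=
  (∑ G : SimpleGraph (Fin n), if edgeCount G = m then (triCount G : ℝ) else 0) /
    ((n.choose 2).choose m : ℝ)

/-- Gibbs weight `λ^{|G|} (1-ζ)^{X(G)}`. -/
def gibbsWeight {n : ℕ} (lam zeta : ℝ) (G : SimpleGraph (Fin n)) : ℝ :=
  lam ^ edgeCount G * (1 - zeta) ^ triCount G

/-- The partition function `Z(λ,ζ)`. -/
def Zfun (n : ℕ) (lam zeta : ℝ) : ℝ := ∑ G : SimpleGraph (Fin n), gibbsWeight lam zeta G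

/-- Probability of the event `A` under the Gibbs measure `μ_{λ,ζ}`. -/
def gibbsProb (n : ℕ) (lam zeta : ℝ) (A : Set (SimpleGraph (Fin n))) : ℝ :=
  (∑ G : SimpleGraph (Fin n), if G ∈ A then gibbsWeight lam zeta G else 0) / Zfun n lam zeta

/-- Expectation of `f` under the Gibbs measure `μ_{λ,ζ}`. -/
def gibbsExp (n : ℕ) (lam zeta : ℝ) (f : SimpleGraph (Fin n) → ℝ) : ℝ :=
  (∑ G : SimpleGraph (Fin n), f G * gibbsWeight lam zeta G) / Zfun n lam zeta

/-- Number of edges of `H` with both endpoints in `S`. -/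
def edgesIn {V : Type*} (H : SimpleGraph V) (S : Finset V) : ℕ :=
  Nat.card {e : Sym2 V // e ∈ H.edgeSet ∧ ∀ v ∈ e, v ∈ S}

/-- Weight `λ^{|S|} (1-ζ)^{|E(S)|}` of the measure `ν_{H,λ,ζ}`. -/
def nuWeight {V : Type*} (H : SimpleGraph V) (lam zeta : ℝ) (S : Finset V) : ℝ :=
  lam ^ S.card * (1 - zeta) ^ edgesIn H S

/-- The partition function `Ξ_H(λ,ζ)`. -/
def XiFun {V : Type*} [Fintype V] (H : SimpleGraph V) (lam zeta : ℝ) : ℝ :=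
  ∑ S : Finset V, nuWeight H lam zeta S

/-- The probability of `S` under `ν_{H,λ,ζ}`. -/
def nuProb {V : Type*} [Fintype V] (H : SimpleGraph V) (lam zeta : ℝ) (S : Finset V) : ℝ :=
  nuWeight H lam zeta S / XiFun H lam zeta

/-- `W` is the Lambert-W function on `[0,∞)`: for `x ≥ 0`, `W x` is the unique `w ≥ 0`
with `w·e^w = x`. -/
def IsLambertW (W : ℝ → ℝ) : Prop :=
  ∀ x : ℝ, 0 ≤ x → (0 ≤ W x ∧ W x * Real.exp (W x) = x ∧
    ∀ w : ℝ, 0 ≤ w → w * Real.exp w = x → w = W x)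

/-- `η* = (W(2/e)/(2/e))^{3/2}`. -/
def etaStar (W : ℝ → ℝ) : ℝ := (W (2 / Real.exp 1) / (2 / Real.exp 1)) ^ ((3 : ℝ) / 2)

/-- The condition `c < c̄(η)` where `c̄(η) = 1/√(e(1−η/η*))` for `η < η*` and `+∞` otherwise. -/
def LtCbar (W : ℝ → ℝ) (c η : ℝ) : Prop :=
  η < etaStar W → c < 1 / Real.sqrt (Real.exp 1 * (1 - η / etaStar W))

/-- The left-hand side of the equation defining `ζ(c,η)`, interpreted as `1` at `ζ = 0`. -/
def zetaLHS (W : ℝ → ℝ) (c zeta : ℝ) : ℝ :=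
  (1 - zeta) * (if zeta = 0 then 1 else
    (W (2 * zeta * c ^ 2) / (2 * zeta * c ^ 2)) ^ ((3 : ℝ) / 2))

section Hypergraph

set_option linter.unusedSectionVars false

variable {E T : Type*} [Fintype E] [DecidableEq E]

/-- Partition function of the triple system `b` restricted to the triples in `Q`, summed over
the edge sets that contain `A`. -/
def partFun (b : T → Finset E) (lam ζ : ℝ) (Q : Finset T) (A : Finset E) : ℝ :=
  ∑ S : Finset E, if A ⊆ S then lam ^ S.card * (1 - ζ) ^ (Q.filter fun t => b t ⊆ S).card else 0

/-- Every triple outside `Q` contains an element of `A`. -/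
def CoversCompl (b : T → Finset E) (Q : Finset T) (A : Finset E) : Prop :=
  ∀ t, t ∉ Q → ∃ a ∈ A, a ∈ b t

/-- No triple of `Q` through `e` has its other two elements in `A`. -/
def IsFree (b : T → Finset E) (Q : Finset T) (A : Finset E) (e : E) : Prop :=
  ∀ t ∈ Q, e ∈ b t → ¬ (b t).erase e ⊆ A

/-- Uniform upper bound on conditional edge marginals. -/
def MarginalLE (b : T → Finset E) (lam ζ : ℝ) (M : ℕ) (y : ℝ) : Prop :=
  ∀ Q A e, A.card ≤ M → CoversCompl b Q A → e ∉ A →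
    partFun b lam ζ Q (insert e A) ≤ y * partFun b lam ζ Q A

/-- Uniform lower bound on conditional edge marginals, for edges which do not close a triple. -/
def MarginalGE (b : T → Finset E) (lam ζ : ℝ) (M : ℕ) (x : ℝ) : Prop :=
  ∀ Q A e, A.card ≤ M → CoversCompl b Q A → e ∉ A → IsFree b Q A e →
    x * partFun b lam ζ Q A ≤ partFun b lam ζ Q (insert e A)

/-- A linear `3`-uniform `D`-regular hypergraph. -/
structure IsTripleSystem [Fintype T] (b : T → Finset E) (D : ℕ) : Prop where
  card_eq : ∀ t, (b t).card = 3
  linear : ∀ t t' e f, e ≠ f → e ∈ b t → f ∈ b t → e ∈ b t' → f ∈ b t' → t = t'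
  degree : ∀ e, (Finset.univ.filter fun t => e ∈ b t).card = D

variable {b : T → Finset E} {lam ζ : ℝ}

lemma partFun_nonneg (hl : 0 ≤ lam) (hζ : ζ ≤ 1) (Q : Finset T) (A : Finset E) :
    0 ≤ partFun b lam ζ Q A := by
  unfold partFun
  refine Finset.sum_nonneg fun S _ => ?_
  split_ifs
  · have : 0 ≤ 1 - ζ := by linarith
    positivity
  · exact le_rfl

lemma partFun_insert_triple [DecidableEq T] {Q : Finset T} {t : T} (ht : t ∉ Q) (A : Finset E) :
    partFun b lam ζ (insert t Q) A = partFun b lam ζ Q A - ζ * partFun b lam ζ Q (A ∪ b t) := by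
  unfold partFun
  rw [Finset.mul_sum, ← Finset.sum_sub_distrib]
  refine Finset.sum_congr rfl fun S _ => ?_
  by_cases hA : A ⊆ S
  · by_cases hb : b t ⊆ S
    · have : (Q.filter fun t => b t ⊆ S).card + 1 =
          ((insert t Q).filter fun t => b t ⊆ S).card := by
        rw [Finset.filter_insert, if_pos hb, Finset.card_insert_of_notMem]
        simp [ht]
      rw [if_pos hA, if_pos hA, if_pos (Finset.union_subset hA hb), ← this]
      ring
    · have h : ¬ (A ∪ b t ⊆ S) := fun h => hb (Finset.union_subset_right h)
      rw [if_pos hA, if_pos hA, if_neg h, Finset.filter_insert, if_neg hb]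
      ring
  · have h : ¬ (A ∪ b t ⊆ S) := fun h => hA (Finset.union_subset_left h)
    simp [hA, h]

lemma partFun_insert_triple_le [DecidableEq T] (hl : 0 ≤ lam) (hζ0 : 0 ≤ ζ) (hζ : ζ ≤ 1)
    {Q : Finset T} {t : T} (ht : t ∉ Q) (A : Finset E) :
    partFun b lam ζ (insert t Q) A ≤ partFun b lam ζ Q A := by
  rw [partFun_insert_triple ht]
  have := mul_nonneg hζ0 (partFun_nonneg (b := b) hl hζ Q (A ∪ b t))
  linarith

lemma partFun_edge_recursion (Q : Finset T) (A : Finset E) (e : E) (he : e ∉ A) :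
    lam * partFun b lam ζ Q A = lam * partFun b lam ζ Q (insert e A) +
      partFun b lam ζ (Q.filter fun t => e ∉ b t) (insert e A) := by
  unfold partFun
  rw [Finset.mul_sum, Finset.mul_sum]
  have key : ∀ F : Finset E → ℝ, ∑ S : Finset E, F S =
      ∑ S ∈ (Finset.univ.erase e).powerset, (F S + F (insert e S)) := by
    intro F
    have h : (Finset.univ : Finset (Finset E)) = (insert e (Finset.univ.erase e)).powerset := by
      rw [Finset.insert_erase (Finset.mem_univ e), Finset.powerset_univ]
    rw [h, Finset.sum_powerset_insert (Finset.notMem_erase e _), Finset.sum_add_distrib]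
  rw [key, key, key, ← Finset.sum_add_distrib]
  refine Finset.sum_congr rfl fun S hS => ?_
  have heS : e ∉ S := by
    intro h
    have := Finset.mem_powerset.1 hS h
    simp at this
  have h1 : ¬ (insert e A ⊆ S) := fun h => heS (h (Finset.mem_insert_self e A))
  have h2 : A ⊆ insert e S ↔ A ⊆ S := by
    rw [Finset.subset_insert_iff_of_notMem he]
  have h3 : insert e A ⊆ insert e S ↔ A ⊆ S := by
    rw [Finset.insert_subset_iff, h2]; simp
  have h4 : ((Q.filter fun t => e ∉ b t).filter fun t => b t ⊆ insert e S) =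
      Q.filter fun t => b t ⊆ S := by
    ext t
    simp only [Finset.mem_filter, and_assoc]
    refine and_congr_right fun _ => ⟨fun h => ?_, fun h => ⟨fun h' => heS (h h'), ?_⟩⟩
    · exact (Finset.subset_insert_iff_of_notMem h.1).1 h.2
    · exact h.trans (Finset.subset_insert e S)
  simp only [h1, h2, h3, h4, if_false, Finset.card_insert_of_notMem heS]
  split_ifs
  · ring
  · ring

lemma partFun_filter_ge (hl : 0 ≤ lam) (hζ0 : 0 ≤ ζ) (hζ : ζ ≤ 1) (Q : Finset T)
    (r : T → Prop) [DecidablePred r] (A : Finset E) :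
    partFun b lam ζ Q A ≤ partFun b lam ζ (Q.filter r) A := by
  unfold partFun
  refine Finset.sum_le_sum fun S _ => ?_
  split_ifs
  · refine mul_le_mul_of_nonneg_left ?_ (by positivity)
    refine pow_le_pow_of_le_one (by linarith) (by linarith) (Finset.card_le_card ?_)
    intro t
    simp only [Finset.mem_filter]
    tauto
  · exact le_rfl

lemma partFun_insert_le (hl : 0 ≤ lam) (hζ0 : 0 ≤ ζ) (hζ : ζ ≤ 1)
    (Q : Finset T) (A : Finset E) (e : E) (he : e ∉ A) :
    partFun b lam ζ Q (insert e A) ≤ lam * partFun b lam ζ Q A := by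
  have h1 := partFun_edge_recursion (b := b) (lam := lam) (ζ := ζ) Q A e he
  have h2 := partFun_filter_ge (b := b) hl hζ0 hζ Q (fun t => e ∉ b t) (insert e A)
  have h3 := mul_nonneg hl (partFun_nonneg (b := b) hl hζ Q (insert e A))
  linarith

lemma marginalLE_lam (hl : 0 ≤ lam) (hζ0 : 0 ≤ ζ) (hζ : ζ ≤ 1) (M : ℕ) :
    MarginalLE b lam ζ M lam :=
  fun Q A e _ _ he => partFun_insert_le hl hζ0 hζ Q A e he

lemma marginalGE_of_nonpos (hl : 0 ≤ lam) (hζ : ζ ≤ 1) (M : ℕ) {x : ℝ} (hx : x ≤ 0) :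
    MarginalGE b lam ζ M x := fun Q A _ _ _ _ _ =>
  (mul_nonpos_of_nonpos_of_nonneg hx (partFun_nonneg hl hζ Q A)).trans (partFun_nonneg hl hζ _ _)

/-- Edges that lie in `A` or close a triple with two elements of `A`. -/
def edgeClosure [Fintype T] (b : T → Finset E) (A : Finset E) : Finset E :=
  A ∪ ((A ×ˢ A).biUnion fun q => (Finset.univ.filter fun t => q.1 ≠ q.2 ∧ q.1 ∈ b t ∧
    q.2 ∈ b t).biUnion b)

lemma card_edgeClosure_le [Fintype T] {D : ℕ} (hb : IsTripleSystem b D) {A : Finset E} {M : ℕ}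
    (hA : A.card ≤ M) : (edgeClosure b A).card ≤ M + 3 * M ^ 2 := by
  unfold edgeClosure
  refine (Finset.card_union_le _ _).trans (add_le_add hA ?_)
  refine (Finset.card_biUnion_le_card_mul _ _ 3 fun q _ => ?_).trans ?_
  · have h1 : (Finset.univ.filter fun t => q.1 ≠ q.2 ∧ q.1 ∈ b t ∧ q.2 ∈ b t).card ≤ 1 := by
      refine Finset.card_le_one.2 fun t ht t' ht' => ?_
      simp only [Finset.mem_filter, Finset.mem_univ, true_and] at ht ht'
      exact hb.linear t t' _ _ ht.1 ht.2.1 ht.2.2 ht'.2.1 ht'.2.2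
    refine (Finset.card_biUnion_le_card_mul _ _ 3 fun t _ => (hb.card_eq t).le).trans ?_
    omega
  · rw [Finset.card_product]
    nlinarith [Nat.mul_le_mul hA hA]

lemma mem_edgeClosure_of_erase_subset [Fintype T] {D : ℕ} (hb : IsTripleSystem b D)
    {A : Finset E} {f : E} {t : T} (hf : f ∈ b t) (h : (b t).erase f ⊆ A) :
    f ∈ edgeClosure b A := by
  have h2 : 1 < ((b t).erase f).card := by
    rw [Finset.card_erase_of_mem hf, hb.card_eq]; norm_num
  obtain ⟨p, hp, q, hq, hpq⟩ := Finset.one_lt_card.1 h2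
  unfold edgeClosure
  refine Finset.mem_union_right _ (Finset.mem_biUnion.2 ⟨(p, q), ?_, ?_⟩)
  · exact Finset.mem_product.2 ⟨h hp, h hq⟩
  · refine Finset.mem_biUnion.2 ⟨t, ?_, hf⟩
    simp only [Finset.mem_filter, Finset.mem_univ, true_and]
    exact ⟨hpq, Finset.mem_of_mem_erase hp, Finset.mem_of_mem_erase hq⟩

lemma exists_triple_eq [Fintype T] {D : ℕ} (hb : IsTripleSystem b D) {t : T} {e : E}
    (he : e ∈ b t) : ∃ f g, e ≠ f ∧ e ≠ g ∧ f ≠ g ∧ b t = {e, f, g} := by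
  have h2 : ((b t).erase e).card = 2 := by
    rw [Finset.card_erase_of_mem he, hb.card_eq]
  obtain ⟨f, g, hfg, h⟩ := Finset.card_eq_two.1 h2
  have hf : f ∈ (b t).erase e := by rw [h]; simp
  have hg : g ∈ (b t).erase e := by rw [h]; simp
  refine ⟨f, g, (Finset.ne_of_mem_erase hf).symm, (Finset.ne_of_mem_erase hg).symm, hfg, ?_⟩
  rw [← h, Finset.insert_erase he]

lemma union_triple_eq {A s : Finset E} {e f g : E} (he : e ∈ A) (hs : s = {e, f, g}) :
    A ∪ s = insert g (insert f A) := by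
  subst hs
  ext z
  simp only [Finset.mem_union, Finset.mem_insert, Finset.mem_singleton]
  constructor
  · rintro (h | h | h | h)
    · tauto
    · subst h; tauto
    · tauto
    · tauto
  · tauto

lemma CoversCompl.mono {Q Q' : Finset T} {A A' : Finset E} (h : CoversCompl b Q A)
    (hA : A ⊆ A') (hQ : ∀ t ∈ Q, t ∉ Q' → ∃ a ∈ A', a ∈ b t) : CoversCompl b Q' A' := by
  intro t ht
  by_cases h' : t ∈ Q
  · exact hQ t h' ht
  · obtain ⟨a, ha, hat⟩ := h t h'
    exact ⟨a, hA ha, hat⟩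

lemma le_partFun_union_triple [Fintype T] {D : ℕ} (hb : IsTripleSystem b D) {M : ℕ} {x : ℝ}
    (hx : 0 ≤ x) (hM : MarginalGE b lam ζ M x) {Q : Finset T} {A : Finset E} {t : T} {e f g : E}
    (hA : A.card + 1 ≤ M) (hQ : CoversCompl b Q A) (htQ : t ∉ Q) (he : e ∈ A)
    (hef : e ≠ f) (heg : e ≠ g) (hfg : f ≠ g) (ht : b t = {e, f, g})
    (hf : f ∉ edgeClosure b (A.erase e)) (hg : g ∉ edgeClosure b (A.erase e)) :
    x ^ 2 * partFun b lam ζ Q A ≤ partFun b lam ζ Q (A ∪ b t) := by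
  have het : e ∈ b t := by rw [ht]; simp
  have hft : f ∈ b t := by rw [ht]; simp
  have hgt : g ∈ b t := by rw [ht]; simp
  have notMem : ∀ z, z ≠ e → z ∉ edgeClosure b (A.erase e) → z ∉ A := fun z hze hz hzA =>
    hz (Finset.mem_union_left _ (Finset.mem_erase.2 ⟨hze, hzA⟩))
  have hfA := notMem f hef.symm hf
  have hgA := notMem g heg.symm hg
  rw [union_triple_eq he ht]
  have h1 : x * partFun b lam ζ Q A ≤ partFun b lam ζ Q (insert f A) := by
    refine hM Q A f (by omega) hQ hfA fun t' ht' hft' hsub => hf ?_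
    refine mem_edgeClosure_of_erase_subset hb hft' fun z hz => Finset.mem_erase.2 ⟨?_, hsub hz⟩
    rintro rfl
    exact htQ (hb.linear t t' _ _ hef het hft (Finset.mem_of_mem_erase hz) hft' ▸ ht')
  have h2 : x * partFun b lam ζ Q (insert f A) ≤ partFun b lam ζ Q (insert g (insert f A)) := by
    refine hM Q (insert f A) g ?_ (hQ.mono (Finset.subset_insert f A) fun _ h h' => absurd h h')
      (by simp [hfg.symm, hgA]) fun t' ht' hgt' hsub => hg ?_
    · rw [Finset.card_insert_of_notMem hfA]; omega
    refine mem_edgeClosure_of_erase_subset hb hgt' fun z hz => ?_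
    have hz' := Finset.mem_of_mem_erase hz
    rcases Finset.mem_insert.1 (hsub hz) with rfl | hzA
    · exact absurd (hb.linear t t' _ _ hfg hft hgt hz' hgt' ▸ ht') htQ
    · refine Finset.mem_erase.2 ⟨?_, hzA⟩
      rintro rfl
      exact htQ (hb.linear t t' _ _ heg het hgt hz' hgt' ▸ ht')
  calc x ^ 2 * partFun b lam ζ Q A = x * (x * partFun b lam ζ Q A) := by ring
    _ ≤ x * partFun b lam ζ Q (insert f A) := mul_le_mul_of_nonneg_left h1 hx
    _ ≤ _ := h2

lemma marginalLE_step [Fintype T] {D : ℕ} (hb : IsTripleSystem b D) (hl : 0 ≤ lam)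
    (hζ0 : 0 ≤ ζ) (hζ : ζ ≤ 1) {M : ℕ} {x : ℝ} (hx : 0 ≤ x) (hx1 : ζ * x ^ 2 ≤ 1)
    (hM : MarginalGE b lam ζ (M + 2) x) :
    MarginalLE b lam ζ M (lam * (1 - ζ * x ^ 2) ^ (D - (M + 3 * M ^ 2))) := by
  classical
  intro Q A e hA hQ he
  set Q0 := Q.filter fun t => e ∉ b t with hQ0
  set B := insert e A with hB
  set r := 1 - ζ * x ^ 2 with hr
  have hr0 : 0 ≤ r := by linarith
  have hr1 : r ≤ 1 := by
    have : 0 ≤ ζ * x ^ 2 := by positivity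
    linarith
  have hBe : B.erase e = A := Finset.erase_insert he
  have hBc : B.card ≤ M + 1 := (Finset.card_insert_le e A).trans (by omega)
  let good : T → Prop := fun t => Disjoint ((b t).erase e) (edgeClosure b A)
  have key : ∀ R : Finset T, R ⊆ Q.filter (fun t => e ∈ b t) →
      partFun b lam ζ (Q0 ∪ R) B ≤ r ^ (R.filter good).card * partFun b lam ζ Q0 B := by
    intro R
    induction R using Finset.induction_on with
    | empty => intro _; simp
    | insert t R htR ih =>
      intro hR
      have ih := ih ((Finset.subset_insert t R).trans hR)
      have ht := Finset.mem_filter.1 (hR (Finset.mem_insert_self t R))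
      have htQ : t ∉ Q0 ∪ R := by simp [hQ0, htR, ht.2]
      rw [Finset.union_insert, Finset.filter_insert]
      split_ifs with hg
      · rw [Finset.card_insert_of_notMem (by simp [htR])]
        obtain ⟨f, g, hef, heg, hfg, hbt⟩ := exists_triple_eq hb ht.2
        have hcov : CoversCompl b (Q0 ∪ R) B := by
          refine hQ.mono (Finset.subset_insert e A) fun t' ht' hn => ⟨e, by simp [hB], ?_⟩
          by_contra h
          exact hn (Finset.mem_union_left _ (Finset.mem_filter.2 ⟨ht', h⟩))
        have hlow := le_partFun_union_triple hb hx hM (by omega) hcov htQ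
          (Finset.mem_insert_self e A) hef heg hfg hbt
          (by rw [hBe]; exact Finset.disjoint_left.1 hg (by simp [hbt, hef.symm]))
          (by rw [hBe]; exact Finset.disjoint_left.1 hg (by simp [hbt, heg.symm]))
        rw [partFun_insert_triple htQ]
        calc _ ≤ r * partFun b lam ζ (Q0 ∪ R) B := by
              rw [hr]; nlinarith [mul_le_mul_of_nonneg_left hlow hζ0]
          _ ≤ r * (r ^ (R.filter good).card * partFun b lam ζ Q0 B) :=
              mul_le_mul_of_nonneg_left ih hr0
          _ = _ := by ring
      · exact (partFun_insert_triple_le hl hζ0 hζ htQ B).trans ih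
  have hunion : Q0 ∪ Q.filter (fun t => e ∈ b t) = Q := by
    rw [Finset.union_comm]; exact Finset.filter_union_filter_not_eq _ _
  have hk := key _ subset_rfl
  rw [hunion] at hk
  have hcard : D - (M + 3 * M ^ 2) ≤ ((Q.filter fun t => e ∈ b t).filter good).card := by
    have h1 : (Finset.univ.filter fun t => e ∈ b t) ⊆
        (Q.filter fun t => e ∈ b t).filter good ∪
        (edgeClosure b A).biUnion (fun f => Finset.univ.filter fun t => e ∈ b t ∧ f ∈ b t ∧ e ≠ f) := by
      intro t ht
      have het := (Finset.mem_filter.1 ht).2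
      by_cases hg : good t
      · refine Finset.mem_union_left _ ?_
        simp only [Finset.mem_filter]
        refine ⟨⟨?_, het⟩, hg⟩
        by_contra htQ
        obtain ⟨a, haA, hat⟩ := hQ t htQ
        refine Finset.disjoint_left.1 hg (Finset.mem_erase.2 ⟨?_, hat⟩)
          (Finset.mem_union_left _ haA)
        rintro rfl
        exact he haA
      · refine Finset.mem_union_right _ ?_
        obtain ⟨f, hf, hfc⟩ := Finset.not_disjoint_iff.1 hg
        refine Finset.mem_biUnion.2 ⟨f, hfc, ?_⟩
        simp only [Finset.mem_filter, Finset.mem_univ, true_and]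
        exact ⟨het, Finset.mem_of_mem_erase hf, (Finset.ne_of_mem_erase hf).symm⟩
    have h2 := (Finset.card_le_card h1).trans (Finset.card_union_le _ _)
    rw [hb.degree] at h2
    have h3 := Finset.card_biUnion_le_card_mul (edgeClosure b A)
      (fun f => Finset.univ.filter fun t => e ∈ b t ∧ f ∈ b t ∧ e ≠ f) 1 (fun f _ => by
        refine Finset.card_le_one.2 fun t ht t' ht' => ?_
        simp only [Finset.mem_filter, Finset.mem_univ, true_and] at ht ht'
        exact hb.linear t t' _ _ ht.2.2 ht.1 ht.2.1 ht'.1 ht'.2.1)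
    have h4 := card_edgeClosure_le hb hA
    omega
  have hZ0 := partFun_nonneg (b := b) hl hζ Q0 B
  have hk2 : partFun b lam ζ Q B ≤ r ^ (D - (M + 3 * M ^ 2)) * partFun b lam ζ Q0 B :=
    hk.trans (mul_le_mul_of_nonneg_right (pow_le_pow_of_le_one hr0 hr1 hcard) hZ0)
  have hrec := partFun_edge_recursion (b := b) (lam := lam) (ζ := ζ) Q A e he
  have h5 : partFun b lam ζ Q0 B ≤ lam * partFun b lam ζ Q A := by
    have := mul_nonneg hl (partFun_nonneg (b := b) hl hζ Q B)
    linarith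
  calc partFun b lam ζ Q B ≤ _ := hk2
    _ ≤ r ^ (D - (M + 3 * M ^ 2)) * (lam * partFun b lam ζ Q A) :=
      mul_le_mul_of_nonneg_left h5 (pow_nonneg hr0 _)
    _ = _ := by ring

lemma marginalGE_step [Fintype T] {D : ℕ} (hb : IsTripleSystem b D) (hl : 0 ≤ lam)
    (hl1 : lam ≤ 1) (hζ0 : 0 ≤ ζ) (hζ : ζ ≤ 1) {M : ℕ} {y : ℝ} (hy : 0 ≤ y)
    (hy1 : ζ * y ^ 2 ≤ 1) (hM : MarginalLE b lam ζ (M + 2) y) :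
    MarginalGE b lam ζ M (lam / (1 + lam) * ((1 - ζ * y ^ 2) ^ D * (1 - ζ * lam) ^ M)) := by
  classical
  intro Q A e hA hQ he hfree
  set Q0 := Q.filter fun t => e ∉ b t with hQ0
  set B := insert e A with hB
  set r := 1 - ζ * y ^ 2 with hr
  set q := 1 - ζ * lam with hq
  have hr0 : 0 ≤ r := by linarith
  have hr1 : r ≤ 1 := by
    have : 0 ≤ ζ * y ^ 2 := by positivity
    linarith
  have hq0 : 0 ≤ q := by nlinarith
  have hq1 : q ≤ 1 := by
    have : 0 ≤ ζ * lam := by positivity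
    linarith
  have hBc : B.card ≤ M + 1 := (Finset.card_insert_le e A).trans (by omega)
  let good : T → Prop := fun t => Disjoint ((b t).erase e) A
  have key : ∀ R : Finset T, R ⊆ Q.filter (fun t => e ∈ b t) →
      r ^ (R.filter good).card * q ^ (R.filter fun t => ¬ good t).card * partFun b lam ζ Q0 B ≤
        partFun b lam ζ (Q0 ∪ R) B := by
    intro R
    induction R using Finset.induction_on with
    | empty => intro _; simp
    | insert t R htR ih =>
      intro hR
      have ih := ih ((Finset.subset_insert t R).trans hR)
      have ht := Finset.mem_filter.1 (hR (Finset.mem_insert_self t R))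
      have htQ : t ∉ Q0 ∪ R := by simp [hQ0, htR, ht.2]
      obtain ⟨f, g, hef, heg, hfg, hbt⟩ := exists_triple_eq hb ht.2
      have hcov : CoversCompl b (Q0 ∪ R) B := by
        refine hQ.mono (Finset.subset_insert e A) fun t' ht' hn => ⟨e, by simp [hB], ?_⟩
        by_contra h
        exact hn (Finset.mem_union_left _ (Finset.mem_filter.2 ⟨ht', h⟩))
      have herase : (b t).erase e = {f, g} := by
        rw [hbt, Finset.erase_insert]; simp [hef, heg]
      rw [Finset.union_insert, Finset.filter_insert, Finset.filter_insert]
      by_cases hg : good t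
      · rw [if_pos hg, if_neg (not_not.2 hg), Finset.card_insert_of_notMem (by simp [htR])]
        have hg' : Disjoint ({f, g} : Finset E) A := herase ▸ hg
        have hfA : f ∉ A := Finset.disjoint_left.1 hg' (by simp)
        have hgA : g ∉ A := Finset.disjoint_left.1 hg' (by simp)
        have hfB : f ∉ B := by simp [hB, hef.symm, hfA]
        have h1 := hM _ _ f (by omega) hcov hfB
        have h2 := hM (Q0 ∪ R) (insert f B) g
          (by rw [Finset.card_insert_of_notMem hfB]; omega)
          (hcov.mono (Finset.subset_insert f B) fun _ h h' => absurd h h')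
          (by simp [hB, hfg.symm, heg.symm, hgA])
        rw [partFun_insert_triple htQ, union_triple_eq (Finset.mem_insert_self e A) hbt]
        have h3 : partFun b lam ζ (Q0 ∪ R) (insert g (insert f B)) ≤
            y ^ 2 * partFun b lam ζ (Q0 ∪ R) B := by
          nlinarith [mul_le_mul_of_nonneg_left h1 hy]
        have h4 := mul_le_mul_of_nonneg_left h3 hζ0
        have h5 := mul_le_mul_of_nonneg_left ih hr0
        rw [pow_succ]
        nlinarith
      · rw [if_neg hg, if_pos hg, Finset.card_insert_of_notMem (by simp [htR])]
        have h3 : partFun b lam ζ (Q0 ∪ R) (B ∪ b t) ≤ lam * partFun b lam ζ (Q0 ∪ R) B := by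
          have hsub := hfree t ht.1 ht.2
          rw [herase] at hsub
          have hg' : ¬ Disjoint ({f, g} : Finset E) A := herase ▸ hg
          rw [union_triple_eq (Finset.mem_insert_self e A) hbt]
          by_cases hfA : f ∈ A
          · have hgA : g ∉ A := fun h => hsub (by
              intro z hz; simp only [Finset.mem_insert, Finset.mem_singleton] at hz
              rcases hz with rfl | rfl <;> assumption)
            rw [Finset.insert_eq_self.2 (Finset.mem_insert_of_mem hfA)]
            exact partFun_insert_le hl hζ0 hζ _ _ _ (by simp [heg.symm, hgA])
          · have hgA : g ∈ A := by
              by_contra h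
              refine hg' (Finset.disjoint_left.2 fun z hz => ?_)
              simp only [Finset.mem_insert, Finset.mem_singleton] at hz
              rcases hz with rfl | rfl <;> assumption
            rw [Finset.insert_eq_self.2
              (Finset.mem_insert_of_mem (Finset.mem_insert_of_mem hgA))]
            exact partFun_insert_le hl hζ0 hζ _ _ _ (by simp [hef.symm, hfA])
        rw [partFun_insert_triple htQ]
        have h4 := mul_le_mul_of_nonneg_left h3 hζ0
        have h5 := mul_le_mul_of_nonneg_left ih hq0
        rw [pow_succ]
        nlinarith
  have hunion : Q0 ∪ Q.filter (fun t => e ∈ b t) = Q := by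
    rw [Finset.union_comm]; exact Finset.filter_union_filter_not_eq _ _
  have hk := key _ subset_rfl
  rw [hunion] at hk
  have hcard1 : ((Q.filter fun t => e ∈ b t).filter good).card ≤ D := by
    rw [← hb.degree e]
    refine Finset.card_le_card fun t ht => ?_
    simp only [Finset.mem_filter, Finset.mem_univ, true_and] at ht ⊢
    exact ht.1.2
  have hcard2 : ((Q.filter fun t => e ∈ b t).filter fun t => ¬ good t).card ≤ M := by
    have h1 : ((Q.filter fun t => e ∈ b t).filter fun t => ¬ good t) ⊆
        A.biUnion (fun f => Finset.univ.filter fun t => e ∈ b t ∧ f ∈ b t ∧ e ≠ f) := by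
      intro t ht
      simp only [Finset.mem_filter] at ht
      obtain ⟨f, hf, hfc⟩ := Finset.not_disjoint_iff.1 ht.2
      refine Finset.mem_biUnion.2 ⟨f, hfc, ?_⟩
      simp only [Finset.mem_filter, Finset.mem_univ, true_and]
      exact ⟨ht.1.2, Finset.mem_of_mem_erase hf, (Finset.ne_of_mem_erase hf).symm⟩
    have h3 := Finset.card_biUnion_le_card_mul A
      (fun f => Finset.univ.filter fun t => e ∈ b t ∧ f ∈ b t ∧ e ≠ f) 1 (fun f _ => by
        refine Finset.card_le_one.2 fun t ht t' ht' => ?_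
        simp only [Finset.mem_filter, Finset.mem_univ, true_and] at ht ht'
        exact hb.linear t t' _ _ ht.2.2 ht.1 ht.2.1 ht'.1 ht'.2.1)
    have h4 := Finset.card_le_card h1
    omega
  have hZ0 := partFun_nonneg (b := b) hl hζ Q0 B
  set P := r ^ D * q ^ M with hP
  have hP0 : 0 ≤ P := by positivity
  have hP1 : P ≤ 1 := mul_le_one₀ (pow_le_one₀ hr0 hr1) (pow_nonneg hq0 _) (pow_le_one₀ hq0 hq1)
  have hk2 : P * partFun b lam ζ Q0 B ≤ partFun b lam ζ Q B := by
    refine le_trans (mul_le_mul_of_nonneg_right ?_ hZ0) hk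
    exact mul_le_mul (pow_le_pow_of_le_one hr0 hr1 hcard1)
      (pow_le_pow_of_le_one hq0 hq1 hcard2) (by positivity) (by positivity)
  have hrec := partFun_edge_recursion (b := b) (lam := lam) (ζ := ζ) Q A e he
  have hZB := partFun_nonneg (b := b) hl hζ Q B
  have h5 : partFun b lam ζ Q0 B = lam * (partFun b lam ζ Q A - partFun b lam ζ Q B) := by
    linarith
  rw [h5] at hk2
  rw [div_mul_eq_mul_div, div_mul_eq_mul_div, div_le_iff₀ (by linarith)]
  nlinarith [mul_le_mul_of_nonneg_right hP1 (mul_nonneg hl hZB)]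

lemma partFun_triple_le [Fintype T] [DecidableEq T] {D : ℕ} (hb : IsTripleSystem b D)
    (hl : 0 ≤ lam) (hl1 : lam ≤ 1) (hζ0 : 0 ≤ ζ) (hζ : ζ ≤ 1) {y : ℝ} (hy : 0 ≤ y)
    (hM : MarginalLE b lam ζ 2 y) (t : T) :
    (1 - lam ^ 2) * partFun b lam ζ (Finset.univ.erase t) (b t) ≤
      y ^ 3 * partFun b lam ζ Finset.univ ∅ := by
  obtain ⟨e, he⟩ : (b t).Nonempty := by
    rw [← Finset.card_pos, hb.card_eq]; norm_num
  obtain ⟨f, g, hef, heg, hfg, hbt⟩ := exists_triple_eq hb he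
  have hcov : CoversCompl b (Finset.univ.erase t) {e} := fun t' ht' => ⟨e, by simp, by
    have : t' = t := by simpa using ht'
    rwa [this]⟩
  have hun : ({e} : Finset E) ∪ b t = insert g (insert f {e}) := union_triple_eq (by simp) hbt
  have hun' : ({e} : Finset E) ∪ b t = b t := Finset.union_eq_right.2 (by simpa using he)
  have hfe : f ∉ ({e} : Finset E) := by simpa using hef.symm
  have hge : g ∉ insert f ({e} : Finset E) := by simp [hfg.symm, heg.symm]
  have hcov2 : CoversCompl b (Finset.univ.erase t) (insert f {e}) :=
    hcov.mono (Finset.subset_insert _ _) fun _ h h' => absurd h h'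
  have hcard2 : (insert f ({e} : Finset E)).card ≤ 2 := Finset.card_le_two
  have two : ∀ z, 0 ≤ z → MarginalLE b lam ζ 2 z →
      partFun b lam ζ (Finset.univ.erase t) (b t) ≤
        z ^ 2 * partFun b lam ζ (Finset.univ.erase t) {e} := by
    intro z hz hMz
    have h1 := hMz _ _ f (by simp) hcov hfe
    have h2 := hMz _ _ g hcard2 hcov2 hge
    rw [← hun', hun]
    nlinarith [mul_le_mul_of_nonneg_left h1 hz]
  have h1 := two y hy hM
  have h2 := two lam hl (marginalLE_lam hl hζ0 hζ 2)
  have h3 := hM Finset.univ ∅ e (by simp) (fun t h => absurd (Finset.mem_univ t) h) (by simp)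
  have h4 := partFun_insert_triple (b := b) (lam := lam) (ζ := ζ)
    (Finset.notMem_erase t Finset.univ) {e}
  rw [Finset.insert_erase (Finset.mem_univ t), hun'] at h4
  have h5 : partFun b lam ζ Finset.univ {e} ≤ y * partFun b lam ζ Finset.univ ∅ := by
    simpa using h3
  have h0 := partFun_nonneg (b := b) hl hζ (Finset.univ.erase t) {e}
  have h0' := partFun_nonneg (b := b) hl hζ (Finset.univ.erase t) (b t)
  have h6 : (1 - lam ^ 2) * partFun b lam ζ (Finset.univ.erase t) {e} ≤
      partFun b lam ζ Finset.univ {e} := by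
    nlinarith [mul_le_mul_of_nonneg_right hζ h0']
  calc (1 - lam ^ 2) * partFun b lam ζ (Finset.univ.erase t) (b t)
      ≤ (1 - lam ^ 2) * (y ^ 2 * partFun b lam ζ (Finset.univ.erase t) {e}) :=
        mul_le_mul_of_nonneg_left h1 (by nlinarith)
    _ = y ^ 2 * ((1 - lam ^ 2) * partFun b lam ζ (Finset.univ.erase t) {e}) := by ring
    _ ≤ y ^ 2 * (y * partFun b lam ζ Finset.univ ∅) :=
        mul_le_mul_of_nonneg_left (h6.trans h5) (by positivity)
    _ = _ := by ring

lemma le_partFun_triple [Fintype T] [DecidableEq T] {D : ℕ} (hb : IsTripleSystem b D)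
    (hl : 0 ≤ lam) (hζ0 : 0 ≤ ζ) (hζ : ζ ≤ 1) {x : ℝ} (hx : 0 ≤ x)
    (hM : MarginalGE b lam ζ 2 x) (t : T) :
    x ^ 3 * partFun b lam ζ Finset.univ ∅ ≤ partFun b lam ζ (Finset.univ.erase t) (b t) := by
  obtain ⟨e, he⟩ : (b t).Nonempty := by
    rw [← Finset.card_pos, hb.card_eq]; norm_num
  obtain ⟨f, g, hef, heg, hfg, hbt⟩ := exists_triple_eq hb he
  have hcov : CoversCompl b (Finset.univ.erase t) {e} := fun t' ht' => ⟨e, by simp, by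
    have : t' = t := by simpa using ht'
    rwa [this]⟩
  have hun' : ({e} : Finset E) ∪ b t = b t := Finset.union_eq_right.2 (by simpa using he)
  have hcl : edgeClosure b (({e} : Finset E).erase e) = ∅ := by simp [edgeClosure]
  have h1 := le_partFun_union_triple hb hx hM (A := {e}) (by simp) hcov
    (Finset.notMem_erase t _) (by simp) hef heg hfg hbt (by rw [hcl]; simp) (by rw [hcl]; simp)
  rw [hun'] at h1
  have h3 := hM Finset.univ ∅ e (by simp) (fun t h => absurd (Finset.mem_univ t) h) (by simp)
    (fun t' _ het' hsub => by
      have := Finset.card_le_card hsub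
      rw [Finset.card_erase_of_mem het', hb.card_eq] at this
      simp at this)
  have h4 := partFun_insert_triple_le (b := b) hl hζ0 hζ (Finset.notMem_erase t Finset.univ) {e}
  rw [Finset.insert_erase (Finset.mem_univ t)] at h4
  have h5 : x * partFun b lam ζ Finset.univ ∅ ≤ partFun b lam ζ Finset.univ {e} := by
    simpa using h3
  calc x ^ 3 * partFun b lam ζ Finset.univ ∅
      = x ^ 2 * (x * partFun b lam ζ Finset.univ ∅) := by ring
    _ ≤ x ^ 2 * partFun b lam ζ (Finset.univ.erase t) {e} :=
        mul_le_mul_of_nonneg_left (h5.trans h4) (by positivity)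
    _ ≤ _ := h1

lemma hasDerivAt_partFun [Fintype T] [DecidableEq T] (b : T → Finset E) (lam ζ : ℝ) :
    HasDerivAt (fun z => partFun b lam z Finset.univ ∅)
      (-∑ t, partFun b lam ζ (Finset.univ.erase t) (b t)) ζ := by
  unfold partFun
  simp only [Finset.empty_subset, if_true]
  rw [Finset.sum_comm, ← Finset.sum_neg_distrib]
  refine HasDerivAt.fun_sum fun S _ => ?_
  set X := (Finset.univ.filter fun t => b t ⊆ S).card with hX
  have h1 : HasDerivAt (fun z : ℝ => lam ^ S.card * (1 - z) ^ X)
      (lam ^ S.card * ((X : ℝ) * (1 - ζ) ^ (X - 1) * (-1))) ζ :=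
    (((hasDerivAt_id ζ).const_sub 1).pow X).const_mul _
  refine h1.congr_deriv ?_
  rw [← Finset.sum_filter]
  have h2 : ∀ t ∈ Finset.univ.filter (fun t => b t ⊆ S),
      lam ^ S.card * (1 - ζ) ^ ((Finset.univ.erase t).filter fun t => b t ⊆ S).card =
      lam ^ S.card * (1 - ζ) ^ (X - 1) := by
    intro t ht
    rw [Finset.filter_erase, Finset.card_erase_of_mem ht]
  rw [Finset.sum_congr rfl h2, Finset.sum_const, nsmul_eq_mul, ← hX]
  ring

lemma one_le_partFun (hl : 0 ≤ lam) (hζ : ζ ≤ 1) (hbne : ∀ t, (b t).Nonempty) (Q : Finset T) :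
    1 ≤ partFun b lam ζ Q ∅ := by
  unfold partFun
  have h0 : 0 ≤ 1 - ζ := by linarith
  have := Finset.single_le_sum (s := Finset.univ)
    (f := fun S : Finset E => if ∅ ⊆ S then lam ^ S.card *
      (1 - ζ) ^ (Q.filter fun t => b t ⊆ S).card else 0)
    (fun S _ => by split_ifs <;> positivity) (Finset.mem_univ ∅)
  refine le_trans (le_of_eq ?_) this
  have h1 : (Q.filter fun t => b t ⊆ (∅ : Finset E)) = ∅ := by
    refine Finset.filter_eq_empty_iff.2 fun t _ h => ?_
    exact (hbne t).ne_empty (Finset.subset_empty.1 h)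
  rw [if_pos subset_rfl, h1]
  simp

end Hypergraph

section Triangles

/-- Two-element sets of vertices. -/
abbrev VertexPair (n : ℕ) := {e : Finset (Fin n) // e.card = 2}

/-- Three-element sets of vertices. -/
abbrev VertexTriple (n : ℕ) := {s : Finset (Fin n) // s.card = 3}

/-- The pairs contained in a triple of vertices. -/
def triplePairs (n : ℕ) (s : VertexTriple n) : Finset (VertexPair n) :=
  Finset.univ.filter fun e => e.1 ⊆ s.1

lemma mem_triplePairs {n : ℕ} {s : VertexTriple n} {e : VertexPair n} :
    e ∈ triplePairs n s ↔ e.1 ⊆ s.1 := by simp [triplePairs]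

lemma isTripleSystem_triplePairs (n : ℕ) : IsTripleSystem (triplePairs n) (n - 2) where
  card_eq s := by
    have h : (triplePairs n s).map (Function.Embedding.subtype _) = s.1.powersetCard 2 := by
      ext e
      simp [mem_triplePairs, Finset.mem_powersetCard, and_comm]
    rw [← Finset.card_map, h, Finset.card_powersetCard, s.2]
    rfl
  linear := by
    intro t t' e f hef he hf he' hf'
    rw [mem_triplePairs] at he hf he' hf'
    have key : ∀ s : VertexTriple n, e.1 ⊆ s.1 → f.1 ⊆ s.1 → e.1 ∪ f.1 = s.1 := by
      intro s hes hfs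
      refine Finset.eq_of_subset_of_card_le (Finset.union_subset hes hfs) ?_
      rw [s.2]
      by_contra h
      have h1 : e.1 = e.1 ∪ f.1 :=
        Finset.eq_of_subset_of_card_le Finset.subset_union_left (by rw [e.2]; omega)
      have h2 : f.1 = e.1 ∪ f.1 :=
        Finset.eq_of_subset_of_card_le Finset.subset_union_right (by rw [f.2]; omega)
      exact hef (Subtype.ext (h1.trans h2.symm))
    exact Subtype.ext ((key t he hf).symm.trans (key t' he' hf'))
  degree := by
    intro e
    have h : (Finset.univ.filter fun t => e ∈ triplePairs n t).map
        (Function.Embedding.subtype _) = (Finset.univ \ e.1).image (fun v => insert v e.1) := by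
      ext s
      simp only [Finset.mem_map, Finset.mem_filter, Finset.mem_univ, true_and, mem_triplePairs,
        Finset.mem_image, Finset.mem_sdiff, Function.Embedding.subtype_apply]
      constructor
      · rintro ⟨t, het, rfl⟩
        obtain ⟨v, hv, hve⟩ := Finset.exists_eq_insert_iff.2 ⟨het, by rw [e.2, t.2]⟩
        exact ⟨v, hv, hve⟩
      · rintro ⟨v, hv, rfl⟩
        exact ⟨⟨insert v e.1, by rw [Finset.card_insert_of_notMem hv, e.2]⟩,
          Finset.subset_insert v e.1, rfl⟩
    rw [← Finset.card_map, h, Finset.card_image_of_injOn, Finset.card_sdiff_of_subset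
      (Finset.subset_univ _), e.2, Finset.card_univ, Fintype.card_fin]
    intro v hv w hw hvw
    have hv' : v ∉ e.1 := by simpa using hv
    have h1 : v ∈ insert w e.1 := by rw [← show insert v e.1 = insert w e.1 from hvw]; simp
    rcases Finset.mem_insert.1 h1 with h2 | h2
    · exact h2
    · exact absurd h2 hv'

lemma triplePairs_nonempty {n : ℕ} (t : VertexTriple n) : (triplePairs n t).Nonempty := by
  rw [← Finset.card_pos, (isTripleSystem_triplePairs n).card_eq]
  norm_num

lemma card_vertexTriple (n : ℕ) : Fintype.card (VertexTriple n) = n.choose 3 := by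
  rw [Fintype.card_finset_len, Fintype.card_fin]

lemma card_vertexPair (n : ℕ) : Fintype.card (VertexPair n) = n.choose 2 := by
  rw [Fintype.card_finset_len, Fintype.card_fin]

/-- The set of pairs spanned by the edges of a graph. -/
def pairSet {n : ℕ} (G : SimpleGraph (Fin n)) : Finset (VertexPair n) :=
  Finset.univ.filter fun e => ∀ u ∈ e.1, ∀ v ∈ e.1, u ≠ v → G.Adj u v

lemma pair_mem_pairSet {n : ℕ} {G : SimpleGraph (Fin n)} {u v : Fin n} (huv : u ≠ v) :
    (⟨{u, v}, Finset.card_pair huv⟩ : VertexPair n) ∈ pairSet G ↔ G.Adj u v := by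
  simp only [pairSet, Finset.mem_filter, Finset.mem_univ, true_and, Finset.mem_insert,
    Finset.mem_singleton]
  constructor
  · intro h
    exact h u (Or.inl rfl) v (Or.inr rfl) huv
  · rintro h a (rfl | rfl) c (rfl | rfl) hac
    · exact absurd rfl hac
    · exact h
    · exact h.symm
    · exact absurd rfl hac

lemma pairSet_bijective (n : ℕ) : Function.Bijective (pairSet (n := n)) := by
  constructor
  · intro G H h
    ext u v
    by_cases huv : u = v
    · subst huv; simp
    · rw [← pair_mem_pairSet huv, ← pair_mem_pairSet huv, h]
  · intro S
    refine ⟨SimpleGraph.fromRel fun u v => ∃ e ∈ S, e.1 = {u, v}, ?_⟩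
    ext e
    obtain ⟨u, v, huv, he⟩ := Finset.card_eq_two.1 e.2
    have he' : e = ⟨{u, v}, Finset.card_pair huv⟩ := Subtype.ext he
    subst he'
    rw [pair_mem_pairSet huv, SimpleGraph.fromRel_adj]
    constructor
    · rintro ⟨-, ⟨e, he, h⟩ | ⟨e, he, h⟩⟩
      · exact (Subtype.ext h : e = ⟨{u, v}, Finset.card_pair huv⟩) ▸ he
      · exact (Subtype.ext (h.trans (Finset.pair_comm v u)) :
          e = ⟨{u, v}, Finset.card_pair huv⟩) ▸ he
    · exact fun h => ⟨huv, Or.inl ⟨_, h, rfl⟩⟩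

lemma card_pairSet {n : ℕ} (G : SimpleGraph (Fin n)) : (pairSet G).card = edgeCount G := by
  unfold edgeCount
  rw [Nat.card_eq_fintype_card, ← SimpleGraph.edgeFinset_card]
  symm
  refine Finset.card_bij (fun e he => ⟨e.toFinset, Sym2.card_toFinset_of_not_isDiag e
    (G.not_isDiag_of_mem_edgeSet (SimpleGraph.mem_edgeFinset.1 he))⟩) ?_ ?_ ?_
  · intro e he
    simp only [pairSet, Finset.mem_filter, Finset.mem_univ, true_and, Sym2.mem_toFinset]
    intro u hu v hv huv
    rw [(Sym2.mem_and_mem_iff huv).1 ⟨hu, hv⟩] at he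
    simpa using he
  · intro e he e' he' h
    have h' : e.toFinset = e'.toFinset := congrArg Subtype.val h
    refine Sym2.ext fun x => ?_
    rw [← Sym2.mem_toFinset, h', Sym2.mem_toFinset]
  · intro e he
    obtain ⟨u, v, huv, h⟩ := Finset.card_eq_two.1 e.2
    have he' : e = ⟨{u, v}, Finset.card_pair huv⟩ := Subtype.ext h
    subst he'
    refine ⟨s(u, v), ?_, Subtype.ext ?_⟩
    · simpa using (pair_mem_pairSet huv).1 he
    · exact Sym2.toFinset_mk_eq

lemma card_triplePairs_subset {n : ℕ} (G : SimpleGraph (Fin n)) :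
    (Finset.univ.filter fun t => triplePairs n t ⊆ pairSet G).card = triCount G := by
  unfold triCount
  have h : ∀ s : Finset (Fin n), (∃ hs : s.card = 3, triplePairs n ⟨s, hs⟩ ⊆ pairSet G) ↔
      G.IsNClique 3 s := by
    intro s
    rw [SimpleGraph.isNClique_iff, SimpleGraph.isClique_iff]
    constructor
    · rintro ⟨hs, h⟩
      refine ⟨fun u hu v hv huv => ?_, hs⟩
      refine (pair_mem_pairSet huv).1 (h (mem_triplePairs.2 ?_))
      intro z hz
      simp only [Finset.mem_insert, Finset.mem_singleton] at hz
      rcases hz with rfl | rfl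
      · exact hu
      · exact hv
    · rintro ⟨h, hs⟩
      refine ⟨hs, fun e he => ?_⟩
      have he := mem_triplePairs.1 he
      simp only [pairSet, Finset.mem_filter, Finset.mem_univ, true_and]
      exact fun u hu v hv huv => h (he hu) (he hv) huv
  rw [Nat.card_eq_fintype_card, Fintype.card_subtype, ← Finset.card_map
    (Function.Embedding.subtype _)]
  congr 1
  ext s
  rw [Finset.mem_filter, ← h s]
  simp

end Triangles

section Asymptotics

lemma le_fixedPoint_of_le {c s a x y : ℝ} (ha : 0 < a) (hs : 0 ≤ s)
    (hsc : 2 * (s * c ^ 2) ≤ 1) (hac : a = c * Real.exp (-(s * a ^ 2)))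
    (hx : 0 ≤ x) (hy : 0 ≤ y) (hyx : y ≤ c * Real.exp (-(s * x ^ 2)))
    (hxy : c * Real.exp (-(s * y ^ 2)) ≤ x) : y ≤ a ∧ a ≤ x := by
  have hc : 0 < c := by
    by_contra h
    have : c * Real.exp (-(s * a ^ 2)) ≤ 0 :=
      mul_nonpos_of_nonpos_of_nonneg (not_lt.1 h) (Real.exp_pos _).le
    linarith
  have hmono : ∀ {u v : ℝ}, 0 ≤ u → u ≤ v →
      c * Real.exp (-(s * v ^ 2)) ≤ c * Real.exp (-(s * u ^ 2)) := by
    intro u v hu huv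
    gcongr
  suffices hya : y ≤ a from ⟨hya, by
    have := hmono hy hya
    linarith⟩
  by_contra! h
  have hxa : x < a := by
    by_contra! h'
    have := hmono ha.le h'
    linarith
  have hx0 : 0 < x := lt_of_lt_of_le (by positivity) hxy
  have hy0 : 0 < y := ha.trans h
  have hyc : y ≤ c := hyx.trans (by
    have : Real.exp (-(s * x ^ 2)) ≤ 1 := Real.exp_le_one_iff.2 (by
      have : 0 ≤ s * x ^ 2 := by positivity
      linarith)
    nlinarith)
  have h1 : Real.log y ≤ Real.log c - s * x ^ 2 := by
    have := Real.log_le_log hy0 hyx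
    rw [Real.log_mul hc.ne' (Real.exp_pos _).ne', Real.log_exp] at this
    linarith
  have h2 : Real.log c - s * y ^ 2 ≤ Real.log x := by
    have := Real.log_le_log (by positivity) hxy
    rw [Real.log_mul hc.ne' (Real.exp_pos _).ne', Real.log_exp] at this
    linarith
  have hxy' : x < y := hxa.trans h
  have hq : x ^ 2 / y ^ 2 ≠ 1 := by
    rw [Ne, div_eq_one_iff_eq (by positivity)]
    nlinarith
  have h3 := Real.log_lt_sub_one_of_pos (x := x ^ 2 / y ^ 2) (by positivity) hq
  rw [Real.log_div (by positivity) (by positivity), Real.log_pow, Real.log_pow] at h3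
  push_cast at h3
  have h4 : 2 * s * y ^ 2 ≤ 1 := by
    nlinarith [mul_le_mul_of_nonneg_left (pow_le_pow_left₀ hy hyc 2) hs]
  have h5 : 2 * s * (y ^ 2 - x ^ 2) ≤ 1 - x ^ 2 / y ^ 2 := by
    rw [le_sub_iff_add_le, ← le_sub_iff_add_le', div_le_iff₀ (by positivity)]
    nlinarith [mul_nonneg (sub_nonneg.2 h4) (sub_nonneg.2 (pow_le_pow_left₀ hx hxy'.le 2))]
  nlinarith

/-- Asymptotic upper bound `y / √n` on conditional marginals. -/
def EventuallyLE (lam : ℕ → ℝ) (ζ y : ℝ) : Prop :=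
  ∀ M, ∀ y' > y, ∀ᶠ n : ℕ in atTop, MarginalLE (triplePairs n) (lam n) ζ M (y' / √n)

/-- Asymptotic lower bound `x / √n` on conditional marginals. -/
def EventuallyGE (lam : ℕ → ℝ) (ζ x : ℝ) : Prop :=
  ∀ M, ∀ x' < x, ∀ᶠ n : ℕ in atTop, MarginalGE (triplePairs n) (lam n) ζ M (x' / √n)

variable {E T : Type*} [Fintype E] [DecidableEq E] {b : T → Finset E}

lemma MarginalLE.mono {l ζ : ℝ} {M : ℕ} {y y' : ℝ} (h : MarginalLE b l ζ M y) (hl : 0 ≤ l)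
    (hζ : ζ ≤ 1) (hy : y ≤ y') : MarginalLE b l ζ M y' := fun Q A e h1 h2 h3 =>
  (h Q A e h1 h2 h3).trans (mul_le_mul_of_nonneg_right hy (partFun_nonneg hl hζ Q A))

lemma MarginalGE.mono {l ζ : ℝ} {M : ℕ} {x x' : ℝ} (h : MarginalGE b l ζ M x) (hl : 0 ≤ l)
    (hζ : ζ ≤ 1) (hx : x' ≤ x) : MarginalGE b l ζ M x' := fun Q A e h1 h2 h3 h4 =>
  (mul_le_mul_of_nonneg_right hx (partFun_nonneg hl hζ Q A)).trans (h Q A e h1 h2 h3 h4)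

lemma tendsto_one_sub_div_pow (u : ℝ) :
    Tendsto (fun n : ℕ => (1 - u / n) ^ n) atTop (nhds (Real.exp (-u))) := by
  have := Real.tendsto_one_add_div_pow_exp (-u)
  refine this.congr fun n => ?_
  rw [neg_div, ← sub_eq_add_neg]

lemma tendsto_one_sub_div (u : ℝ) :
    Tendsto (fun n : ℕ => 1 - u / n) atTop (nhds 1) := by
  simpa using (tendsto_const_div_atTop_nhds_zero_nat u).const_sub 1

lemma tendsto_one_sub_div_pow_sub (u : ℝ) (k : ℕ) :
    Tendsto (fun n : ℕ => (1 - u / n) ^ (n - k)) atTop (nhds (Real.exp (-u))) := by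
  have h1 := (tendsto_one_sub_div_pow u).div ((tendsto_one_sub_div u).pow k) (by simp)
  simp only [one_pow, div_one] at h1
  refine h1.congr' ?_
  filter_upwards [eventually_ge_atTop k, (tendsto_one_sub_div u).eventually_ne one_ne_zero]
    with n hn hne
  simp only [Pi.div_apply]
  rw [div_eq_iff (pow_ne_zero _ hne), ← pow_add, Nat.sub_add_cancel hn]

variable {lam : ℕ → ℝ} {c ζ : ℝ}

lemma tendsto_zero_of_sqrt_mul (hlc : Tendsto (fun n : ℕ => √n * lam n) atTop (nhds c)) :
    Tendsto lam atTop (nhds 0) := by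
  have h1 : Tendsto (fun n : ℕ => (√n)⁻¹) atTop (nhds 0) :=
    (Real.tendsto_sqrt_atTop.comp tendsto_natCast_atTop_atTop).inv_tendsto_atTop
  have := h1.mul hlc
  rw [zero_mul] at this
  refine this.congr' ?_
  filter_upwards [eventually_gt_atTop 0] with n hn
  have : √(n : ℝ) ≠ 0 := (Real.sqrt_pos.2 (by exact_mod_cast hn)).ne'
  field_simp

lemma eventuallyLE_step (hl : ∀ n, 0 < lam n) (hζ0 : 0 ≤ ζ) (hζ : ζ ≤ 1)
    (hlc : Tendsto (fun n : ℕ => √n * lam n) atTop (nhds c)) {x : ℝ} (hx : 0 ≤ x)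
    (h : EventuallyGE lam ζ x) : EventuallyLE lam ζ (c * Real.exp (-(ζ * x ^ 2))) := by
  intro M y' hy'
  have hcont : Tendsto (fun z : ℝ => c * Real.exp (-(ζ * (max z 0) ^ 2))) (nhdsWithin x (Set.Iio x))
      (nhds (c * Real.exp (-(ζ * x ^ 2)))) := by
    have : Continuous fun z : ℝ => c * Real.exp (-(ζ * (max z 0) ^ 2)) := by fun_prop
    have h1 := this.tendsto x
    rw [max_eq_left hx] at h1
    exact h1.mono_left nhdsWithin_le_nhds
  obtain ⟨z, hzy, hzx⟩ := ((hcont.eventually (gt_mem_nhds hy')).and self_mem_nhdsWithin).exists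
  set w := max z 0 with hw
  have hw0 : 0 ≤ w := le_max_right _ _
  have hlim : Tendsto (fun n : ℕ => (√n * lam n) *
      (1 - ζ * w ^ 2 / n) ^ (n - (2 + ((M : ℕ) + 3 * M ^ 2)))) atTop
      (nhds (c * Real.exp (-(ζ * w ^ 2)))) :=
    hlc.mul (tendsto_one_sub_div_pow_sub _ _)
  filter_upwards [h (M + 2) z hzx, hlim.eventually (gt_mem_nhds hzy),
    (tendsto_one_sub_div (ζ * w ^ 2)).eventually (lt_mem_nhds one_pos), eventually_gt_atTop 0]
    with n hn1 hn2 hn3 hn4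
  have hn0 : (0 : ℝ) < n := by exact_mod_cast hn4
  have hsq : (0 : ℝ) < √n := Real.sqrt_pos.2 hn0
  have hGE : MarginalGE (triplePairs n) (lam n) ζ (M + 2) (w / √n) := by
    rcases le_total z 0 with hz | hz
    · rw [hw, max_eq_right hz]
      exact marginalGE_of_nonpos (hl n).le hζ _ (by simp)
    · rwa [hw, max_eq_left hz]
  have heq : ζ * (w / √n) ^ 2 = ζ * w ^ 2 / n := by
    rw [div_pow, Real.sq_sqrt hn0.le]; ring
  have hstep := marginalLE_step (isTripleSystem_triplePairs n) (hl n).le hζ0 hζ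
    (div_nonneg hw0 hsq.le) (by rw [heq]; linarith) hGE
  refine hstep.mono (hl n).le hζ ?_
  rw [heq, Nat.sub_sub, le_div_iff₀ hsq]
  calc _ = (√n * lam n) * (1 - ζ * w ^ 2 / n) ^ (n - (2 + ((M : ℕ) + 3 * M ^ 2))) := by ring
    _ ≤ y' := hn2.le

lemma eventuallyGE_step (hl : ∀ n, 0 < lam n) (hζ0 : 0 ≤ ζ) (hζ : ζ ≤ 1)
    (hlc : Tendsto (fun n : ℕ => √n * lam n) atTop (nhds c)) {y : ℝ} (hy : 0 ≤ y)
    (h : EventuallyLE lam ζ y) : EventuallyGE lam ζ (c * Real.exp (-(ζ * y ^ 2))) := by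
  intro M x' hx'
  have hcont : Tendsto (fun z : ℝ => c * Real.exp (-(ζ * z ^ 2))) (nhdsWithin y (Set.Ioi y))
      (nhds (c * Real.exp (-(ζ * y ^ 2)))) := by
    have : Continuous fun z : ℝ => c * Real.exp (-(ζ * z ^ 2)) := by fun_prop
    exact (this.tendsto y).mono_left nhdsWithin_le_nhds
  obtain ⟨w, hwx, hwy⟩ := ((hcont.eventually (lt_mem_nhds hx')).and self_mem_nhdsWithin).exists
  have hw0 : 0 ≤ w := hy.trans (le_of_lt hwy)
  have hl0 := tendsto_zero_of_sqrt_mul hlc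
  have hlim : Tendsto (fun n : ℕ => (√n * lam n) / (1 + lam n) *
      ((1 - ζ * w ^ 2 / n) ^ (n - 2) * (1 - ζ * lam n) ^ M)) atTop
      (nhds (c / (1 + 0) * (Real.exp (-(ζ * w ^ 2)) * (1 - ζ * 0) ^ M))) :=
    (hlc.div (hl0.const_add 1) (by norm_num)).mul
      ((tendsto_one_sub_div_pow_sub _ _).mul (((hl0.const_mul ζ).const_sub 1).pow M))
  simp only [add_zero, div_one, mul_zero, sub_zero, one_pow, mul_one] at hlim
  filter_upwards [h (M + 2) w hwy, hlim.eventually (lt_mem_nhds hwx),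
    (tendsto_one_sub_div (ζ * w ^ 2)).eventually (lt_mem_nhds one_pos), eventually_gt_atTop 0,
    hl0.eventually (gt_mem_nhds one_pos)]
    with n hn1 hn2 hn3 hn4 hn5
  have hn0 : (0 : ℝ) < n := by exact_mod_cast hn4
  have hsq : (0 : ℝ) < √n := Real.sqrt_pos.2 hn0
  have heq : ζ * (w / √n) ^ 2 = ζ * w ^ 2 / n := by
    rw [div_pow, Real.sq_sqrt hn0.le]; ring
  have hstep := marginalGE_step (isTripleSystem_triplePairs n) (hl n).le hn5.le hζ0 hζ
    (div_nonneg hw0 hsq.le) (by rw [heq]; linarith) hn1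
  refine hstep.mono (hl n).le hζ ?_
  rw [heq, div_le_iff₀ hsq]
  refine hn2.le.trans (le_of_eq ?_)
  ring

lemma eventually_marginals (hl : ∀ n, 0 < lam n) (hζ0 : 0 ≤ ζ) (hζ : ζ ≤ 1)
    (hlc : Tendsto (fun n : ℕ => √n * lam n) atTop (nhds c)) {a : ℝ} (ha : 0 < a)
    (hζc : 2 * (ζ * c ^ 2) ≤ 1) (hac : a = c * Real.exp (-(ζ * a ^ 2))) :
    EventuallyLE lam ζ a ∧ EventuallyGE lam ζ a := by
  have hc : 0 ≤ c := ge_of_tendsto' hlc fun n => mul_nonneg (Real.sqrt_nonneg _) (hl n).le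
  set SY := {y : ℝ | 0 ≤ y ∧ EventuallyLE lam ζ y} with hSY
  set SX := {x : ℝ | 0 ≤ x ∧ EventuallyGE lam ζ x} with hSX
  have h0X : (0 : ℝ) ∈ SX := by
    refine ⟨le_rfl, fun M x' hx' => Eventually.of_forall fun n => ?_⟩
    exact marginalGE_of_nonpos (hl n).le hζ _ (div_nonpos_of_nonpos_of_nonneg hx'.le
      (Real.sqrt_nonneg _))
  have hSYne : SY.Nonempty :=
    ⟨_, by positivity, eventuallyLE_step hl hζ0 hζ hlc le_rfl h0X.2⟩
  have hSYbdd : BddBelow SY := ⟨0, fun y hy => hy.1⟩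
  have hY0 : 0 ≤ sInf SY := le_csInf hSYne fun y hy => hy.1
  have hYmem : EventuallyLE lam ζ (sInf SY) := by
    intro M y' hy'
    obtain ⟨y, hy, hyy'⟩ := exists_lt_of_csInf_lt hSYne hy'
    exact hy.2 M y' hyy'
  by_cases hbdd : BddAbove SX
  · have hX0 : 0 ≤ sSup SX := le_csSup hbdd h0X
    have hXmem : EventuallyGE lam ζ (sSup SX) := by
      intro M x' hx'
      obtain ⟨x, hx, hxx'⟩ := exists_lt_of_lt_csSup ⟨0, h0X⟩ hx'
      exact hx.2 M x' hxx'
    have h1 : sInf SY ≤ c * Real.exp (-(ζ * sSup SX ^ 2)) :=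
      csInf_le hSYbdd ⟨by positivity, eventuallyLE_step hl hζ0 hζ hlc hX0 hXmem⟩
    have h2 : c * Real.exp (-(ζ * sInf SY ^ 2)) ≤ sSup SX :=
      le_csSup hbdd ⟨by positivity, eventuallyGE_step hl hζ0 hζ hlc hY0 hYmem⟩
    obtain ⟨h3, h4⟩ := le_fixedPoint_of_le ha hζ0 hζc hac hX0 hY0 h1 h2
    exact ⟨fun M y' hy' => hYmem M y' (h3.trans_lt hy'),
      fun M x' hx' => hXmem M x' (hx'.trans_le h4)⟩
  · have hGE : EventuallyGE lam ζ a := by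
      intro M x' hx'
      obtain ⟨x, hx, hxx'⟩ := not_bddAbove_iff.1 hbdd a
      exact hx.2 M x' (hx'.trans hxx')
    exact ⟨hac ▸ eventuallyLE_step hl hζ0 hζ hlc ha.le hGE, hGE⟩

/-- Minus the logarithmic derivative of the partition function. -/
def triangleRatio (n : ℕ) (l ζ : ℝ) : ℝ :=
  (∑ t, partFun (triplePairs n) l ζ (Finset.univ.erase t) (triplePairs n t)) /
    partFun (triplePairs n) l ζ Finset.univ ∅

lemma partFun_univ_pos {n : ℕ} {l : ℝ} (hl : 0 ≤ l) (hζ : ζ ≤ 1) :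
    0 < partFun (triplePairs n) l ζ Finset.univ ∅ :=
  one_pos.trans_le (one_le_partFun hl hζ triplePairs_nonempty _)

lemma triangleRatio_nonneg {n : ℕ} {l : ℝ} (hl : 0 ≤ l) (hζ : ζ ≤ 1) :
    0 ≤ triangleRatio n l ζ :=
  div_nonneg (Finset.sum_nonneg fun _ _ => partFun_nonneg hl hζ _ _) (partFun_nonneg hl hζ _ _)

lemma triangleRatio_le {n : ℕ} {l y : ℝ} (hl : 0 ≤ l) (hl1 : l < 1) (hζ0 : 0 ≤ ζ) (hζ : ζ ≤ 1)
    (hy : 0 ≤ y) (h : MarginalLE (triplePairs n) l ζ 2 y) :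
    triangleRatio n l ζ ≤ n.choose 3 * y ^ 3 / (1 - l ^ 2) := by
  have hl2 : 0 < 1 - l ^ 2 := by nlinarith
  unfold triangleRatio
  rw [div_le_iff₀ (partFun_univ_pos hl hζ)]
  have := Finset.sum_le_card_nsmul Finset.univ
    (fun t => partFun (triplePairs n) l ζ (Finset.univ.erase t) (triplePairs n t))
    (y ^ 3 / (1 - l ^ 2) * partFun (triplePairs n) l ζ Finset.univ ∅) (fun t _ => by
      rw [div_mul_eq_mul_div, le_div_iff₀ hl2, mul_comm]
      exact partFun_triple_le (isTripleSystem_triplePairs n) hl hl1.le hζ0 hζ hy h t)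
  refine this.trans (le_of_eq ?_)
  rw [Finset.card_univ, card_vertexTriple, nsmul_eq_mul]
  ring

lemma le_triangleRatio {n : ℕ} {l x : ℝ} (hl : 0 ≤ l) (hζ0 : 0 ≤ ζ) (hζ : ζ ≤ 1)
    (hx : 0 ≤ x) (h : MarginalGE (triplePairs n) l ζ 2 x) :
    n.choose 3 * x ^ 3 ≤ triangleRatio n l ζ := by
  unfold triangleRatio
  rw [le_div_iff₀ (partFun_univ_pos hl hζ)]
  have := Finset.card_nsmul_le_sum Finset.univ
    (fun t => partFun (triplePairs n) l ζ (Finset.univ.erase t) (triplePairs n t))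
    (x ^ 3 * partFun (triplePairs n) l ζ Finset.univ ∅) (fun t _ =>
      le_partFun_triple (isTripleSystem_triplePairs n) hl hζ0 hζ hx h t)
  refine le_trans (le_of_eq ?_) this
  rw [Finset.card_univ, card_vertexTriple, nsmul_eq_mul]
  ring

lemma tendsto_choose_three_div :
    Tendsto (fun n : ℕ => (n.choose 3 : ℝ) / (n : ℝ) ^ 3) atTop (nhds (1 / 6)) := by
  have h1 : ∀ k : ℝ, Tendsto (fun n : ℕ => 1 - k / (n : ℝ)) atTop (nhds 1) := tendsto_one_sub_div
  have h2 : Tendsto (fun n : ℕ => (1 - 1 / (n : ℝ)) * (1 - 2 / (n : ℝ)) / 6) atTop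
      (nhds (1 * 1 / 6)) := ((h1 1).mul (h1 2)).div_const 6
  rw [one_mul] at h2
  refine h2.congr' ?_
  filter_upwards [eventually_ge_atTop 2] with n hn
  have hn0 : (n : ℝ) ≠ 0 := by
    have : n ≠ 0 := by omega
    exact_mod_cast this
  have h3 := Nat.descFactorial_eq_factorial_mul_choose n 3
  have h4 : ((n.choose 3 : ℕ) : ℝ) * 6 = n * (n - 1) * (n - 2) := by
    have h5 := congrArg (Nat.cast : ℕ → ℝ) h3
    simp only [Nat.descFactorial_succ, Nat.descFactorial_zero, Nat.factorial, Nat.sub_zero] at h5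
    push_cast [Nat.cast_sub hn, Nat.cast_sub (by omega : 1 ≤ n)] at h5
    linarith
  rw [show ((n.choose 3 : ℕ) : ℝ) = n * (n - 1) * (n - 2) / 6 by linarith]
  field_simp

lemma sqrt_pow_three (n : ℕ) : (n : ℝ) ^ ((3 : ℝ) / 2) = √n ^ 3 := by
  rw [Real.sqrt_eq_rpow, ← Real.rpow_natCast, ← Real.rpow_mul (Nat.cast_nonneg n)]
  norm_num

lemma choose_three_mul_div_sqrt {n : ℕ} (hn : 0 < n) (z : ℝ) :
    (n.choose 3 * (z / √n) ^ 3) / √n ^ 3 = (n.choose 3 : ℝ) / (n : ℝ) ^ 3 * z ^ 3 := by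
  have hn0 : (0 : ℝ) < n := by exact_mod_cast hn
  have h1 : (n : ℝ) ^ 3 = √n ^ 3 * √n ^ 3 := by
    rw [← mul_pow, Real.mul_self_sqrt hn0.le]
  have hsq : √(n : ℝ) ≠ 0 := (Real.sqrt_pos.2 hn0).ne'
  rw [h1]
  field_simp

lemma tendsto_triangleRatio (hl : ∀ n, 0 < lam n) (hζ0 : 0 ≤ ζ) (hζ : ζ ≤ 1)
    (hlc : Tendsto (fun n : ℕ => √n * lam n) atTop (nhds c)) {a : ℝ} (ha : 0 < a)
    (hζc : 2 * (ζ * c ^ 2) ≤ 1) (hac : a = c * Real.exp (-(ζ * a ^ 2))) :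
    Tendsto (fun n : ℕ => triangleRatio n (lam n) ζ / √n ^ 3) atTop (nhds (a ^ 3 / 6)) := by
  obtain ⟨hLE, hGE⟩ := eventually_marginals hl hζ0 hζ hlc ha hζc hac
  have hl0 := tendsto_zero_of_sqrt_mul hlc
  refine tendsto_order.2 ⟨fun v hv => ?_, fun v hv => ?_⟩
  · have hcont : Tendsto (fun z : ℝ => z ^ 3 / 6) (nhdsWithin a (Set.Iio a))
        (nhds (a ^ 3 / 6)) := by
      have : Continuous fun z : ℝ => z ^ 3 / 6 := by fun_prop
      exact (this.tendsto a).mono_left nhdsWithin_le_nhds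
    obtain ⟨x, ⟨hvx, hx0⟩, hxa⟩ := ((hcont.eventually (lt_mem_nhds hv)).and
      ((tendsto_id.mono_left nhdsWithin_le_nhds).eventually (lt_mem_nhds ha))|>.and
        self_mem_nhdsWithin).exists
    have hlim := (tendsto_choose_three_div.mul_const (x ^ 3))
    filter_upwards [hGE 2 x hxa, hlim.eventually (lt_mem_nhds (show v < 1 / 6 * x ^ 3 by linarith)),
      eventually_gt_atTop 0] with n hn1 hn2 hn3
    have hsq : (0 : ℝ) < √n := Real.sqrt_pos.2 (by exact_mod_cast hn3)
    rw [← choose_three_mul_div_sqrt hn3] at hn2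
    refine hn2.trans_le ?_
    gcongr
    exact le_triangleRatio (hl n).le hζ0 hζ (div_nonneg (le_of_lt hx0) hsq.le) hn1
  · have hcont : Tendsto (fun z : ℝ => z ^ 3 / 6) (nhdsWithin a (Set.Ioi a))
        (nhds (a ^ 3 / 6)) := by
      have : Continuous fun z : ℝ => z ^ 3 / 6 := by fun_prop
      exact (this.tendsto a).mono_left nhdsWithin_le_nhds
    obtain ⟨y, hvy, hya⟩ := ((hcont.eventually (gt_mem_nhds hv)).and self_mem_nhdsWithin).exists
    have hlim : Tendsto (fun n : ℕ => (n.choose 3 : ℝ) / (n : ℝ) ^ 3 * y ^ 3 / (1 - lam n ^ 2))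
        atTop (nhds (1 / 6 * y ^ 3 / (1 - 0 ^ 2))) :=
      (tendsto_choose_three_div.mul_const (y ^ 3)).div ((hl0.pow 2).const_sub 1) (by norm_num)
    filter_upwards [hLE 2 y hya, hlim.eventually
      (gt_mem_nhds (show 1 / 6 * y ^ 3 / (1 - 0 ^ 2) < v by norm_num; linarith)),
      eventually_gt_atTop 0, hl0.eventually (gt_mem_nhds one_pos)] with n hn1 hn2 hn3 hn4
    have hsq : (0 : ℝ) < √n := Real.sqrt_pos.2 (by exact_mod_cast hn3)
    rw [← choose_three_mul_div_sqrt hn3] at hn2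
    refine lt_of_le_of_lt ?_ hn2
    rw [div_right_comm]
    gcongr
    exact triangleRatio_le (hl n).le hn4 hζ0 hζ (div_nonneg (ha.le.trans (le_of_lt hya)) hsq.le) hn1

end Asymptotics

section LambertW

variable {W : ℝ → ℝ} {c : ℝ}

lemma IsLambertW.mono (hW : IsLambertW W) {x y : ℝ} (hx : 0 ≤ x) (hxy : x ≤ y) : W x ≤ W y := by
  obtain ⟨h1, h2, -⟩ := hW x hx
  obtain ⟨h3, h4, -⟩ := hW y (hx.trans hxy)
  by_contra! h
  have h5 : Real.exp (W y) < Real.exp (W x) := Real.exp_lt_exp.2 h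
  have := mul_lt_mul'' h h5 h3 (Real.exp_pos _).le
  linarith

lemma IsLambertW.sub_le (hW : IsLambertW W) {x y : ℝ} (hx : 0 ≤ x) (hxy : x ≤ y) :
    W y - W x ≤ y - x := by
  obtain ⟨h1, h2, -⟩ := hW x hx
  obtain ⟨h3, h4, -⟩ := hW y (hx.trans hxy)
  have h5 := hW.mono hx hxy
  have h6 : Real.exp (W x) ≤ Real.exp (W y) := Real.exp_le_exp.2 h5
  have h7 : 1 ≤ Real.exp (W x) := Real.one_le_exp h1
  nlinarith

lemma IsLambertW.continuousOn (hW : IsLambertW W) : ContinuousOn W (Set.Ici 0) := by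
  have : LipschitzOnWith 1 W (Set.Ici 0) := by
    refine LipschitzOnWith.of_dist_le_mul fun x hx y hy => ?_
    rw [NNReal.coe_one, one_mul, Real.dist_eq, Real.dist_eq]
    rcases le_total x y with h | h
    · rw [abs_sub_comm, abs_sub_comm x, abs_of_nonneg (sub_nonneg.2 h),
        abs_of_nonneg (sub_nonneg.2 (hW.mono hx h))]
      exact hW.sub_le hx h
    · rw [abs_of_nonneg (sub_nonneg.2 h), abs_of_nonneg (sub_nonneg.2 (hW.mono hy h))]
      exact hW.sub_le hy h
  exact this.continuousOn

lemma IsLambertW.map_zero (hW : IsLambertW W) : W 0 = 0 :=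
  ((hW 0 le_rfl).2.2 0 le_rfl (by simp)).symm

lemma IsLambertW.pos (hW : IsLambertW W) {x : ℝ} (hx : 0 < x) : 0 < W x := by
  obtain ⟨h1, h2, -⟩ := hW x hx.le
  refine h1.lt_of_ne fun h => ?_
  rw [← h, zero_mul] at h2
  exact hx.ne h2

lemma IsLambertW.hasDerivAt (hW : IsLambertW W) {x : ℝ} (hx : 0 < x) :
    HasDerivAt W (Real.exp (W x) * (1 + W x))⁻¹ x := by
  obtain ⟨h1, h2, -⟩ := hW x hx.le
  have hf : HasDerivAt (fun w => w * Real.exp w) (Real.exp (W x) * (1 + W x)) (W x) := by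
    refine ((hasDerivAt_id' (W x)).mul (Real.hasDerivAt_exp (W x))).congr_deriv ?_
    ring
  refine HasDerivAt.of_local_left_inverse
    (hW.continuousOn.continuousAt (Ici_mem_nhds hx)) hf (by positivity) ?_
  filter_upwards [lt_mem_nhds hx] with y hy
  exact (hW y hy.le).2.1

lemma IsLambertW.div_self (hW : IsLambertW W) {x : ℝ} (hx : 0 < x) :
    W x / x = Real.exp (-W x) := by
  obtain ⟨h1, h2, -⟩ := hW x hx.le
  rw [Real.exp_neg, div_eq_iff hx.ne', eq_inv_mul_iff_mul_eq₀ (Real.exp_pos _).ne', mul_comm]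
  exact h2

/-- The rescaled edge density of the Gibbs measure with parameter `s`. -/
def gibbsDensity (W : ℝ → ℝ) (c s : ℝ) : ℝ := c * Real.exp (-(W (2 * s * c ^ 2) / 2))

/-- The limiting normalized log partition function. -/
def limitPressure (W : ℝ → ℝ) (c s : ℝ) : ℝ :=
  (gibbsDensity W c s + 2 * s * gibbsDensity W c s ^ 3 / 3 - c) / 2

lemma gibbsDensity_pos (hc : 0 < c) (s : ℝ) : 0 < gibbsDensity W c s :=
  mul_pos hc (Real.exp_pos _)

lemma mul_gibbsDensity_sq (hW : IsLambertW W) {s : ℝ} (hs : 0 ≤ s) :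
    s * gibbsDensity W c s ^ 2 = W (2 * s * c ^ 2) / 2 := by
  obtain ⟨h1, h2, -⟩ := hW (2 * s * c ^ 2) (by positivity)
  have h3 : Real.exp (-(W (2 * s * c ^ 2) / 2)) ^ 2 = (Real.exp (W (2 * s * c ^ 2)))⁻¹ := by
    rw [← Real.exp_nat_mul, ← Real.exp_neg]
    congr 1
    push_cast
    ring
  rw [gibbsDensity, mul_pow, h3, ← mul_assoc, ← div_eq_mul_inv, div_eq_iff (Real.exp_pos _).ne']
  linarith

lemma gibbsDensity_eq (hW : IsLambertW W) {s : ℝ} (hs : 0 ≤ s) :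
    gibbsDensity W c s = c * Real.exp (-(s * gibbsDensity W c s ^ 2)) := by
  rw [mul_gibbsDensity_sq hW hs, gibbsDensity]

lemma gibbsDensity_anti (hW : IsLambertW W) (hc : 0 < c) {s t : ℝ} (hs : 0 ≤ s) (hst : s ≤ t) :
    gibbsDensity W c t ≤ gibbsDensity W c s := by
  unfold gibbsDensity
  have : W (2 * s * c ^ 2) ≤ W (2 * t * c ^ 2) := hW.mono (by positivity) (by gcongr)
  gcongr

lemma continuousOn_gibbsDensity (hW : IsLambertW W) :
    ContinuousOn (gibbsDensity W c) (Set.Ici 0) := by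
  unfold gibbsDensity
  have : ContinuousOn (fun s => W (2 * s * c ^ 2)) (Set.Ici 0) :=
    hW.continuousOn.comp (by fun_prop) fun s (hs : 0 ≤ s) => by
      simp only [Set.mem_Ici]; positivity
  exact (Real.continuous_exp.comp_continuousOn (this.div_const 2).neg).const_mul c

lemma continuousOn_limitPressure (hW : IsLambertW W) :
    ContinuousOn (limitPressure W c) (Set.Ici 0) := by
  unfold limitPressure
  have := continuousOn_gibbsDensity (c := c) hW
  fun_prop

lemma limitPressure_zero (hW : IsLambertW W) : limitPressure W c 0 = 0 := by
  simp [limitPressure, gibbsDensity, hW.map_zero]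

lemma hasDerivAt_limitPressure (hW : IsLambertW W) (hc : 0 < c) {s : ℝ} (hs : 0 < s) :
    HasDerivAt (limitPressure W c) (-(gibbsDensity W c s ^ 3 / 6)) s := by
  have hx : 0 < 2 * s * c ^ 2 := by positivity
  have hsq := mul_gibbsDensity_sq (c := c) hW hs.le
  have h1 : HasDerivAt (fun s => 2 * s * c ^ 2) (2 * c ^ 2) s := by
    simpa using ((hasDerivAt_id s).const_mul 2).mul_const (c ^ 2)
  have h2 := (((hW.hasDerivAt hx).comp s h1).div_const 2).neg.exp.const_mul c
  simp only [Function.comp_apply, Pi.neg_apply] at h2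
  set w := W (2 * s * c ^ 2) with hw
  have hw0 : 0 ≤ w := (hW _ hx.le).1
  have ha : HasDerivAt (gibbsDensity W c) (-(gibbsDensity W c s ^ 3 / (1 + w))) s := by
    refine h2.congr_deriv ?_
    have h3 : gibbsDensity W c s ^ 3 =
        gibbsDensity W c s * (c ^ 2 * (Real.exp w)⁻¹) := by
      rw [pow_succ', gibbsDensity, mul_pow, ← Real.exp_nat_mul, ← Real.exp_neg]
      congr 4
      push_cast
      ring
    rw [h3, gibbsDensity, ← hw]
    field_simp
  have h4 := (((ha.add ((((hasDerivAt_id s).const_mul 2).mul (ha.pow 3)).div_const 3)).sub_const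
    c).div_const 2)
  refine h4.congr_deriv ?_
  simp only [id, mul_one, Pi.pow_apply]
  have h5 : w = 2 * (s * gibbsDensity W c s ^ 2) := by linarith
  have h6 : 1 + w ≠ 0 := by positivity
  generalize gibbsDensity W c s = a at *
  field_simp
  norm_num
  rw [h5]
  ring

/-- The rescaled triangle density of the Gibbs measure with parameter `s`. -/
def gibbsTriangle (W : ℝ → ℝ) (c s : ℝ) : ℝ := (1 - s) * gibbsDensity W c s ^ 3 / 6

lemma gibbsTriangle_lt (hW : IsLambertW W) (hc : 0 < c) {s t : ℝ} (hs : 0 ≤ s) (hst : s < t)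
    (ht : t ≤ 1) : gibbsTriangle W c t < gibbsTriangle W c s := by
  unfold gibbsTriangle
  have h1 := gibbsDensity_anti hW hc hs hst.le
  have h2 := gibbsDensity_pos (W := W) hc t
  have h3 : gibbsDensity W c t ^ 3 ≤ gibbsDensity W c s ^ 3 := by gcongr
  have h4 : 0 < gibbsDensity W c t ^ 3 := by positivity
  nlinarith

lemma continuousOn_gibbsTriangle (hW : IsLambertW W) :
    ContinuousOn (gibbsTriangle W c) (Set.Ici 0) := by
  unfold gibbsTriangle
  have := continuousOn_gibbsDensity (c := c) hW
  fun_prop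

/-- The exponential rate `-r log (1 - s)` plus the limiting pressure. -/
def tiltedRate (W : ℝ → ℝ) (c r s : ℝ) : ℝ := -(r * Real.log (1 - s)) + limitPressure W c s

lemma continuousOn_tiltedRate (hW : IsLambertW W) (r : ℝ) :
    ContinuousOn (tiltedRate W c r) (Set.Ico 0 1) := by
  unfold tiltedRate
  have h1 : ContinuousOn (limitPressure W c) (Set.Ico 0 1) :=
    (continuousOn_limitPressure hW).mono Set.Ico_subset_Ici_self
  have h2 : ContinuousOn (fun s : ℝ => Real.log (1 - s)) (Set.Ico 0 1) :=
    ContinuousOn.log (by fun_prop) fun s hs => by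
      have := hs.2
      linarith
  fun_prop

lemma hasDerivAt_tiltedRate (hW : IsLambertW W) (hc : 0 < c) (r : ℝ) {s : ℝ} (hs : 0 < s)
    (hs1 : s < 1) :
    HasDerivAt (tiltedRate W c r) ((r - gibbsTriangle W c s) / (1 - s)) s := by
  have h0 : 1 - s ≠ 0 := by linarith
  have h1 := ((((hasDerivAt_id s).const_sub 1).log h0).const_mul r).neg.add
    (hasDerivAt_limitPressure hW hc hs)
  refine h1.congr_deriv ?_
  rw [gibbsTriangle]
  simp only [id]
  field_simp
  ring

lemma tiltedRate_lt (hW : IsLambertW W) (hc : 0 < c) {s t : ℝ} (hs : 0 ≤ s) (ht : t < 1)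
    (hst : s < t) : tiltedRate W c (gibbsTriangle W c s) s <
      tiltedRate W c (gibbsTriangle W c s) t := by
  refine strictMonoOn_of_deriv_pos (D := Set.Icc s t) (convex_Icc s t)
    ((continuousOn_tiltedRate hW _).mono fun x hx => ⟨hs.trans hx.1, hx.2.trans_lt ht⟩) ?_
    (Set.left_mem_Icc.2 hst.le) (Set.right_mem_Icc.2 hst.le) hst
  intro x hx
  rw [interior_Icc] at hx
  rw [(hasDerivAt_tiltedRate hW hc _ (hs.trans_lt hx.1) (hx.2.trans ht)).deriv]
  exact div_pos (sub_pos.2 (gibbsTriangle_lt hW hc hs hx.1 (hx.2.trans ht).le))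
    (sub_pos.2 (hx.2.trans ht))

lemma tiltedRate_gt (hW : IsLambertW W) (hc : 0 < c) {s t : ℝ} (hs : 0 ≤ s) (ht : t < 1)
    (hst : s < t) : tiltedRate W c (gibbsTriangle W c t) t <
      tiltedRate W c (gibbsTriangle W c t) s := by
  refine strictAntiOn_of_deriv_neg (D := Set.Icc s t) (convex_Icc s t)
    ((continuousOn_tiltedRate hW _).mono fun x hx => ⟨hs.trans hx.1, hx.2.trans_lt ht⟩) ?_
    (Set.left_mem_Icc.2 hst.le) (Set.right_mem_Icc.2 hst.le) hst
  intro x hx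
  rw [interior_Icc] at hx
  rw [(hasDerivAt_tiltedRate hW hc _ (hs.trans_lt hx.1) (hx.2.trans ht)).deriv]
  exact div_neg_of_neg_of_pos (sub_neg.2 (gibbsTriangle_lt hW hc (hs.trans hx.1.le) hx.2 ht.le))
    (sub_pos.2 (hx.2.trans ht))

lemma gibbsDensity_pow_three (hW : IsLambertW W) (hc : 0 < c) {s : ℝ} (hs : 0 < s) :
    gibbsDensity W c s ^ 3 =
      c ^ 3 * (W (2 * s * c ^ 2) / (2 * s * c ^ 2)) ^ ((3 : ℝ) / 2) := by
  rw [hW.div_self (by positivity), ← Real.exp_mul, gibbsDensity, mul_pow, ← Real.exp_nat_mul]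
  congr 2
  push_cast
  ring

lemma gibbsTriangle_eq (hW : IsLambertW W) (hc : 0 < c) {s η : ℝ} (hs : 0 < s)
    (h : zetaLHS W c s = η) : gibbsTriangle W c s = η * c ^ 3 / 6 := by
  rw [zetaLHS, if_neg hs.ne'] at h
  rw [gibbsTriangle, gibbsDensity_pow_three hW hc hs, ← h]
  ring

lemma mul_sq_lt_of_ltCbar (hW : IsLambertW W) {η s : ℝ} (hc : 0 < c)
    (hcbar : LtCbar W c η) (hs0 : 0 < s) (hs1 : s ≤ 1) (h : zetaLHS W c s = η) :
    2 * (s * c ^ 2) < 1 := by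
  rw [zetaLHS, if_neg hs0.ne'] at h
  have he := Real.exp_pos 1
  have he2 : 2 < Real.exp 1 := by
    have := Real.add_one_lt_exp (show (1 : ℝ) ≠ 0 by norm_num)
    linarith
  suffices hlt : s * c ^ 2 < 1 / Real.exp 1 by
    rw [lt_div_iff₀ he] at hlt
    have : 0 < s * c ^ 2 := by positivity
    nlinarith
  by_contra! hge
  have hes : 0 < etaStar W :=
    Real.rpow_pos_of_pos (div_pos (hW.pos (by positivity)) (by positivity)) _
  have hle : (W (2 * s * c ^ 2) / (2 * s * c ^ 2)) ^ ((3 : ℝ) / 2) ≤ etaStar W := by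
    have h2 : 2 / Real.exp 1 ≤ 2 * s * c ^ 2 := by
      rw [div_eq_mul_one_div, mul_assoc]
      linarith
    have h0 : 0 ≤ W (2 * s * c ^ 2) := (hW _ (by positivity)).1
    unfold etaStar
    gcongr ?_ ^ _
    rw [hW.div_self (by positivity), hW.div_self (by positivity)]
    have := hW.mono (by positivity) h2
    gcongr
  have h3 : η ≤ (1 - s) * etaStar W := h ▸ mul_le_mul_of_nonneg_left hle (by linarith)
  have h4 : η < etaStar W := by nlinarith
  have h5 := hcbar h4
  have h6 : s ≤ 1 - η / etaStar W := by
    rw [le_sub_comm, div_le_iff₀ hes]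
    exact h3
  have h7 : 0 < Real.exp 1 * (1 - η / etaStar W) := by nlinarith
  rw [lt_div_iff₀ (Real.sqrt_pos.2 h7)] at h5
  have h8 : c ^ 2 * (Real.exp 1 * (1 - η / etaStar W)) < 1 := by
    have := pow_lt_pow_left₀ h5 (by positivity) two_ne_zero
    rwa [mul_pow, Real.sq_sqrt h7.le, one_pow] at this
  rw [div_le_iff₀ he] at hge
  have h9 : c ^ 2 * Real.exp 1 * s ≤ c ^ 2 * Real.exp 1 * (1 - η / etaStar W) := by gcongr
  linarith

lemma limitPressure_eq (hW : IsLambertW W) (hc : 0 < c) {s : ℝ} (hs : 0 < s) :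
    limitPressure W c s = (1 / 2) *
      ((W (2 * s * c ^ 2) ^ ((3 : ℝ) / 2) + 3 * W (2 * s * c ^ 2) ^ ((1 : ℝ) / 2)) /
        (3 * Real.sqrt (2 * s)) - c) := by
  have h0 : 0 ≤ W (2 * s * c ^ 2) := (hW _ (by positivity)).1
  have ha := gibbsDensity_pos (W := W) hc s
  have h1 : W (2 * s * c ^ 2) = 2 * s * gibbsDensity W c s ^ 2 := by
    have := mul_gibbsDensity_sq (c := c) hW hs.le
    linarith
  have h2 : W (2 * s * c ^ 2) ^ ((1 : ℝ) / 2) = √(2 * s) * gibbsDensity W c s := by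
    rw [← Real.sqrt_eq_rpow, h1, Real.sqrt_mul (by positivity), Real.sqrt_sq ha.le]
  have h3 : W (2 * s * c ^ 2) ^ ((3 : ℝ) / 2) = (√(2 * s) * gibbsDensity W c s) ^ 3 := by
    rw [← h2, ← Real.rpow_mul_natCast h0]
    norm_num
  have h4 : √(2 * s) ^ 2 = 2 * s := Real.sq_sqrt (by positivity)
  have h5 : 0 < √(2 * s) := Real.sqrt_pos.2 (by positivity)
  rw [h2, h3, limitPressure, mul_pow, pow_succ (√(2 * s)) 2, h4]
  field_simp
  ring

end LambertW

section Pressure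

open MeasureTheory

lemma continuous_partFun {E T : Type*} [Fintype E] [DecidableEq E] (b : T → Finset E) (l : ℝ)
    (Q : Finset T) (A : Finset E) : Continuous fun ζ => partFun b l ζ Q A := by
  unfold partFun
  refine continuous_finsetSum _ fun S _ => ?_
  split_ifs
  · fun_prop
  · fun_prop

lemma continuousOn_triangleRatio {n : ℕ} {l : ℝ} (hl : 0 ≤ l) :
    ContinuousOn (triangleRatio n l) (Set.Iic 1) := by
  refine ContinuousOn.div (continuous_finsetSum Finset.univ fun t _ =>
      continuous_partFun (triplePairs n) l _ _).continuousOn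
    (continuous_partFun _ _ _ _).continuousOn fun s hs => (partFun_univ_pos hl hs).ne'

/-- The normalized log partition function of the triangle-weighted random graph. -/
def pressure (n : ℕ) (l s : ℝ) : ℝ :=
  Real.log (partFun (triplePairs n) l s Finset.univ ∅ /
    partFun (triplePairs n) l 0 Finset.univ ∅) / √n ^ 3

lemma pressure_eq_integral {n : ℕ} {l s : ℝ} (hl : 0 ≤ l) (hs0 : 0 ≤ s) (hs : s ≤ 1) :
    pressure n l s = ∫ x in (0 : ℝ)..s, -(triangleRatio n l x / √n ^ 3) := by
  have huIcc : Set.uIcc 0 s ⊆ Set.Iic 1 := by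
    rw [Set.uIcc_of_le hs0]
    exact fun x hx => hx.2.trans hs
  have hderiv : ∀ x ∈ Set.uIcc 0 s, HasDerivAt
      (fun x => Real.log (partFun (triplePairs n) l x Finset.univ ∅) / √n ^ 3)
      (-(triangleRatio n l x / √n ^ 3)) x := by
    intro x hx
    refine (((hasDerivAt_partFun (triplePairs n) l x).log
      (partFun_univ_pos hl (huIcc hx)).ne').div_const (√n ^ 3)).congr_deriv ?_
    rw [triangleRatio]
    ring
  rw [intervalIntegral.integral_eq_sub_of_hasDerivAt hderiv
    ((((continuousOn_triangleRatio hl).mono huIcc).div_const _).neg.intervalIntegrable),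
    pressure, Real.log_div (partFun_univ_pos hl hs).ne' (partFun_univ_pos hl zero_le_one).ne',
    sub_div]

lemma limitPressure_eq_integral {W : ℝ → ℝ} {c s : ℝ} (hW : IsLambertW W) (hc : 0 < c)
    (hs : 0 ≤ s) : limitPressure W c s = ∫ x in (0 : ℝ)..s, -(gibbsDensity W c x ^ 3 / 6) := by
  have hsub : Set.Icc 0 s ⊆ Set.Ici 0 := Set.Icc_subset_Ici_self
  have hcont : ContinuousOn (fun x => -(gibbsDensity W c x ^ 3 / 6)) (Set.uIcc 0 s) := by
    have := (continuousOn_gibbsDensity (c := c) hW).mono hsub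
    rw [Set.uIcc_of_le hs]
    exact ((this.pow 3).div_const 6).neg
  rw [intervalIntegral.integral_eq_sub_of_hasDerivAt_of_le hs
    ((continuousOn_limitPressure hW).mono hsub)
    (fun x hx => hasDerivAt_limitPressure hW hc hx.1) hcont.intervalIntegrable,
    limitPressure_zero hW, sub_zero]

lemma tendsto_pressure {W : ℝ → ℝ} {c s : ℝ} {lam : ℕ → ℝ} (hW : IsLambertW W) (hc : 0 < c)
    (hl : ∀ n, 0 < lam n) (hlc : Tendsto (fun n : ℕ => √n * lam n) atTop (nhds c))
    (hs0 : 0 ≤ s) (hs : s ≤ 1) (hsc : 2 * (s * c ^ 2) ≤ 1) :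
    Tendsto (fun n => pressure n (lam n) s) atTop (nhds (limitPressure W c s)) := by
  simp_rw [fun n => pressure_eq_integral (n := n) (hl n).le hs0 hs]
  rw [limitPressure_eq_integral hW hc hs0]
  have hl0 := tendsto_zero_of_sqrt_mul hlc
  have hI : ∀ x, x ∈ Set.uIoc 0 s → 0 ≤ x ∧ x ≤ s := fun x hx => by
    rw [Set.uIoc_of_le hs0] at hx
    exact ⟨hx.1.le, hx.2⟩
  refine intervalIntegral.tendsto_integral_filter_of_dominated_convergence
    (fun _ => c ^ 3 / 6 + 1) ?_ ?_ intervalIntegrable_const ?_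
  · refine Eventually.of_forall fun n => ?_
    refine ContinuousOn.aestronglyMeasurable ?_ measurableSet_uIoc
    exact (((continuousOn_triangleRatio (hl n).le).mono
      fun x hx => (hI x hx).2.trans hs).div_const _).neg
  · have hlim : Tendsto (fun n : ℕ => (n.choose 3 : ℝ) / (n : ℝ) ^ 3 * (√n * lam n) ^ 3 /
        (1 - lam n ^ 2)) atTop (nhds (1 / 6 * c ^ 3 / (1 - 0 ^ 2))) :=
      (tendsto_choose_three_div.mul (hlc.pow 3)).div ((hl0.pow 2).const_sub 1) (by norm_num)
    filter_upwards [hlim.eventually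
      (gt_mem_nhds (show 1 / 6 * c ^ 3 / (1 - 0 ^ 2) < c ^ 3 / 6 + 1 by norm_num; linarith)),
      eventually_gt_atTop 0, hl0.eventually (gt_mem_nhds one_pos)] with n hn1 hn2 hn3
    refine Eventually.of_forall fun x hx => ?_
    obtain ⟨hx0, hx1⟩ := hI x hx
    have hsq : (0 : ℝ) < √n := Real.sqrt_pos.2 (by exact_mod_cast hn2)
    have h0 := triangleRatio_nonneg (n := n) (hl n).le (hx1.trans hs)
    rw [norm_neg, Real.norm_of_nonneg (by positivity)]
    refine le_trans ?_ hn1.le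
    rw [← choose_three_mul_div_sqrt hn2, mul_div_cancel_left₀ _ hsq.ne', div_right_comm]
    gcongr
    exact triangleRatio_le (hl n).le hn3 hx0 (hx1.trans hs) (hl n).le
      (marginalLE_lam (hl n).le hx0 (hx1.trans hs) 2)
  · refine Eventually.of_forall fun x hx => ?_
    obtain ⟨hx0, hx1⟩ := hI x hx
    refine (tendsto_triangleRatio hl hx0 (hx1.trans hs) hlc (gibbsDensity_pos hc x) ?_
      (gibbsDensity_eq hW hx0)).neg
    nlinarith [sq_nonneg c]

end Pressure

section LowerTail

variable {n : ℕ} {l : ℝ}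

lemma partFun_triplePairs_eq_Zfun (n : ℕ) (l s : ℝ) :
    partFun (triplePairs n) l s Finset.univ ∅ = Zfun n l s := by
  rw [partFun, Zfun, ← (pairSet_bijective n).sum_comp]
  refine Finset.sum_congr rfl fun G _ => ?_
  rw [if_pos (Finset.empty_subset _), card_pairSet, card_triplePairs_subset, gibbsWeight]

lemma Zfun_pos (hl : 0 ≤ l) {s : ℝ} (hs : s ≤ 1) : 0 < Zfun n l s := by
  rw [← partFun_triplePairs_eq_Zfun]
  exact partFun_univ_pos hl hs

lemma edgeCount_le (G : SimpleGraph (Fin n)) : edgeCount G ≤ n.choose 2 := by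
  rw [← card_pairSet, ← card_vertexPair]
  exact Finset.card_le_univ _

lemma erProb_eq_gibbsProb {p : ℝ} (hp : p ∈ Set.Ioo (0 : ℝ) 1) (A : Set (SimpleGraph (Fin n))) :
    erProb n p A = gibbsProb n (p / (1 - p)) 0 A := by
  have h1 : 0 < 1 - p := sub_pos.2 hp.2
  have hw : ∀ G : SimpleGraph (Fin n), p ^ edgeCount G * (1 - p) ^ (n.choose 2 - edgeCount G) =
      (1 - p) ^ n.choose 2 * gibbsWeight (p / (1 - p)) 0 G := fun G => by
    rw [gibbsWeight, sub_zero, one_pow, mul_one, div_pow, mul_div_assoc',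
      eq_div_iff (pow_ne_zero _ h1.ne'), mul_assoc, ← pow_add, Nat.sub_add_cancel (edgeCount_le G),
      mul_comm]
  have hZ : (1 - p) ^ n.choose 2 * Zfun n (p / (1 - p)) 0 = 1 := by
    rw [Zfun, Finset.mul_sum]
    simp_rw [← hw, ← card_pairSet]
    rw [(pairSet_bijective n).sum_comp fun S => p ^ S.card * (1 - p) ^ (n.choose 2 - S.card),
      ← card_vertexPair, Fintype.sum_pow_mul_eq_add_pow, add_sub_cancel, one_pow]
  rw [gibbsProb, eq_div_iff (right_ne_zero_of_mul_eq_one hZ), erProb]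
  simp_rw [hw, ← mul_ite_zero, ← Finset.mul_sum]
  rw [mul_right_comm, hZ, one_mul]

lemma gibbsWeight_nonneg (hl : 0 ≤ l) {s : ℝ} (hs : s ≤ 1) (G : SimpleGraph (Fin n)) :
    0 ≤ gibbsWeight l s G :=
  mul_nonneg (pow_nonneg hl _) (pow_nonneg (sub_nonneg.2 hs) _)

lemma gibbsProb_mono (hl : 0 ≤ l) {s : ℝ} (hs : s ≤ 1) {A B : Set (SimpleGraph (Fin n))}
    (h : A ⊆ B) : gibbsProb n l s A ≤ gibbsProb n l s B := by
  refine div_le_div_of_nonneg_right (Finset.sum_le_sum fun G _ => ?_) (Zfun_pos hl hs).le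
  have := gibbsWeight_nonneg hl hs G
  split_ifs with h1 h2 h2
  exacts [le_rfl, absurd (h h1) h2, this, le_rfl]

lemma gibbsProb_univ (hl : 0 ≤ l) {s : ℝ} (hs : s ≤ 1) :
    gibbsProb n l s Set.univ = 1 := by
  simp only [gibbsProb, Set.mem_univ, if_true]
  exact div_self (Zfun_pos hl hs).ne'

lemma gibbsProb_le_one (hl : 0 ≤ l) {s : ℝ} (hs : s ≤ 1) (A : Set (SimpleGraph (Fin n))) :
    gibbsProb n l s A ≤ 1 :=
  (gibbsProb_mono hl hs (Set.subset_univ A)).trans_eq (gibbsProb_univ hl hs)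

lemma gibbsProb_union_le (hl : 0 ≤ l) {s : ℝ} (hs : s ≤ 1) (A B : Set (SimpleGraph (Fin n))) :
    gibbsProb n l s (A ∪ B) ≤ gibbsProb n l s A + gibbsProb n l s B := by
  simp only [gibbsProb]
  rw [← add_div, ← Finset.sum_add_distrib]
  refine div_le_div_of_nonneg_right (Finset.sum_le_sum fun G _ => ?_) (Zfun_pos hl hs).le
  have := gibbsWeight_nonneg hl hs G
  by_cases h1 : G ∈ A <;> by_cases h2 : G ∈ B <;> simp [h1, h2, this]

/-- The finite-size analogue of `tiltedRate`. -/
def finiteRate (n : ℕ) (l r s : ℝ) : ℝ := -(r * Real.log (1 - s)) + pressure n l s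

lemma finiteRate_zero (hl : 0 ≤ l) (r : ℝ) : finiteRate n l r 0 = 0 := by
  rw [finiteRate, pressure, div_self (partFun_univ_pos hl zero_le_one).ne']
  simp

lemma Zfun_div_Zfun (hn : 0 < n) (hl : 0 ≤ l) {s t : ℝ} (hs : s ≤ 1) (ht : t ≤ 1) :
    Zfun n l t / Zfun n l s = Real.exp (√n ^ 3 * (pressure n l t - pressure n l s)) := by
  have hsq : (0 : ℝ) < √n := Real.sqrt_pos.2 (by exact_mod_cast hn)
  have h0 := Zfun_pos (n := n) hl zero_le_one
  have h1 := Zfun_pos (n := n) hl hs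
  have h2 := Zfun_pos (n := n) hl ht
  simp only [pressure, partFun_triplePairs_eq_Zfun]
  rw [← sub_div, mul_div_cancel₀ _ (by positivity), ← Real.log_div (by positivity) (by positivity),
    Real.exp_log (by positivity), div_div_div_cancel_right₀ h0.ne']

/-- Exponential change of measure between two Gibbs measures. -/
lemma gibbsProb_le_exp_mul (hn : 0 < n) (hl : 0 ≤ l) {s t : ℝ} (hs : s < 1) (ht : t < 1) (r : ℝ)
    {A : Set (SimpleGraph (Fin n))}
    (h : ∀ G ∈ A, (triCount G - r * √n ^ 3) * (Real.log (1 - s) - Real.log (1 - t)) ≤ 0) :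
    gibbsProb n l s A ≤
      Real.exp (√n ^ 3 * (finiteRate n l r t - finiteRate n l r s)) * gibbsProb n l t A := by
  have hZs := Zfun_pos (n := n) hl hs.le
  have hZt := Zfun_pos (n := n) hl ht.le
  set K := Real.exp (r * √n ^ 3 * (Real.log (1 - s) - Real.log (1 - t))) with hK
  have hw : ∀ G ∈ A, gibbsWeight l s G ≤ K * gibbsWeight l t G := fun G hG => by
    have hpow : ∀ u < 1, (1 - u) ^ triCount G = Real.exp (triCount G * Real.log (1 - u)) :=
      fun u hu => by rw [Real.exp_nat_mul, Real.exp_log (sub_pos.2 hu)]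
    rw [gibbsWeight, gibbsWeight, mul_left_comm]
    refine mul_le_mul_of_nonneg_left ?_ (pow_nonneg hl _)
    rw [hpow s hs, hpow t ht, hK, ← Real.exp_add, Real.exp_le_exp]
    nlinarith [h G hG]
  have hexp : Real.exp (√n ^ 3 * (finiteRate n l r t - finiteRate n l r s)) =
      K * (Zfun n l t / Zfun n l s) := by
    rw [Zfun_div_Zfun hn hl hs.le ht.le, hK, ← Real.exp_add]
    congr 1
    simp only [finiteRate]
    ring
  rw [hexp, gibbsProb, gibbsProb, mul_assoc, div_mul_div_comm, mul_comm (Zfun n l t),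
    mul_div_mul_right _ _ hZt.ne', mul_div_assoc', Finset.mul_sum]
  refine div_le_div_of_nonneg_right (Finset.sum_le_sum fun G _ => ?_) hZs.le
  split_ifs with hG
  · exact hw G hG
  · rw [mul_zero]

lemma gibbsProb_triangle_free (n : ℕ) (l : ℝ) :
    gibbsProb n l 0 {G | (triCount G : ℝ) ≤ 0} = Zfun n l 1 / Zfun n l 0 := by
  rw [gibbsProb]
  congr 1
  refine Finset.sum_congr rfl fun G _ => ?_
  simp only [Set.mem_ofPred_eq, Nat.cast_nonpos, gibbsWeight, sub_zero, one_pow, mul_one, sub_self]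
  split_ifs with h
  · simp [h]
  · simp [h]

variable {W : ℝ → ℝ} {c : ℝ} {lam : ℕ → ℝ}

lemma tendsto_finiteRate (hW : IsLambertW W) (hc : 0 < c)
    (hl : ∀ n, 0 < lam n) (hlc : Tendsto (fun n : ℕ => √n * lam n) atTop (nhds c)) {s : ℝ}
    (hs0 : 0 ≤ s) (hs : s ≤ 1) (hsc : 2 * (s * c ^ 2) ≤ 1) {r : ℕ → ℝ} {r₀ : ℝ}
    (hr : Tendsto r atTop (nhds r₀)) :
    Tendsto (fun n => finiteRate n (lam n) (r n) s) atTop (nhds (tiltedRate W c r₀ s)) :=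
  (hr.mul_const _).neg.add (tendsto_pressure hW hc hl hlc hs0 hs hsc)

lemma tendsto_sqrt_pow_three : Tendsto (fun n : ℕ => √(n : ℝ) ^ 3) atTop atTop :=
  (tendsto_pow_atTop (by norm_num)).comp
    (Real.tendsto_sqrt_atTop.comp tendsto_natCast_atTop_atTop)

lemma tendsto_exp_mul_zero {u : ℕ → ℝ} {u₀ : ℝ} (hu : Tendsto u atTop (nhds u₀)) (h : u₀ < 0) :
    Tendsto (fun n : ℕ => Real.exp (√n ^ 3 * u n)) atTop (nhds 0) :=
  Real.tendsto_exp_atBot.comp (tendsto_sqrt_pow_three.atTop_mul_neg h hu)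

lemma log_gibbsProb_le (hn : 0 < n) (hl : 0 ≤ l) {t r : ℝ} (ht0 : 0 ≤ t) (ht : t < 1)
    (hpos : 0 < gibbsProb n l 0 {G | (triCount G : ℝ) ≤ r * √n ^ 3}) :
    Real.log (gibbsProb n l 0 {G | (triCount G : ℝ) ≤ r * √n ^ 3}) / √n ^ 3 ≤
      finiteRate n l r t := by
  have hsq : (0 : ℝ) < √n := Real.sqrt_pos.2 (by exact_mod_cast hn)
  have h1 := gibbsProb_le_exp_mul hn hl one_pos ht r
    (A := {G | (triCount G : ℝ) ≤ r * √n ^ 3}) fun G hG => by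
      have : Real.log (1 - t) ≤ 0 := Real.log_nonpos (by linarith) (by linarith)
      rw [sub_zero, Real.log_one]
      exact mul_nonpos_of_nonpos_of_nonneg (sub_nonpos.2 hG) (by linarith)
  have h2 := h1.trans (mul_le_of_le_one_right (Real.exp_pos _).le (gibbsProb_le_one hl ht.le _))
  rw [finiteRate_zero hl, sub_zero] at h2
  rw [div_le_iff₀' (by positivity)]
  exact (Real.log_le_iff_le_exp hpos).2 h2

lemma gibbsProb_triCount_le_pos (hl : 0 ≤ l) {x : ℝ} (hx : 0 ≤ x) :
    0 < gibbsProb n l 0 {G | (triCount G : ℝ) ≤ x} := by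
  refine lt_of_lt_of_le ?_ (gibbsProb_mono hl zero_le_one
    (A := {G | (triCount G : ℝ) ≤ 0}) fun G (hG : _ ≤ _) => hG.trans hx)
  rw [gibbsProb_triangle_free]
  exact div_pos (Zfun_pos hl le_rfl) (Zfun_pos hl zero_le_one)

/-- Lower bound on the lower tail from two-sided concentration under a Gibbs measure. -/
lemma le_log_gibbsProb (hn : 0 < n) (hl : 0 ≤ l) {s x υ : ℝ} (hs0 : 0 ≤ s) (hs : s < 1)
    (hx : 0 ≤ x)
    (h1 : gibbsProb n l s {G | x < triCount G} ≤ 1 / 4)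
    (h2 : gibbsProb n l s {G | triCount G < υ * √n ^ 3} ≤ 1 / 4) :
    finiteRate n l υ s - Real.log 2 / √n ^ 3 ≤
      Real.log (gibbsProb n l 0 {G | (triCount G : ℝ) ≤ x}) / √n ^ 3 := by
  have hsq : (0 : ℝ) < √n := Real.sqrt_pos.2 (by exact_mod_cast hn)
  set A := {G : SimpleGraph (Fin n) | (triCount G : ℝ) ≤ x ∧ υ * √n ^ 3 ≤ triCount G} with hA
  have hA1 : 1 / 2 ≤ gibbsProb n l s A := by
    have hcov : Set.univ ⊆ A ∪ ({G : SimpleGraph (Fin n) | x < triCount G} ∪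
        {G | triCount G < υ * √n ^ 3}) := fun G _ => by
      simp only [hA, Set.mem_union, Set.mem_ofPred_eq]
      rcases le_or_gt (triCount G : ℝ) x with h | h
      · rcases le_or_gt (υ * √n ^ 3) (triCount G : ℝ) with h' | h'
        · exact Or.inl ⟨h, h'⟩
        · exact Or.inr (Or.inr h')
      · exact Or.inr (Or.inl h)
    have h3 := gibbsProb_mono hl hs.le hcov
    rw [gibbsProb_univ hl hs.le] at h3
    have h4 := gibbsProb_union_le hl hs.le A ({G : SimpleGraph (Fin n) | x < triCount G} ∪
        {G | triCount G < υ * √n ^ 3})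
    have h5 := gibbsProb_union_le hl hs.le {G : SimpleGraph (Fin n) | x < triCount G}
        {G | triCount G < υ * √n ^ 3}
    linarith
  have h6 := gibbsProb_le_exp_mul hn hl hs one_pos υ (A := A) fun G hG => by
    have : Real.log (1 - s) ≤ 0 := Real.log_nonpos (by linarith) (by linarith)
    rw [sub_zero, Real.log_one]
    exact mul_nonpos_of_nonneg_of_nonpos (sub_nonneg.2 hG.2) (by linarith)
  rw [finiteRate_zero hl, zero_sub] at h6
  have h7 := gibbsProb_mono (n := n) hl zero_le_one
    (show A ⊆ {G | (triCount G : ℝ) ≤ x} from fun G hG => hG.1)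
  have hpos := gibbsProb_triCount_le_pos (n := n) hl hx
  have h8 : Real.exp (√n ^ 3 * finiteRate n l υ s - Real.log 2) ≤
      gibbsProb n l 0 {G | (triCount G : ℝ) ≤ x} := by
    have h9 : 1 / 2 ≤ Real.exp (√n ^ 3 * -finiteRate n l υ s) *
        gibbsProb n l 0 {G | (triCount G : ℝ) ≤ x} :=
      hA1.trans (h6.trans (mul_le_mul_of_nonneg_left h7 (Real.exp_pos _).le))
    rw [mul_neg, Real.exp_neg, ← div_eq_inv_mul, le_div_iff₀ (Real.exp_pos _)] at h9
    rw [Real.exp_sub, Real.exp_log two_pos]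
    linarith
  rw [← Real.le_log_iff_exp_le hpos] at h8
  rw [le_div_iff₀ (by positivity), sub_mul, div_mul_cancel₀ _ (by positivity)]
  linarith

lemma tendsto_log_gibbsProb (hW : IsLambertW W) (hc : 0 < c)
    (hl : ∀ n, 0 < lam n) (hlc : Tendsto (fun n : ℕ => √n * lam n) atTop (nhds c)) {ζ : ℝ}
    (hζ0 : 0 < ζ) (hζ : ζ < 1) (hζc : 2 * (ζ * c ^ 2) < 1) {r : ℕ → ℝ} (hr0 : ∀ n, 0 ≤ r n)
    (hr : Tendsto r atTop (nhds (gibbsTriangle W c ζ))) :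
    Tendsto (fun n : ℕ => Real.log (gibbsProb n (lam n) 0
      {G | (triCount G : ℝ) ≤ r n * √n ^ 3}) / √n ^ 3) atTop
      (nhds (tiltedRate W c (gibbsTriangle W c ζ) ζ)) := by
  have hx : ∀ n : ℕ, 0 ≤ r n * √n ^ 3 := fun n =>
    mul_nonneg (hr0 n) (pow_nonneg (Real.sqrt_nonneg _) 3)
  have hupper := tendsto_finiteRate hW hc hl hlc hζ0.le hζ.le hζc.le hr
  refine tendsto_order.2 ⟨fun v hv => ?_, fun v hv => ?_⟩
  · have hcont : Tendsto (fun σ => tiltedRate W c (gibbsTriangle W c σ) ((ζ + σ) / 2))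
        (nhdsWithin ζ (Set.Ioi ζ)) (nhds (tiltedRate W c (gibbsTriangle W c ζ) ζ)) := by
      have hm : Tendsto (fun σ : ℝ => (ζ + σ) / 2) (nhds ζ) (nhds ζ) := by
        have : Continuous fun σ : ℝ => (ζ + σ) / 2 := by fun_prop
        simpa using this.tendsto ζ
      have h1 : Tendsto (gibbsTriangle W c) (nhds ζ) (nhds (gibbsTriangle W c ζ)) :=
        (continuousOn_gibbsTriangle hW).continuousAt (Ici_mem_nhds hζ0)
      have h2 : Tendsto (limitPressure W c) (nhds ζ) (nhds (limitPressure W c ζ)) :=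
        (continuousOn_limitPressure hW).continuousAt (Ici_mem_nhds hζ0)
      have h3 : Tendsto (fun σ : ℝ => Real.log (1 - (ζ + σ) / 2)) (nhds ζ)
          (nhds (Real.log (1 - ζ))) := (hm.const_sub 1).log (by linarith)
      exact ((h1.mul h3).neg.add (h2.comp hm)).mono_left nhdsWithin_le_nhds
    have hsmall : ∀ᶠ σ in nhds ζ, σ < 1 ∧ 2 * (σ * c ^ 2) < 1 :=
      (gt_mem_nhds hζ).and ((Continuous.tendsto (f := fun σ => 2 * (σ * c ^ 2)) (by fun_prop)
        ζ).eventually (gt_mem_nhds hζc))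
    obtain ⟨σ, ⟨hvσ, hσ1, hσc⟩, hζσ⟩ := ((hcont.eventually (lt_mem_nhds hv)).and
      (hsmall.filter_mono nhdsWithin_le_nhds) |>.and self_mem_nhdsWithin).exists
    have hζσ' : ζ < σ := hζσ
    set s := (ζ + σ) / 2 with hs
    have hζs : ζ < s := by linarith
    have hsσ : s < σ := by linarith
    have hs1 : s < 1 := hsσ.trans hσ1
    have hs0 : 0 < s := hζ0.trans hζs
    have hσ0 : 0 < σ := hs0.trans hsσ
    have hsc : 2 * (s * c ^ 2) ≤ 1 := by
      have : s * c ^ 2 ≤ σ * c ^ 2 := by gcongr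
      linarith
    have hlog1 : Real.log (1 - s) ≤ Real.log (1 - ζ) :=
      Real.log_le_log (by linarith) (by linarith)
    have hlog2 : Real.log (1 - σ) ≤ Real.log (1 - s) :=
      Real.log_le_log (by linarith) (by linarith)
    set υ := gibbsTriangle W c σ with hυ
    have hυlim : Tendsto (fun _ : ℕ => υ) atTop (nhds υ) := tendsto_const_nhds
    have hq1 := tendsto_exp_mul_zero (hupper.sub (tendsto_finiteRate hW hc hl hlc hs0.le hs1.le
      hsc hr)) (sub_neg.2 (tiltedRate_lt hW hc hζ0.le hs1 hζs))
    have hq2 := tendsto_exp_mul_zero ((tendsto_finiteRate hW hc hl hlc hσ0.le hσ1.le hσc.le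
      hυlim).sub (tendsto_finiteRate hW hc hl hlc hs0.le hs1.le hsc hυlim))
      (sub_neg.2 (tiltedRate_gt hW hc hs0.le hσ1 hsσ))
    have hlim := (tendsto_finiteRate hW hc hl hlc hs0.le hs1.le hsc hυlim).sub
      (tendsto_sqrt_pow_three.const_div_atTop (Real.log 2))
    rw [sub_zero] at hlim
    filter_upwards [hq1.eventually (gt_mem_nhds (show (0 : ℝ) < 1 / 4 by norm_num)),
      hq2.eventually (gt_mem_nhds (show (0 : ℝ) < 1 / 4 by norm_num)),
      hlim.eventually (lt_mem_nhds hvσ), eventually_gt_atTop 0] with n hn1 hn2 hn3 hn4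
    refine hn3.trans_le (le_log_gibbsProb hn4 (hl n).le hs0.le hs1 (hx n) ?_ ?_)
    · refine ((gibbsProb_le_exp_mul hn4 (hl n).le hs1 hζ (r n) fun G hG => ?_).trans
        (mul_le_of_le_one_right (Real.exp_pos _).le
          (gibbsProb_le_one (hl n).le hζ.le _))).trans hn1.le
      exact mul_nonpos_of_nonneg_of_nonpos (sub_nonneg.2 (le_of_lt hG)) (sub_nonpos.2 hlog1)
    · refine ((gibbsProb_le_exp_mul hn4 (hl n).le hs1 hσ1 υ fun G hG => ?_).trans
        (mul_le_of_le_one_right (Real.exp_pos _).le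
          (gibbsProb_le_one (hl n).le hσ1.le _))).trans hn2.le
      exact mul_nonpos_of_nonpos_of_nonneg (sub_nonpos.2 (le_of_lt hG)) (sub_nonneg.2 hlog2)
  · filter_upwards [hupper.eventually (gt_mem_nhds hv), eventually_gt_atTop 0] with n hn1 hn2
    exact (log_gibbsProb_le hn2 (hl n).le hζ0.le hζ
      (gibbsProb_triCount_le_pos (hl n).le (hx n))).trans_lt hn1

end LowerTail

/-- **Theorem (lower-tail asymptotics for triangles in `G(n,p)` in the critical window).** -/
theorem lower_tail_asymptotics
    (W : ℝ → ℝ) (hW : IsLambertW W)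
    (c η : ℝ) (hc : 0 < c) (hη : η ∈ Set.Ico (0 : ℝ) 1) (hcbar : LtCbar W c η)
    (zeta : ℝ) (hzeta : zeta ∈ Set.Icc (0 : ℝ) 1) (hzetaEq : zetaLHS W c zeta = η)
    (p : ℕ → ℝ) (hp : ∀ n, p n ∈ Set.Ioo (0 : ℝ) 1)
    (hpc : Tendsto (fun n : ℕ => Real.sqrt n * p n) atTop (nhds c)) :
    Tendsto (fun n : ℕ =>
        Real.log (erProb n (p n)
          {G | (triCount G : ℝ) ≤ η * (n.choose 3 : ℝ) * p n ^ 3}) / (n : ℝ) ^ ((3 : ℝ) / 2))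
      atTop
      (nhds ((1 / 2) *
        ((W (2 * zeta * c ^ 2) ^ ((3 : ℝ) / 2) + 3 * W (2 * zeta * c ^ 2) ^ ((1 : ℝ) / 2)) /
            (3 * Real.sqrt (2 * zeta))
          - Real.log (1 - zeta) * η * c ^ 3 / 3 - c))) := by

  have hp0 : Tendsto p atTop (nhds 0) := tendsto_zero_of_sqrt_mul hpc
  set lam : ℕ → ℝ := fun n => p n / (1 - p n) with hlam
  have hl : ∀ n, 0 < lam n := fun n => div_pos (hp n).1 (sub_pos.2 (hp n).2)
  have hlc : Tendsto (fun n : ℕ => √n * lam n) atTop (nhds c) := by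
    have := hpc.div (hp0.const_sub 1) (by norm_num)
    rw [sub_zero, div_one] at this
    exact this.congr fun n => mul_div_assoc _ _ _
  have hζ0 : 0 < zeta := by
    refine hzeta.1.lt_of_ne fun h => ?_
    rw [← h, zetaLHS, if_pos rfl] at hzetaEq
    linarith [hη.2]
  have hζc := mul_sq_lt_of_ltCbar hW hc hcbar hζ0 hzeta.2 hzetaEq
  have htri := gibbsTriangle_eq hW hc hζ0 hzetaEq
  simp_rw [fun n => erProb_eq_gibbsProb (n := n) (hp n), sqrt_pow_three]
  rcases hzeta.2.eq_or_lt with h1 | h1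
  · have hη0 : η = 0 := by rw [← hzetaEq, zetaLHS, h1, sub_self, zero_mul]
    have hlim := tendsto_pressure hW hc hl hlc hζ0.le hzeta.2 hζc.le
    rw [limitPressure_eq hW hc hζ0] at hlim
    simp only [hη0, zero_mul, mul_zero, zero_div, sub_zero]
    refine hlim.congr fun n => ?_
    rw [gibbsProb_triangle_free, pressure, partFun_triplePairs_eq_Zfun,
      partFun_triplePairs_eq_Zfun, h1]
  · set r : ℕ → ℝ := fun n => η * ((n.choose 3 : ℝ) / (n : ℝ) ^ 3 * (√n * p n) ^ 3) with hr
    have hr0 : ∀ n, 0 ≤ r n := fun n => by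
      have := (hp n).1.le
      have := hη.1
      positivity
    have hrlim : Tendsto r atTop (nhds (gibbsTriangle W c zeta)) := by
      have := (tendsto_choose_three_div.mul (hpc.pow 3)).const_mul η
      rwa [htri, show η * c ^ 3 / 6 = η * (1 / 6 * c ^ 3) by ring]
    have hlim := tendsto_log_gibbsProb hW hc hl hlc hζ0 h1 hζc hr0 hrlim
    rw [tiltedRate, limitPressure_eq hW hc hζ0, htri] at hlim
    convert hlim.congr' ?_ using 2
    · ring
    · filter_upwards [eventually_gt_atTop 0] with n hn
      have hsq : √(n : ℝ) ≠ 0 := (Real.sqrt_pos.2 (by exact_mod_cast hn)).ne'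
      have hx : r n * √n ^ 3 = η * (n.choose 3 : ℝ) * p n ^ 3 := by
        rw [hr]
        simp only
        rw [← choose_three_mul_div_sqrt hn, mul_div_cancel_left₀ _ hsq]
        field_simp
      rw [hx]
end
end

section
/- Fix 0 < c < e^{-1/2}. Let p : ℕ → (0,1) be any sequence with √n·p(n) → c as n → ∞. Then lim_{n→∞} n^{-3/2}·log P_{p(n)}( X = 0 ) = (1/2)·[ ( W(2c²)^{3/2} + 3·W(2c²)^{1/2} ) / (3·√2) − c ]. -/
open Filter
open scoped BigOperators symmDiff Classical

noncomputable section

section LinearHypergraph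

/-- A linear 3-uniform hypergraph on `E`, presented by its symmetric ternary incidence relation:
two vertices lie in at most one common triple. -/
structure LinearTriples (E : Type*) where
  rel : E → E → E → Prop
  swap_left : ∀ {a b c}, rel a b c → rel b a c
  swap_right : ∀ {a b c}, rel a b c → rel a c b
  ne : ∀ {a b c}, rel a b c → a ≠ b
  unique : ∀ {a b c c'}, rel a b c → rel a b c' → c = c'

namespace LinearTriples

lemma ne_right {E : Type*} {H : LinearTriples E} {a b c : E} (h : H.rel a b c) : b ≠ c :=
  H.ne (H.swap_right (H.swap_left h))

lemma rel_rot {E : Type*} {H : LinearTriples E} {a b c : E} (h : H.rel a b c) : H.rel b c a := H.swap_right (H.swap_left h)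

end LinearTriples

variable {E : Type*} [Fintype E]

/-- Sum of `lam ^ |S|` over the finite sets `S` satisfying `A`. -/
def weightSum (lam : ℝ) (A : Finset E → Prop) : ℝ :=
  ∑ S : Finset E, if A S then lam ^ S.card else 0

lemma weightSum_nonneg {lam : ℝ} (hl : 0 ≤ lam) (A : Finset E → Prop) : 0 ≤ weightSum lam A :=
  Finset.sum_nonneg fun S _ => by split_ifs <;> positivity

lemma weightSum_mono {lam : ℝ} (hl : 0 ≤ lam) {A B : Finset E → Prop} (h : ∀ S, A S → B S) :
    weightSum lam A ≤ weightSum lam B :=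
  Finset.sum_le_sum fun S _ => by
    by_cases hA : A S
    · simp [hA, h S hA]
    · simp only [hA, if_false]; split_ifs <;> positivity

lemma weightSum_congr {lam : ℝ} {A B : Finset E → Prop} (h : ∀ S, A S ↔ B S) :
    weightSum lam A = weightSum lam B := by
  congr 1; funext S; exact propext (h S)

lemma weightSum_split (lam : ℝ) (A B : Finset E → Prop) :
    weightSum lam A = weightSum lam (fun S => A S ∧ ¬ B S) + weightSum lam (fun S => A S ∧ B S) := by
  unfold weightSum
  rw [← Finset.sum_add_distrib]
  refine Finset.sum_congr rfl fun S _ => ?_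
  by_cases hA : A S <;> by_cases hB : B S <;> simp [hA, hB]

lemma weightSum_mem (lam : ℝ) (A : Finset E → Prop) (e : E) :
    weightSum lam (fun S => A S ∧ e ∈ S) =
      lam * weightSum lam (fun S => e ∉ S ∧ A (insert e S)) := by
  unfold weightSum
  rw [Finset.mul_sum]
  refine Finset.sum_bij_ne_zero (fun S _ _ => S.erase e) (fun _ _ _ => Finset.mem_univ _)
    (fun S _ hS S' _ hS' h => ?_) (fun S _ hS => ⟨insert e S, Finset.mem_univ _, ?_⟩)
    (fun S _ hS => ?_)
  · have h1 : e ∈ S := by by_contra h; simp [h] at hS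
    have h2 : e ∈ S' := by by_contra h; simp [h] at hS'
    rw [← Finset.insert_erase h1, h, Finset.insert_erase h2]
  · have h : e ∉ S ∧ A (insert e S) := by by_contra h; simp only [h, if_false] at hS; simp at hS
    simp only [h, if_true, ne_eq, mul_eq_zero, not_or, not_false_eq_true, and_self] at hS
    refine ⟨?_, Finset.erase_insert h.1⟩
    simp only [h.2, Finset.mem_insert_self, and_self, if_true, Finset.card_insert_of_notMem h.1,
      pow_succ]
    exact mul_ne_zero hS.2 hS.1
  · have h : A S ∧ e ∈ S := by by_contra h; simp only [h, if_false] at hS; simp at hS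
    simp only [h, Finset.notMem_erase, Finset.insert_erase h.2, not_false_eq_true, and_self,
      if_true, ← pow_succ']
    rw [Finset.card_erase_add_one h.2]

namespace LinearTriples

variable (H : LinearTriples E)

/-- The pairs completing `e` to a triple. -/
def link (e : E) : Finset (Sym2 E) :=
  Finset.univ.filter fun q => ∃ f g, q = s(f, g) ∧ H.rel e f g

/-- `S` avoids the vertices in `D`, contains no pair in `P`, and contains no triple of `H`. -/
def Valid (P : Finset (Sym2 E)) (D S : Finset E) : Prop :=
  (∀ x ∈ S, x ∉ D) ∧ (∀ x ∈ S, ∀ y ∈ S, s(x, y) ∉ P) ∧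
    ∀ x ∈ S, ∀ y ∈ S, ∀ z ∈ S, ¬ H.rel x y z

/-- The vertices joined to `e` by a pair in `P`. -/
def nbr (P : Finset (Sym2 E)) (e : E) : Finset E := Finset.univ.filter fun f => s(e, f) ∈ P

/-- The vertices to be deleted once `e` has been decided. -/
def delAt (P : Finset (Sym2 E)) (D : Finset E) (e : E) : Finset E := insert e D ∪ nbr P e

/-- The partition function of the constraints `(P, D)` at fugacity `lam`. -/
def part (lam : ℝ) (P : Finset (Sym2 E)) (D : Finset E) : ℝ := weightSum lam (H.Valid P D)

/-- The part of the partition function carried by the sets containing `e`. -/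
def partMem (lam : ℝ) (P : Finset (Sym2 E)) (D : Finset E) (e : E) : ℝ :=
  weightSum lam (fun S => H.Valid P D S ∧ e ∈ S)

variable {H}

lemma mem_link {e f g : E} : s(f, g) ∈ H.link e ↔ H.rel e f g := by
  simp only [link, Finset.mem_filter, Finset.mem_univ, true_and]
  constructor
  · rintro ⟨a, b, h, hr⟩
    rcases Sym2.eq_iff.1 h with ⟨rfl, rfl⟩ | ⟨rfl, rfl⟩
    · exact hr
    · exact H.swap_right hr
  · exact fun h => ⟨f, g, rfl, h⟩

lemma mem_boundary {P : Finset (Sym2 E)} {D : Finset E} (hP : P ⊆ D.biUnion H.link) {f g : E}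
    (h : s(f, g) ∈ P) : ∃ d ∈ D, H.rel d f g := by
  obtain ⟨d, hd, h⟩ := Finset.mem_biUnion.1 (hP h)
  exact ⟨d, hd, mem_link.1 h⟩

lemma card_nbr_le {P : Finset (Sym2 E)} {D : Finset E} (hP : P ⊆ D.biUnion H.link) (e : E) :
    (nbr P e).card ≤ D.card := by
  have : nbr P e ⊆ D.biUnion fun d => Finset.univ.filter fun f => H.rel d e f := by
    intro f hf
    obtain ⟨d, hd, h⟩ := mem_boundary hP (Finset.mem_filter.1 hf).2
    simp only [Finset.mem_biUnion, Finset.mem_filter, Finset.mem_univ, true_and]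
    exact ⟨d, hd, h⟩
  refine (Finset.card_le_card this).trans ((Finset.card_biUnion_le_card_mul _ _ 1 ?_).trans
    (by simp))
  intro d _
  refine Finset.card_le_one.2 fun a ha b hb => ?_
  exact H.unique (Finset.mem_filter.1 ha).2 (Finset.mem_filter.1 hb).2

lemma card_delAt_le {P : Finset (Sym2 E)} {D : Finset E} (hP : P ⊆ D.biUnion H.link) (e : E) :
    (delAt P D e).card ≤ 2 * D.card + 1 := by
  have h1 := Finset.card_union_le (insert e D) (nbr P e)
  have h2 := Finset.card_insert_le e D
  have h3 := card_nbr_le hP e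
  unfold delAt
  omega

lemma valid_insert {P : Finset (Sym2 E)} {D : Finset E} {e : E} (he : e ∉ D)
    (hee : s(e, e) ∉ P) {S : Finset E} :
    (e ∉ S ∧ H.Valid P D (insert e S)) ↔ H.Valid (P ∪ H.link e) (delAt P D e) S := by
  constructor
  · rintro ⟨heS, h1, h2, h3⟩
    refine ⟨fun x hx hxD => ?_, fun x hx y hy h => ?_, fun x hx y hy z hz => ?_⟩
    · simp only [delAt, nbr, Finset.mem_union, Finset.mem_insert, Finset.mem_filter,
        Finset.mem_univ, true_and] at hxD
      rcases hxD with (rfl | h) | h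
      · exact heS hx
      · exact h1 x (Finset.mem_insert_of_mem hx) h
      · exact h2 e (Finset.mem_insert_self _ _) x (Finset.mem_insert_of_mem hx) h
    · rcases Finset.mem_union.1 h with h | h
      · exact h2 x (Finset.mem_insert_of_mem hx) y (Finset.mem_insert_of_mem hy) h
      · exact h3 e (Finset.mem_insert_self _ _) x (Finset.mem_insert_of_mem hx) y
          (Finset.mem_insert_of_mem hy) (mem_link.1 h)
    · exact h3 x (Finset.mem_insert_of_mem hx) y (Finset.mem_insert_of_mem hy) z
        (Finset.mem_insert_of_mem hz)
  · rintro ⟨h1, h2, h3⟩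
    have hD : ∀ x ∈ S, x ≠ e ∧ x ∉ D ∧ s(e, x) ∉ P := fun x hx => by
      have := h1 x hx
      simp only [delAt, nbr, Finset.mem_union, Finset.mem_insert, Finset.mem_filter,
        Finset.mem_univ, true_and] at this
      tauto
    have hP : ∀ x ∈ S, ∀ y ∈ S, s(x, y) ∉ P ∧ ¬ H.rel e x y := fun x hx y hy => by
      have := h2 x hx y hy
      rw [Finset.mem_union, mem_link] at this
      tauto
    refine ⟨fun h => (hD e h).1 rfl, fun x hx => ?_, fun x hx y hy => ?_, fun x hx y hy z hz h => ?_⟩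
    · rcases Finset.mem_insert.1 hx with rfl | hx
      · exact he
      · exact (hD x hx).2.1
    · rcases Finset.mem_insert.1 hx with rfl | hx <;> rcases Finset.mem_insert.1 hy with rfl | hy
      · exact hee
      · exact (hD y hy).2.2
      · rw [Sym2.eq_swap]; exact (hD x ‹_›).2.2
      · exact (hP x ‹_› y ‹_›).1
    · have n1 := H.ne h
      have n2 := ne_right h
      have n3 := ne_right (rel_rot h)
      rcases Finset.mem_insert.1 hx with rfl | hx <;> rcases Finset.mem_insert.1 hy with rfl | hy <;>
        rcases Finset.mem_insert.1 hz with rfl | hz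
      · exact n1 rfl
      · exact n1 rfl
      · exact n3 rfl
      · exact (hP y hy z hz).2 h
      · exact n2 rfl
      · exact (hP x ‹_› z ‹_›).2 (H.swap_left h)
      · exact (hP x ‹_› y ‹_›).2 (rel_rot (rel_rot h))
      · exact h3 x hx y hy z hz h

lemma part_nonneg {lam : ℝ} (hl : 0 ≤ lam) (P : Finset (Sym2 E)) (D : Finset E) :
    0 ≤ H.part lam P D := weightSum_nonneg hl _

lemma part_pos {lam : ℝ} (hl : 0 ≤ lam) (P : Finset (Sym2 E)) (D : Finset E) :
    0 < H.part lam P D := by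
  have h : (if H.Valid P D ∅ then lam ^ (∅ : Finset E).card else 0) ≤ H.part lam P D :=
    Finset.single_le_sum (f := fun S => if H.Valid P D S then lam ^ S.card else 0)
      (fun S _ => by split_ifs <;> positivity) (Finset.mem_univ ∅)
  rw [if_pos (by simp [Valid])] at h
  simp at h
  linarith

lemma part_anti {lam : ℝ} (hl : 0 ≤ lam) {P P' : Finset (Sym2 E)} {D D' : Finset E}
    (hP : P ⊆ P') (hD : D ⊆ D') : H.part lam P' D' ≤ H.part lam P D :=
  weightSum_mono hl fun _ h => ⟨fun x hx hxD => h.1 x hx (hD hxD),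
    fun x hx y hy hxy => h.2.1 x hx y hy (hP hxy), h.2.2⟩

lemma loop_notMem {P : Finset (Sym2 E)} {D : Finset E} (hP : P ⊆ D.biUnion H.link) (e : E) :
    s(e, e) ∉ P := fun h => by
  obtain ⟨d, _, h⟩ := mem_boundary hP h
  exact ne_right h rfl

lemma link_delAt {P : Finset (Sym2 E)} {D : Finset E} (hP : P ⊆ D.biUnion H.link) (e : E) :
    P ∪ H.link e ⊆ (delAt P D e).biUnion H.link := by
  refine Finset.union_subset (hP.trans (Finset.biUnion_subset_biUnion_of_subset_left _ ?_)) ?_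
  · exact fun x hx => Finset.mem_union_left _ (Finset.mem_insert_of_mem hx)
  · exact Finset.subset_biUnion_of_mem H.link
      (Finset.mem_union_left _ (Finset.mem_insert_self e D))

lemma partMem_eq {P : Finset (Sym2 E)} {D : Finset E} (hP : P ⊆ D.biUnion H.link) {e : E}
    (he : e ∉ D) (lam : ℝ) :
    H.partMem lam P D e = lam * H.part lam (P ∪ H.link e) (delAt P D e) := by
  unfold partMem part
  rw [weightSum_mem]
  exact congrArg _ (weightSum_congr fun S => valid_insert he (loop_notMem hP e))

lemma part_eq_add (lam : ℝ) (P : Finset (Sym2 E)) (D : Finset E) (e : E) :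
    H.part lam P D = H.part lam P (insert e D) + H.partMem lam P D e := by
  unfold partMem part
  rw [weightSum_split lam _ (fun S => e ∈ S)]
  congr 1
  refine weightSum_congr fun S => ?_
  constructor
  · rintro ⟨h, heS⟩
    refine ⟨fun x hx hxD => ?_, h.2⟩
    rcases Finset.mem_insert.1 hxD with rfl | hxD
    · exact heS hx
    · exact h.1 x hx hxD
  · rintro h
    exact ⟨⟨fun x hx hxD => h.1 x hx (Finset.mem_insert_of_mem hxD), h.2⟩,
      fun heS => h.1 e heS (Finset.mem_insert_self _ _)⟩

lemma partMem_of_mem {P : Finset (Sym2 E)} {D : Finset E} {e : E} (he : e ∈ D) (lam : ℝ) :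
    H.partMem lam P D e = 0 := by
  refine Finset.sum_eq_zero fun S _ => if_neg ?_
  rintro ⟨h, heS⟩
  exact h.1 e heS he

/-- Adding one pair of forbidden vertices. -/
lemma part_insert_pair {P : Finset (Sym2 E)} {D : Finset E} (hP : P ⊆ D.biUnion H.link) {f g : E}
    (hfg : f ≠ g) (hf : f ∉ D) (lam : ℝ) :
    H.part lam P D = H.part lam (insert s(f, g) P) D +
      lam * H.partMem lam (P ∪ H.link f) (delAt P D f) g := by
  have key : weightSum lam (fun S => (H.Valid P D S ∧ g ∈ S) ∧ f ∈ S) =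
      lam * H.partMem lam (P ∪ H.link f) (delAt P D f) g := by
    rw [weightSum_mem]
    refine congrArg _ (weightSum_congr fun S => ?_)
    rw [← valid_insert hf (loop_notMem hP f)]
    simp only [Finset.mem_insert, hfg.symm, false_or]
    tauto
  rw [← key]
  unfold part
  rw [weightSum_split lam _ (fun S => g ∈ S ∧ f ∈ S)]
  congr 1
  · refine weightSum_congr fun S => ?_
    constructor
    · rintro ⟨h, hn⟩
      refine ⟨h.1, fun x hx y hy hxy => ?_, h.2.2⟩
      rcases Finset.mem_insert.1 hxy with hxy | hxy
      · rcases Sym2.eq_iff.1 hxy with ⟨rfl, rfl⟩ | ⟨rfl, rfl⟩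
        · exact hn ⟨hy, hx⟩
        · exact hn ⟨hx, hy⟩
      · exact h.2.1 x hx y hy hxy
    · intro h
      exact ⟨⟨h.1, fun x hx y hy hxy => h.2.1 x hx y hy (Finset.mem_insert_of_mem hxy), h.2.2⟩,
        fun hn => h.2.1 f hn.2 g hn.1 (Finset.mem_insert_self _ _)⟩
  · exact weightSum_congr fun S => by tauto

lemma part_le_mul_insert {lam : ℝ} (hl : 0 ≤ lam) {P : Finset (Sym2 E)} {D : Finset E}
    (hP : P ⊆ D.biUnion H.link) (e : E) :
    H.part lam P D ≤ (1 + lam) * H.part lam P (insert e D) := by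
  have h0 := part_nonneg (H := H) hl P (insert e D)
  have h := part_eq_add (H := H) lam P D e
  by_cases he : e ∈ D
  · rw [partMem_of_mem he] at h
    nlinarith
  · rw [partMem_eq hP he] at h
    have := part_anti (H := H) hl (Finset.subset_union_left (s₁ := P) (s₂ := H.link e))
      (Finset.subset_union_left (s₁ := insert e D) (s₂ := nbr P e))
    unfold delAt at h
    nlinarith

lemma part_le_mul_union {lam : ℝ} (hl : 0 ≤ lam) {P : Finset (Sym2 E)} {D : Finset E}
    (hP : P ⊆ D.biUnion H.link) (N : Finset E) :
    H.part lam P D ≤ (1 + lam) ^ N.card * H.part lam P (D ∪ N) := by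
  induction N using Finset.induction_on with
  | empty => simp
  | insert e N he ih =>
    rw [Finset.card_insert_of_notMem he, Finset.union_insert, pow_succ, mul_assoc]
    refine ih.trans (mul_le_mul_of_nonneg_left (part_le_mul_insert hl ?_ e) (by positivity))
    exact hP.trans (Finset.biUnion_subset_biUnion_of_subset_left _ Finset.subset_union_left)

variable (H) in
/-- Whenever at most `M` vertices are deleted, and the forbidden pairs come from deleted vertices,
every remaining vertex is occupied with probability between `α` and `β`. -/
def OccBounds (lam : ℝ) (M : ℕ) (α β : ℝ) : Prop :=
  ∀ (P : Finset (Sym2 E)) (D : Finset E), P ⊆ D.biUnion H.link → D.card ≤ M → ∀ e ∉ D,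
    α * H.part lam P D ≤ H.partMem lam P D e ∧ H.partMem lam P D e ≤ β * H.part lam P D

lemma occBounds_trivial {lam : ℝ} (hl : 0 ≤ lam) (M : ℕ) : H.OccBounds lam M 0 lam := by
  intro P D hP _ e he
  refine ⟨by simpa [partMem] using weightSum_nonneg hl _, ?_⟩
  rw [partMem_eq hP he]
  refine mul_le_mul_of_nonneg_left (part_anti hl Finset.subset_union_left ?_) hl
  exact (Finset.subset_insert e D).trans Finset.subset_union_left

lemma part_insert_of_mem {P : Finset (Sym2 E)} {D : Finset E} {f g : E} (hf : f ∈ D) (lam : ℝ) :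
    H.part lam (insert s(f, g) P) D = H.part lam P D := by
  refine weightSum_congr fun S => ⟨fun h => ⟨h.1, fun x hx y hy hxy =>
    h.2.1 x hx y hy (Finset.mem_insert_of_mem hxy), h.2.2⟩, fun h => ⟨h.1, ?_, h.2.2⟩⟩
  intro x hx y hy hxy
  rcases Finset.mem_insert.1 hxy with hxy | hxy
  · rcases Sym2.eq_iff.1 hxy with ⟨rfl, rfl⟩ | ⟨rfl, rfl⟩
    · exact h.1 x hx hf
    · exact h.1 y hy hf
  · exact h.2.1 x hx y hy hxy

lemma part_insert_pair_lower {lam α β : ℝ} (hl : 0 ≤ lam) (hβ : 0 ≤ β) {M : ℕ}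
    (hb : H.OccBounds lam (2 * M + 1) α β) {P : Finset (Sym2 E)} {D : Finset E}
    (hP : P ⊆ D.biUnion H.link) (hD : D.card ≤ M) {f g : E} (hfg : f ≠ g) :
    (1 - β ^ 2) * H.part lam P D ≤ H.part lam (insert s(f, g) P) D := by
  have h0 := part_nonneg (H := H) hl P D
  by_cases hf : f ∈ D
  · rw [part_insert_of_mem hf]
    nlinarith [mul_nonneg (sq_nonneg β) h0]
  have h1 := part_insert_pair hP hfg hf lam
  have h2 : H.partMem lam (P ∪ H.link f) (delAt P D f) g ≤
      β * H.part lam (P ∪ H.link f) (delAt P D f) := by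
    by_cases hg : g ∈ delAt P D f
    · rw [partMem_of_mem hg]
      exact mul_nonneg hβ (part_nonneg hl _ _)
    · exact (hb _ _ (link_delAt hP f) ((card_delAt_le hP f).trans (by omega)) g hg).2
  have h3 := (hb P D hP (by omega) f hf).2
  rw [partMem_eq hP hf] at h3
  have h4 := mul_le_mul_of_nonneg_left h2 hl
  have h5 := mul_le_mul_of_nonneg_left h3 hβ
  linarith

lemma part_insert_pair_upper {lam α β : ℝ} (hl : 0 ≤ lam) (hα : 0 ≤ α) {M : ℕ}
    (hb : H.OccBounds lam (2 * M + 1) α β) {P : Finset (Sym2 E)} {D : Finset E}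
    (hP : P ⊆ D.biUnion H.link) (hD : D.card ≤ M) {f g : E} (hfg : f ≠ g) (hf : f ∉ D)
    (hg : g ∉ D) (hfgP : s(f, g) ∉ P) :
    H.part lam (insert s(f, g) P) D ≤ (1 - α ^ 2) * H.part lam P D := by
  have h1 := part_insert_pair hP hfg hf lam
  have hg' : g ∉ delAt P D f := by
    simp only [delAt, nbr, Finset.mem_union, Finset.mem_insert, Finset.mem_filter,
      Finset.mem_univ, true_and, not_or]
    exact ⟨⟨hfg.symm, hg⟩, hfgP⟩
  have h2 := (hb _ _ (link_delAt hP f) ((card_delAt_le hP f).trans (by omega)) g hg').1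
  have h3 := (hb P D hP (by omega) f hf).1
  rw [partMem_eq hP hf] at h3
  have h4 := mul_le_mul_of_nonneg_left h2 hl
  have h5 := mul_le_mul_of_nonneg_left h3 hα
  linarith

lemma part_union_lower {lam α β : ℝ} (hl : 0 ≤ lam) (hβ : 0 ≤ β) (hβ1 : β ≤ 1) {M : ℕ}
    (hb : H.OccBounds lam (2 * M + 1) α β) {P : Finset (Sym2 E)} {D : Finset E}
    (hP : P ⊆ D.biUnion H.link) (hD : D.card ≤ M) {e : E} (he : e ∈ D) {Q : Finset (Sym2 E)}
    (hQ : Q ⊆ H.link e) :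
    (1 - β ^ 2) ^ Q.card * H.part lam P D ≤ H.part lam (P ∪ Q) D := by
  induction Q using Finset.induction_on with
  | empty => simp
  | insert q Q hq ih =>
    have hPQ : P ∪ Q ⊆ D.biUnion H.link :=
      Finset.union_subset hP (((Finset.subset_insert q Q).trans hQ).trans
        (Finset.subset_biUnion_of_mem H.link he))
    have hqe := hQ (Finset.mem_insert_self q Q)
    have h1 := ih ((Finset.subset_insert q Q).trans hQ)
    rw [Finset.card_insert_of_notMem hq, pow_succ', mul_assoc, Finset.union_insert]
    induction q using Sym2.ind with
    | _ f g =>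
      refine le_trans (mul_le_mul_of_nonneg_left h1 ?_)
        (part_insert_pair_lower hl hβ hb hPQ hD (ne_right (mem_link.1 hqe)))
      nlinarith

lemma part_union_upper {lam α β : ℝ} (hl : 0 ≤ lam) (hα : 0 ≤ α) (hα1 : α ≤ 1) {M : ℕ}
    (hb : H.OccBounds lam (2 * M + 1) α β) {P : Finset (Sym2 E)} {D : Finset E}
    (hP : P ⊆ D.biUnion H.link) (hD : D.card ≤ M) {e : E} (he : e ∈ D) {Q : Finset (Sym2 E)}
    (hQ : Q ⊆ H.link e) (hQD : ∀ q ∈ Q, ∀ x ∈ q, x ∉ D) (hQP : ∀ q ∈ Q, q ∉ P) :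
    H.part lam (P ∪ Q) D ≤ (1 - α ^ 2) ^ Q.card * H.part lam P D := by
  induction Q using Finset.induction_on with
  | empty => simp
  | insert q Q hq ih =>
    have hPQ : P ∪ Q ⊆ D.biUnion H.link :=
      Finset.union_subset hP (((Finset.subset_insert q Q).trans hQ).trans
        (Finset.subset_biUnion_of_mem H.link he))
    have hqe := hQ (Finset.mem_insert_self q Q)
    have h1 := ih ((Finset.subset_insert q Q).trans hQ)
      (fun q' hq' => hQD q' (Finset.mem_insert_of_mem hq'))
      (fun q' hq' => hQP q' (Finset.mem_insert_of_mem hq'))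
    have h2 := hQD q (Finset.mem_insert_self q Q)
    have h3 := hQP q (Finset.mem_insert_self q Q)
    rw [Finset.card_insert_of_notMem hq, pow_succ', mul_assoc, Finset.union_insert]
    induction q using Sym2.ind with
    | _ f g =>
      refine le_trans (part_insert_pair_upper hl hα hb hPQ hD (ne_right (mem_link.1 hqe))
        (h2 f (Sym2.mem_mk_left f g)) (h2 g (Sym2.mem_mk_right f g)) ?_)
        (mul_le_mul_of_nonneg_left h1 ?_)
      · rw [Finset.mem_union]; tauto
      · nlinarith

lemma card_link_filter {e : E} (D : Finset E) :
    (H.link e).card - D.card ≤ ((H.link e).filter fun q => ∀ x ∈ q, x ∉ D).card := by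
  have h := Finset.card_filter_add_card_filter_not (s := H.link e) (fun q => ∀ x ∈ q, x ∉ D)
  have h2 : ((H.link e).filter fun q => ¬ ∀ x ∈ q, x ∉ D).card ≤ D.card := by
    have hsub : ((H.link e).filter fun q => ¬ ∀ x ∈ q, x ∉ D) ⊆
        D.biUnion fun x => (H.link e).filter fun q => x ∈ q := by
      intro q hq
      simp only [Finset.mem_filter, not_forall, not_not] at hq
      obtain ⟨hq, x, hx, hxD⟩ := hq
      exact Finset.mem_biUnion.2 ⟨x, hxD, Finset.mem_filter.2 ⟨hq, hx⟩⟩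
    refine (Finset.card_le_card hsub).trans ((Finset.card_biUnion_le_card_mul _ _ 1 ?_).trans
      (by simp))
    intro x _
    refine Finset.card_le_one.2 fun a ha b hb => ?_
    obtain ⟨ha, hxa⟩ := Finset.mem_filter.1 ha
    obtain ⟨hb, hxb⟩ := Finset.mem_filter.1 hb
    obtain ⟨y, rfl⟩ := hxa
    obtain ⟨z, rfl⟩ := hxb
    rw [H.unique (mem_link.1 ha) (mem_link.1 hb)]
  omega

/-- One step of the tree recursion. -/
theorem occBounds_step {lam α β : ℝ} (hl : 0 ≤ lam) (hα : 0 ≤ α) (hα1 : α ≤ 1) (hβ : 0 ≤ β)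
    (hβ1 : β ≤ 1) {d M : ℕ} (hd : ∀ e, (H.link e).card = d)
    (hb : H.OccBounds lam (4 * M + 3) α β) :
    H.OccBounds lam M (lam * (1 - β ^ 2) ^ d / (1 + lam) ^ (M + 1))
      (lam * (1 - α ^ 2) ^ (d - (2 * M + 1))) := by
  intro P D hP hD e he
  have hD' : (delAt P D e).card ≤ 2 * M + 1 := (card_delAt_le hP e).trans (by omega)
  have hDD : D ⊆ delAt P D e := (Finset.subset_insert e D).trans Finset.subset_union_left
  have heD : e ∈ delAt P D e := Finset.mem_union_left _ (Finset.mem_insert_self e D)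
  have hP' : P ⊆ (delAt P D e).biUnion H.link := Finset.subset_union_left.trans (link_delAt hP e)
  have hb' : H.OccBounds lam (2 * (2 * M + 1) + 1) α β := by
    rwa [show 2 * (2 * M + 1) + 1 = 4 * M + 3 by ring]
  rw [partMem_eq hP he]
  constructor
  · have h1 := part_union_lower hl hβ hβ1 hb' hP' hD' heD (Finset.Subset.refl (H.link e))
    rw [hd] at h1
    have h2 : H.part lam P D ≤ (1 + lam) ^ (M + 1) * H.part lam P (delAt P D e) := by
      have h3 := part_le_mul_insert hl hP e
      have h4 := part_le_mul_union hl
        (hP.trans (Finset.biUnion_subset_biUnion_of_subset_left H.link (Finset.subset_insert e D)))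
        (nbr P e)
      have h5 : (1 + lam) ^ (nbr P e).card ≤ (1 + lam) ^ M :=
        pow_le_pow_right₀ (by linarith) ((card_nbr_le hP e).trans hD)
      have h6 := h4.trans (mul_le_mul_of_nonneg_right h5 (part_nonneg hl _ _))
      rw [pow_succ', mul_assoc]
      exact h3.trans (mul_le_mul_of_nonneg_left h6 (by linarith))
    have hpow : 0 < (1 + lam) ^ (M + 1) := by positivity
    have h1β : 0 ≤ lam * (1 - β ^ 2) ^ d := mul_nonneg hl (pow_nonneg (by nlinarith) d)
    rw [div_mul_eq_mul_div, div_le_iff₀ hpow]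
    calc lam * (1 - β ^ 2) ^ d * H.part lam P D
        ≤ lam * (1 - β ^ 2) ^ d * ((1 + lam) ^ (M + 1) * H.part lam P (delAt P D e)) :=
          mul_le_mul_of_nonneg_left h2 h1β
      _ = lam * (1 + lam) ^ (M + 1) * ((1 - β ^ 2) ^ d * H.part lam P (delAt P D e)) := by ring
      _ ≤ lam * (1 + lam) ^ (M + 1) * H.part lam (P ∪ H.link e) (delAt P D e) :=
          mul_le_mul_of_nonneg_left h1 (by positivity)
      _ = _ := by ring
  · have hQ := card_link_filter (H := H) (e := e) (delAt P D e)
    have h1 := part_union_upper hl hα hα1 hb' hP' hD' heD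
      (Finset.filter_subset (fun q => ∀ x ∈ q, x ∉ delAt P D e) (H.link e))
      (fun q hq => (Finset.mem_filter.1 hq).2) (fun q hq hqP => by
        obtain ⟨hq, hqD⟩ := Finset.mem_filter.1 hq
        induction q using Sym2.ind with
        | _ f g =>
          obtain ⟨d', hd', hr⟩ := mem_boundary hP hqP
          have : e = d' := H.unique (rel_rot (mem_link.1 hq)) (rel_rot hr)
          exact he (this ▸ hd'))
    rw [mul_assoc]
    refine mul_le_mul_of_nonneg_left ?_ hl
    refine (part_anti hl (Finset.union_subset_union (Finset.Subset.refl P)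
      (Finset.filter_subset (fun q => ∀ x ∈ q, x ∉ delAt P D e) (H.link e)))
      (Finset.Subset.refl _)).trans (h1.trans ?_)
    refine mul_le_mul (pow_le_pow_of_le_one (by nlinarith) (by nlinarith) ?_)
      (part_anti hl (Finset.Subset.refl P) hDD) (part_nonneg hl _ _) (pow_nonneg (by nlinarith) _)
    rw [hd] at hQ
    omega

end LinearTriples

end LinearHypergraph

lemma tendsto_one_sub_sq_pow {u : ℕ → ℝ} {a : ℝ} (k : ℕ)
    (hu : Tendsto (fun n : ℕ => Real.sqrt n * u n) atTop (nhds a)) :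
    Tendsto (fun n : ℕ => (1 - u n ^ 2) ^ (n - k)) atTop (nhds (Real.exp (-a ^ 2))) := by
  have hsq : Tendsto (fun n : ℕ => (n : ℝ) * (-u n ^ 2)) atTop (nhds (-a ^ 2)) := by
    refine ((hu.pow 2).neg).congr fun n => ?_
    rw [mul_pow, Real.sq_sqrt (Nat.cast_nonneg n)]
    ring
  have h1 := Real.tendsto_one_add_pow_exp_of_tendsto hsq
  have h0 : Tendsto (fun n : ℕ => -u n ^ 2) atTop (nhds 0) := by
    have := hsq.mul (tendsto_inv_atTop_nhds_zero_nat (𝕜 := ℝ))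
    rw [mul_zero] at this
    refine this.congr' ?_
    filter_upwards [eventually_gt_atTop 0] with n hn
    have : (n : ℝ) ≠ 0 := by positivity
    field_simp
  have h2 : Tendsto (fun n : ℕ => (1 + -u n ^ 2) ^ k) atTop (nhds 1) := by
    simpa using ((tendsto_const_nhds (x := (1 : ℝ))).add h0).pow k
  have h3 := h1.div h2 one_ne_zero
  rw [div_one] at h3
  refine h3.congr' ?_
  filter_upwards [eventually_ge_atTop k, h0.eventually (lt_mem_nhds (show (-1 : ℝ) < 0 by norm_num))]
    with n hn hpos
  have : (1 + -u n ^ 2) ^ k ≠ 0 := pow_ne_zero _ (by linarith)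
  simp only [Pi.div_apply]
  rw [div_eq_iff this, ← sub_eq_add_neg, ← pow_add, Nat.sub_add_cancel hn]

lemma tendsto_zero_of_sqrt_mul_s1 {u : ℕ → ℝ} {a : ℝ}
    (hu : Tendsto (fun n : ℕ => Real.sqrt n * u n) atTop (nhds a)) :
    Tendsto u atTop (nhds 0) := by
  have hs : Tendsto (fun n : ℕ => (Real.sqrt n)⁻¹) atTop (nhds 0) :=
    tendsto_inv_atTop_zero.comp (Real.tendsto_sqrt_atTop.comp tendsto_natCast_atTop_atTop)
  have := hs.mul hu
  rw [zero_mul] at this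
  refine this.congr' ?_
  filter_upwards [eventually_gt_atTop 0] with n hn
  have : Real.sqrt n ≠ 0 := by positivity
  field_simp

lemma tendsto_sqrt_mul_div (s : ℝ) :
    Tendsto (fun n : ℕ => Real.sqrt n * (s / Real.sqrt n)) atTop (nhds s) := by
  refine tendsto_const_nhds.congr' ?_
  filter_upwards [eventually_gt_atTop 0] with n hn
  have : Real.sqrt n ≠ 0 := by positivity
  field_simp

lemma abs_exp_neg_sq_sub_le {a x s : ℝ} (ha : 0 ≤ a) (has : a ≤ s) (hx : 0 ≤ x) (hxs : x ≤ s) :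
    |Real.exp (-a ^ 2) - Real.exp (-x ^ 2)| ≤ 2 * s * |a - x| := by
  have key : ∀ u v : ℝ, 0 ≤ u → u ≤ v → v ≤ s →
      |Real.exp (-u ^ 2) - Real.exp (-v ^ 2)| ≤ 2 * s * |u - v| := by
    intro u v hu huv hv
    have h1 : Real.exp (-v ^ 2) ≤ Real.exp (-u ^ 2) := Real.exp_le_exp.2 (by nlinarith)
    have h2 : Real.exp (-v ^ 2) = Real.exp (-u ^ 2) * Real.exp (u ^ 2 - v ^ 2) := by
      rw [← Real.exp_add]; ring_nf
    have h3 := Real.add_one_le_exp (u ^ 2 - v ^ 2)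
    have h4 : Real.exp (-u ^ 2) ≤ 1 := Real.exp_le_one_iff.2 (by nlinarith)
    have h5 := Real.exp_pos (-u ^ 2)
    have h6 : 0 ≤ v ^ 2 - u ^ 2 := by nlinarith
    rw [abs_of_nonneg (by linarith), abs_of_nonpos (by linarith), h2]
    have h7 : Real.exp (-u ^ 2) * (u ^ 2 - v ^ 2 + 1) ≤
        Real.exp (-u ^ 2) * Real.exp (u ^ 2 - v ^ 2) := mul_le_mul_of_nonneg_left h3 h5.le
    have h8 : Real.exp (-u ^ 2) * (v ^ 2 - u ^ 2) ≤ 1 * (v ^ 2 - u ^ 2) :=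
      mul_le_mul_of_nonneg_right h4 h6
    have h9 : v ^ 2 - u ^ 2 ≤ 2 * s * (v - u) := by nlinarith
    linarith
  rcases le_total a x with h | h
  · exact key a x ha h hxs
  · rw [abs_sub_comm, abs_sub_comm a x]
    exact key x a hx h has

section Asymptotics

variable {E : ℕ → Type*} [∀ n, Fintype (E n)] {H : ∀ n, LinearTriples (E n)}

open LinearTriples

/-- Iterating the tree recursion brings the occupation probabilities at fugacity `s / √n`
geometrically close to `x / √n`, where `x` is the fixed point of `x = s * exp (-x ^ 2)`. -/
theorem exists_occBounds (hd : ∀ n e, ((H n).link e).card = n - 2) {x s : ℝ} (hs : 0 < s)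
    (hx : 0 ≤ x) (hxs : x = s * Real.exp (-x ^ 2)) (k : ℕ) :
    ∃ a b : ℝ, 0 ≤ a ∧ a ≤ s ∧ 0 ≤ b ∧ b ≤ s ∧ |a - x| ≤ (2 * s ^ 2) ^ k * s ∧
      |b - x| ≤ (2 * s ^ 2) ^ k * s ∧ ∀ M : ℕ, ∃ α β : ℕ → ℝ,
        Tendsto (fun n : ℕ => Real.sqrt n * α n) atTop (nhds a) ∧
        Tendsto (fun n : ℕ => Real.sqrt n * β n) atTop (nhds b) ∧
        ∀ᶠ n in atTop, 0 ≤ α n ∧ 0 ≤ β n ∧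
          (H n).OccBounds (s / Real.sqrt n) M (α n) (β n) := by
  have hxle : x ≤ s := by
    have : Real.exp (-x ^ 2) ≤ 1 := Real.exp_le_one_iff.2 (by nlinarith)
    nlinarith
  have hl0 : ∀ n : ℕ, 0 ≤ s / Real.sqrt n := fun n => by positivity
  induction k with
  | zero =>
    refine ⟨0, s, le_rfl, hs.le, hs.le, le_rfl, ?_, ?_, fun M => ⟨fun _ => 0,
      fun n => s / Real.sqrt n, by simp, tendsto_sqrt_mul_div s, ?_⟩⟩
    · rw [abs_le]; constructor <;> simp <;> linarith
    · rw [abs_le]; constructor <;> simp <;> linarith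
    · exact Eventually.of_forall fun n => ⟨le_rfl, hl0 n, occBounds_trivial (hl0 n) M⟩
  | succ k ih =>
    obtain ⟨a, b, ha, has, hb, hbs, hax, hbx, hM⟩ := ih
    have hstep : ∀ y, 0 ≤ y → y ≤ s → |y - x| ≤ (2 * s ^ 2) ^ k * s →
        0 ≤ s * Real.exp (-y ^ 2) ∧ s * Real.exp (-y ^ 2) ≤ s ∧
          |s * Real.exp (-y ^ 2) - x| ≤ (2 * s ^ 2) ^ (k + 1) * s := by
      intro y hy hys hyx
      have : Real.exp (-y ^ 2) ≤ 1 := Real.exp_le_one_iff.2 (by nlinarith)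
      refine ⟨by positivity, by nlinarith, ?_⟩
      nth_rewrite 1 [hxs]
      rw [← mul_sub, abs_mul, abs_of_pos hs]
      have h1 := abs_exp_neg_sq_sub_le hy hys hx hxle
      have h2 := mul_le_mul_of_nonneg_left h1 hs.le
      have h3 := mul_le_mul_of_nonneg_left hyx (show 0 ≤ 2 * s ^ 2 by positivity)
      calc s * |Real.exp (-y ^ 2) - Real.exp (-x ^ 2)| ≤ s * (2 * s * |y - x|) := h2
        _ = 2 * s ^ 2 * |y - x| := by ring
        _ ≤ 2 * s ^ 2 * ((2 * s ^ 2) ^ k * s) := h3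
        _ = _ := by ring
    obtain ⟨h1, h2, h3⟩ := hstep a ha has hax
    obtain ⟨h4, h5, h6⟩ := hstep b hb hbs hbx
    refine ⟨_, _, h4, h5, h1, h2, h6, h3, fun M => ?_⟩
    obtain ⟨α, β, hα, hβ, hocc⟩ := hM (4 * M + 3)
    have hlam := tendsto_sqrt_mul_div s
    have hlam0 := tendsto_zero_of_sqrt_mul_s1 hlam
    have hα0 := tendsto_zero_of_sqrt_mul_s1 hα
    have hβ0 := tendsto_zero_of_sqrt_mul_s1 hβ
    refine ⟨fun n => s / Real.sqrt n * (1 - β n ^ 2) ^ (n - 2) / (1 + s / Real.sqrt n) ^ (M + 1),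
      fun n => s / Real.sqrt n * (1 - α n ^ 2) ^ (n - 2 - (2 * M + 1)), ?_, ?_, ?_⟩
    · have hden : Tendsto (fun n : ℕ => (1 + s / Real.sqrt n) ^ (M + 1)) atTop (nhds 1) := by
        simpa using ((tendsto_const_nhds (x := (1 : ℝ))).add hlam0).pow (M + 1)
      have := (hlam.mul (tendsto_one_sub_sq_pow 2 hβ)).div hden one_ne_zero
      rw [div_one] at this
      refine this.congr fun n => ?_
      simp only [Pi.div_apply]
      ring
    · refine (hlam.mul (tendsto_one_sub_sq_pow (2 + (2 * M + 1)) hα)).congr fun n => ?_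
      dsimp only
      rw [Nat.sub_sub]
      ring
    · filter_upwards [hocc, hα0.eventually (gt_mem_nhds one_pos),
        hβ0.eventually (gt_mem_nhds one_pos)] with n hn hα1 hβ1
      obtain ⟨hαn, hβn, hn⟩ := hn
      have hln := hl0 n
      refine ⟨?_, ?_, occBounds_step hln hαn hα1.le hβn hβ1.le (hd n) hn⟩
      · have : 0 ≤ 1 - β n ^ 2 := by nlinarith
        positivity
      · have : 0 ≤ 1 - α n ^ 2 := by nlinarith
        positivity

theorem eventually_occupation (hd : ∀ n e, ((H n).link e).card = n - 2) {x s : ℝ} (hs : 0 < s)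
    (hs1 : 2 * s ^ 2 < 1) (hx : 0 ≤ x) (hxs : x = s * Real.exp (-x ^ 2)) {ε : ℝ} (hε : 0 < ε) :
    ∀ᶠ n : ℕ in atTop, ∀ e : E n,
      |Real.sqrt n * ((H n).partMem (s / Real.sqrt n) ∅ ∅ e / (H n).part (s / Real.sqrt n) ∅ ∅) - x|
        ≤ ε := by
  have hgeo : Tendsto (fun k : ℕ => (2 * s ^ 2) ^ k * s) atTop (nhds 0) := by
    simpa using (tendsto_pow_atTop_nhds_zero_of_lt_one (by positivity) hs1).mul_const s
  obtain ⟨k, hk⟩ := (hgeo.eventually (gt_mem_nhds (half_pos hε))).exists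
  obtain ⟨a, b, -, -, -, -, hax, hbx, hM⟩ := exists_occBounds hd hs hx hxs k
  obtain ⟨α, β, hα, hβ, hocc⟩ := hM 0
  filter_upwards [hocc, hα.eventually (lt_mem_nhds (show a - ε / 2 < a by linarith)),
    hβ.eventually (gt_mem_nhds (show b < b + ε / 2 by linarith))] with n hn hαn hβn e
  obtain ⟨-, -, hn⟩ := hn
  obtain ⟨h1, h2⟩ := hn ∅ ∅ (by simp) (by simp) e (by simp)
  have hpos := part_pos (H := H n) (show 0 ≤ s / Real.sqrt n by positivity) ∅ ∅
  rw [← le_div_iff₀ hpos] at h1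
  rw [← div_le_iff₀ hpos] at h2
  have h3 := mul_le_mul_of_nonneg_left h1 (Real.sqrt_nonneg n)
  have h4 := mul_le_mul_of_nonneg_left h2 (Real.sqrt_nonneg n)
  have h5 := abs_le.1 hax
  have h6 := abs_le.1 hbx
  rw [abs_le]
  constructor <;> linarith

end Asymptotics

/-- The derivative of the partition function in the fugacity. -/
def LinearTriples.dpart {V : Type*} [Fintype V] (K : LinearTriples V) (lam : ℝ) : ℝ :=
  ∑ S : Finset V, if K.Valid ∅ ∅ S then S.card * lam ^ (S.card - 1) else 0

section Derivative

variable {V : Type*} [Fintype V] {K : LinearTriples V}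

lemma hasDerivAt_part (lam : ℝ) :
    HasDerivAt (fun l => K.part l ∅ ∅) (K.dpart lam) lam := by
  unfold LinearTriples.part weightSum LinearTriples.dpart
  refine HasDerivAt.fun_sum fun S _ => ?_
  by_cases h : K.Valid ∅ ∅ S
  · simpa [h] using hasDerivAt_pow S.card lam
  · simpa [h] using hasDerivAt_const lam (0 : ℝ)

lemma continuous_part : Continuous fun l => K.part l ∅ ∅ :=
  continuous_iff_continuousAt.2 fun l => (hasDerivAt_part l).continuousAt

lemma continuous_dpart : Continuous K.dpart := by
  unfold LinearTriples.dpart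
  refine continuous_finsetSum _ fun S _ => ?_
  split_ifs <;> fun_prop

lemma mul_dpart (lam : ℝ) : lam * K.dpart lam = ∑ e, K.partMem lam ∅ ∅ e := by
  unfold LinearTriples.dpart LinearTriples.partMem weightSum
  rw [Finset.mul_sum, Finset.sum_comm]
  refine Finset.sum_congr rfl fun S _ => ?_
  by_cases h : K.Valid ∅ ∅ S
  · simp only [h, true_and, if_true]
    rw [← Finset.sum_filter, Finset.sum_const, nsmul_eq_mul, Finset.filter_mem_eq_inter,
      Finset.univ_inter]
    rcases Nat.eq_zero_or_pos S.card with h0 | h0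
    · simp [h0]
    · rw [mul_left_comm, ← pow_succ', Nat.sub_add_cancel h0]
  · simp [h]

lemma part_zero : K.part 0 ∅ ∅ = 1 := by
  unfold LinearTriples.part weightSum
  rw [Finset.sum_eq_single ∅]
  · simp [LinearTriples.Valid]
  · intro S _ hS
    simp [hS]
  · simp

lemma dpart_nonneg {lam : ℝ} (hl : 0 ≤ lam) : 0 ≤ K.dpart lam :=
  Finset.sum_nonneg fun S _ => by split_ifs <;> positivity

lemma dpart_div_part_le {lam : ℝ} (hl : 0 < lam) :
    K.dpart lam / K.part lam ∅ ∅ ≤ Fintype.card V := by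
  rw [div_le_iff₀ (LinearTriples.part_pos hl.le _ _)]
  refine le_of_mul_le_mul_left ?_ hl
  rw [mul_dpart]
  calc ∑ e, K.partMem lam ∅ ∅ e ≤ ∑ _e : V, lam * K.part lam ∅ ∅ :=
        Finset.sum_le_sum fun e _ =>
          (LinearTriples.occBounds_trivial hl.le 0 ∅ ∅ (by simp) (by simp) e (by simp)).2
    _ = _ := by simp only [Finset.sum_const, Finset.card_univ, nsmul_eq_mul]; ring

end Derivative

section LogPartition

variable {E : ℕ → Type*} [∀ n, Fintype (E n)] {H : ∀ n, LinearTriples (E n)}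

open LinearTriples

lemma choose_two_div_sq_le (n : ℕ) : ((n.choose 2 : ℕ) : ℝ) / (n : ℝ) ^ 2 ≤ 1 / 2 := by
  rw [Nat.cast_choose_two]
  have hn : (0 : ℝ) ≤ n := Nat.cast_nonneg n
  refine div_le_of_le_mul₀ (by positivity) (by norm_num) ?_
  nlinarith

lemma tendsto_choose_two_div_sq :
    Tendsto (fun n : ℕ => ((n.choose 2 : ℕ) : ℝ) / (n : ℝ) ^ 2) atTop (nhds (1 / 2)) := by
  have h : Tendsto (fun n : ℕ => (1 - ((n : ℝ))⁻¹) / 2) atTop (nhds ((1 - 0) / 2)) :=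
    (tendsto_const_nhds.sub tendsto_inv_atTop_nhds_zero_nat).div_const 2
  rw [sub_zero] at h
  refine h.congr' ?_
  filter_upwards [eventually_gt_atTop 0] with n hn
  have : (n : ℝ) ≠ 0 := by positivity
  rw [Nat.cast_choose_two]
  field_simp

variable (H) in
/-- The scaled logarithmic derivative of the partition function at fugacity `t / √n`. -/
def logPartSlope (n : ℕ) (t : ℝ) : ℝ :=
  (H n).dpart (t / Real.sqrt n) / (H n).part (t / Real.sqrt n) ∅ ∅ / (n : ℝ) ^ 2

variable (H) in
/-- The scaled logarithm of the partition function at fugacity `t / √n`. -/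
def logPart (n : ℕ) (t : ℝ) : ℝ :=
  Real.log ((H n).part (t / Real.sqrt n) ∅ ∅) / (n * Real.sqrt n)

lemma hasDerivAt_logPart {n : ℕ} (hn : 0 < n) {t : ℝ} (ht : 0 ≤ t) :
    HasDerivAt (logPart H n) (logPartSlope H n t) t := by
  have hs : 0 < Real.sqrt n := by positivity
  have h1 : HasDerivAt (fun t : ℝ => t / Real.sqrt n) (1 / Real.sqrt n) t :=
    (hasDerivAt_id t).div_const _
  have hpos := part_pos (H := H n) (show 0 ≤ t / Real.sqrt n by positivity) ∅ ∅
  have h2 := (((hasDerivAt_part (K := H n) (t / Real.sqrt n)).comp t h1).log (by exact hpos.ne')).div_const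
    (n * Real.sqrt n)
  refine h2.congr_deriv ?_
  have hsq : Real.sqrt n ^ 2 = n := Real.sq_sqrt (Nat.cast_nonneg n)
  have hn' : (n : ℝ) ≠ 0 := by positivity
  simp only [logPartSlope, Function.comp_apply]
  rw [div_div, div_div, mul_one_div, div_div]
  congr 1
  linear_combination ((n : ℝ) * (H n).part (t / Real.sqrt n) ∅ ∅) * hsq

lemma logPartSlope_nonneg {n : ℕ} {t : ℝ} (ht : 0 ≤ t) : 0 ≤ logPartSlope H n t :=
  div_nonneg (div_nonneg (dpart_nonneg (by positivity)) (part_nonneg (by positivity) _ _))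
    (by positivity)

lemma logPartSlope_le (hE : ∀ n, Fintype.card (E n) = n.choose 2) {n : ℕ} (hn : 0 < n) {t : ℝ}
    (ht : 0 < t) : logPartSlope H n t ≤ 1 / 2 := by
  refine le_trans (div_le_div_of_nonneg_right (dpart_div_part_le (by positivity))
    (by positivity)) ?_
  rw [hE]
  exact choose_two_div_sq_le n

lemma continuousOn_logPartSlope (n : ℕ) : ContinuousOn (logPartSlope H n) (Set.Ici 0) := by
  have h1 : Continuous fun t : ℝ => t / Real.sqrt n := by fun_prop
  refine ContinuousOn.div_const (ContinuousOn.div (continuous_dpart.comp h1).continuousOn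
    (continuous_part.comp h1).continuousOn fun t ht => ?_) _
  exact (part_pos (H := H n) (div_nonneg ht (Real.sqrt_nonneg n)) ∅ ∅).ne'

lemma tendsto_logPartSlope (hd : ∀ n e, ((H n).link e).card = n - 2)
    (hE : ∀ n, Fintype.card (E n) = n.choose 2) {x s : ℝ} (hs : 0 < s)
    (hs1 : 2 * s ^ 2 < 1) (hx : 0 ≤ x) (hxs : x = s * Real.exp (-x ^ 2)) :
    Tendsto (fun n => logPartSlope H n s) atTop (nhds (1 / 2 * Real.exp (-x ^ 2))) := by
  have hxs' : x / s = Real.exp (-x ^ 2) := by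
    rw [div_eq_iff hs.ne', mul_comm]; exact hxs
  have h0 : Tendsto (fun n : ℕ => ((n.choose 2 : ℕ) : ℝ) / (n : ℝ) ^ 2 * (x / s)) atTop
      (nhds (1 / 2 * Real.exp (-x ^ 2))) := by
    rw [← hxs']
    exact tendsto_choose_two_div_sq.mul_const _
  refine tendsto_of_tendsto_of_dist h0 ?_
  rw [Metric.tendsto_nhds]
  intro ε hε
  filter_upwards [eventually_occupation (H := H) hd hs hs1 hx hxs (mul_pos hs hε),
    eventually_gt_atTop 0] with n hn hn0
  have hsq : 0 < Real.sqrt n := by positivity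
  have hpos := part_pos (H := H n) (show 0 ≤ s / Real.sqrt n by positivity) ∅ ∅
  have hn2 : (0 : ℝ) < (n : ℝ) ^ 2 := by positivity
  set Z := (H n).part (s / Real.sqrt n) ∅ ∅ with hZ
  have hsl : logPartSlope H n s = (∑ e, Real.sqrt n * ((H n).partMem (s / Real.sqrt n) ∅ ∅ e / Z)) / s /
      (n : ℝ) ^ 2 := by
    rw [← Finset.mul_sum, ← Finset.sum_div, ← mul_dpart, logPartSlope, ← hZ]
    field_simp
  have hmain : |(n.choose 2 : ℝ) * x -
      ∑ e, Real.sqrt n * ((H n).partMem (s / Real.sqrt n) ∅ ∅ e / Z)| ≤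
      (n.choose 2 : ℝ) * (s * ε) := by
    have : (n.choose 2 : ℝ) * x = ∑ _e : E n, x := by simp [hE]
    rw [this, ← Finset.sum_sub_distrib]
    refine (Finset.abs_sum_le_sum_abs _ _).trans ((Finset.sum_le_sum fun e _ => ?_).trans_eq
      (?_ : ∑ _e : E n, s * ε = _))
    · rw [abs_sub_comm]; exact hn e
    · simp [hE]
  rw [Real.dist_eq, sub_zero, abs_of_nonneg dist_nonneg, Real.dist_eq, hsl]
  have heq : (n.choose 2 : ℝ) / (n : ℝ) ^ 2 * (x / s) -
      (∑ e, Real.sqrt n * ((H n).partMem (s / Real.sqrt n) ∅ ∅ e / Z)) / s / (n : ℝ) ^ 2 =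
      ((n.choose 2 : ℝ) * x -
        ∑ e, Real.sqrt n * ((H n).partMem (s / Real.sqrt n) ∅ ∅ e / Z)) / (s * (n : ℝ) ^ 2) := by
    field_simp
  rw [heq, abs_div, abs_of_pos (mul_pos hs hn2), div_lt_iff₀ (mul_pos hs hn2)]
  have h2 := choose_two_div_sq_le n
  rw [div_le_iff₀ hn2] at h2
  have h3 := mul_le_mul_of_nonneg_right h2 (mul_pos hs hε).le
  have h4 : 0 < s * ε * (n : ℝ) ^ 2 := by positivity
  linarith

lemma logPart_zero (n : ℕ) : logPart H n 0 = 0 := by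
  simp [logPart, part_zero]

/-- Integrating the logarithmic derivative along the curve `y ↦ y * exp (y ^ 2)`. -/
theorem tendsto_logPart (hd : ∀ n e, ((H n).link e).card = n - 2)
    (hE : ∀ n, Fintype.card (E n) = n.choose 2) {X c : ℝ} (hX : 0 ≤ X) (hc : 2 * c ^ 2 < 1)
    (hXc : X * Real.exp (X ^ 2) = c) :
    Tendsto (fun n => logPart H n c) atTop (nhds (1 / 2 * (X + 2 * X ^ 3 / 3))) := by
  have hψ : ∀ y : ℝ, HasDerivAt (fun y => y * Real.exp (y ^ 2))
      ((1 + 2 * y ^ 2) * Real.exp (y ^ 2)) y := by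
    intro y
    have h1 := (hasDerivAt_id y).mul ((hasDerivAt_pow 2 y).exp)
    refine h1.congr_deriv ?_
    simp
    ring
  have hψ0 : ∀ y : ℝ, 0 ≤ y → 0 ≤ y * Real.exp (y ^ 2) := fun y hy => by positivity
  have hψc : ∀ y : ℝ, 0 ≤ y → y ≤ X → y * Real.exp (y ^ 2) ≤ c := fun y hy hyX => by
    rw [← hXc]
    gcongr
  have hcont : ∀ n, ContinuousOn (fun y => logPartSlope H n (y * Real.exp (y ^ 2)) *
      ((1 + 2 * y ^ 2) * Real.exp (y ^ 2))) (Set.uIcc 0 X) := by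
    intro n
    refine ContinuousOn.mul ((continuousOn_logPartSlope n).comp (by fun_prop) fun y hy => ?_) (by fun_prop)
    rw [Set.uIcc_of_le hX] at hy
    exact hψ0 y hy.1
  have hftc : ∀ n : ℕ, 0 < n → ∫ y in (0 : ℝ)..X, logPartSlope H n (y * Real.exp (y ^ 2)) *
      ((1 + 2 * y ^ 2) * Real.exp (y ^ 2)) = logPart H n c := by
    intro n hn
    rw [intervalIntegral.integral_eq_sub_of_hasDerivAt
      (f := fun y => logPart H n (y * Real.exp (y ^ 2))) ?_ (hcont n).intervalIntegrable]
    · simp [hXc, logPart_zero (H := H)]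
    · intro y hy
      rw [Set.uIcc_of_le hX] at hy
      exact (hasDerivAt_logPart (H := H) hn (hψ0 y hy.1)).comp y (hψ y)
  have hval : ∫ y in (0 : ℝ)..X, (1 / 2 * (1 + 2 * y ^ 2)) = 1 / 2 * (X + 2 * X ^ 3 / 3) := by
    rw [intervalIntegral.integral_eq_sub_of_hasDerivAt
      (f := fun y => 1 / 2 * (y + 2 * y ^ 3 / 3)) ?_ (Continuous.intervalIntegrable (by fun_prop) _ _)]
    · simp
    · intro y _
      have h1 := (((hasDerivAt_id y).add (((hasDerivAt_pow 3 y).const_mul 2).div_const 3))).const_mul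
        (1 / 2)
      refine h1.congr_deriv ?_
      norm_num
      ring
  rw [← hval]
  have hlim : Tendsto (fun n => ∫ y in (0 : ℝ)..X, logPartSlope H n (y * Real.exp (y ^ 2)) *
      ((1 + 2 * y ^ 2) * Real.exp (y ^ 2))) atTop
      (nhds (∫ y in (0 : ℝ)..X, (1 / 2 * (1 + 2 * y ^ 2)))) := by
    refine intervalIntegral.tendsto_integral_filter_of_dominated_convergence
      (fun y => 1 / 2 * ((1 + 2 * y ^ 2) * Real.exp (y ^ 2))) ?_ ?_ ?_ ?_
    · refine Eventually.of_forall fun n => ?_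
      exact (hcont n).intervalIntegrable.aestronglyMeasurable_restrict_uIoc
    · filter_upwards [eventually_gt_atTop 0] with n hn
      refine MeasureTheory.ae_of_all _ fun y hy => ?_
      rw [Set.uIoc_of_le hX] at hy
      have hy0 : 0 < y * Real.exp (y ^ 2) := mul_pos hy.1 (Real.exp_pos _)
      have hp : 0 ≤ (1 + 2 * y ^ 2) * Real.exp (y ^ 2) := by positivity
      rw [Real.norm_eq_abs, abs_of_nonneg (mul_nonneg (logPartSlope_nonneg hy0.le) hp)]
      exact mul_le_mul_of_nonneg_right (logPartSlope_le hE hn hy0) hp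
    · exact Continuous.intervalIntegrable (by fun_prop) _ _
    · refine MeasureTheory.ae_of_all _ fun y hy => ?_
      rw [Set.uIoc_of_le hX] at hy
      have hy0 : 0 < y * Real.exp (y ^ 2) := mul_pos hy.1 (Real.exp_pos _)
      have hyc := hψc y hy.1.le hy.2
      have h1 := tendsto_logPartSlope (H := H) hd hE hy0 (by nlinarith) hy.1.le (x := y) (by
        rw [mul_assoc, ← Real.exp_add]; simp)
      have h2 := h1.mul_const ((1 + 2 * y ^ 2) * Real.exp (y ^ 2))
      have h3 : 1 / 2 * Real.exp (-y ^ 2) * ((1 + 2 * y ^ 2) * Real.exp (y ^ 2)) =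
          1 / 2 * (1 + 2 * y ^ 2) := by
        rw [show 1 / 2 * Real.exp (-y ^ 2) * ((1 + 2 * y ^ 2) * Real.exp (y ^ 2)) =
          1 / 2 * (1 + 2 * y ^ 2) * (Real.exp (-y ^ 2) * Real.exp (y ^ 2)) by ring, ← Real.exp_add]
        simp
      rwa [h3] at h2
  refine hlim.congr' ?_
  filter_upwards [eventually_gt_atTop 0] with n hn
  exact hftc n hn

lemma abs_logPart_sub_le (hE : ∀ n, Fintype.card (E n) = n.choose 2) {n : ℕ} (hn : 0 < n)
    {t u : ℝ} (ht : 0 < t) (hu : 0 < u) : |logPart H n t - logPart H n u| ≤ 1 / 2 * |t - u| := by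
  refine (convex_Ioi (0 : ℝ)).norm_image_sub_le_of_norm_hasDerivWithin_le (f' := logPartSlope H n)
    (fun y hy => (hasDerivAt_logPart hn (le_of_lt hy)).hasDerivWithinAt) (fun y hy => ?_) hu ht
  rw [Real.norm_eq_abs, abs_of_nonneg (logPartSlope_nonneg (le_of_lt hy))]
  exact logPartSlope_le hE hn hy

theorem tendsto_logPart_of_tendsto (hd : ∀ n e, ((H n).link e).card = n - 2)
    (hE : ∀ n, Fintype.card (E n) = n.choose 2) {X c : ℝ} (hX : 0 < X) (hc : 2 * c ^ 2 < 1)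
    (hXc : X * Real.exp (X ^ 2) = c) {t : ℕ → ℝ} (ht : ∀ᶠ n in atTop, 0 < t n)
    (htc : Tendsto t atTop (nhds c)) :
    Tendsto (fun n => logPart H n (t n)) atTop (nhds (1 / 2 * (X + 2 * X ^ 3 / 3))) := by
  have hc0 : 0 < c := by rw [← hXc]; positivity
  refine tendsto_of_tendsto_of_dist (tendsto_logPart (H := H) hd hE hX.le hc hXc) ?_
  have h1 : Tendsto (fun n => 1 / 2 * |c - t n|) atTop (nhds (1 / 2 * |c - c|)) :=
    ((tendsto_const_nhds.sub htc).abs).const_mul _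
  rw [sub_self, abs_zero, mul_zero] at h1
  refine squeeze_zero' (Eventually.of_forall fun n => dist_nonneg) ?_ h1
  filter_upwards [ht, eventually_gt_atTop 0] with n htn hn
  exact abs_logPart_sub_le hE hn hc0 htn

end LogPartition

/-- The possible edges of a graph on `Fin n`. -/
abbrev EdgeSlot (n : ℕ) : Type := {e : Sym2 (Fin n) // ¬ e.IsDiag}

section Triangles

/-- The hypergraph whose triples are the edge sets of triangles in the complete graph. -/
def triangleTriples (n : ℕ) : LinearTriples (EdgeSlot n) where
  rel e f g := ∃ a b c : Fin n, a ≠ b ∧ b ≠ c ∧ a ≠ c ∧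
    e.1 = s(a, b) ∧ f.1 = s(b, c) ∧ g.1 = s(a, c)
  swap_left := by
    rintro e f g ⟨a, b, c, hab, hbc, hac, he, hf, hg⟩
    exact ⟨c, b, a, hbc.symm, hab.symm, hac.symm, hf.trans Sym2.eq_swap, he.trans Sym2.eq_swap,
      hg.trans Sym2.eq_swap⟩
  swap_right := by
    rintro e f g ⟨a, b, c, hab, hbc, hac, he, hf, hg⟩
    exact ⟨b, a, c, hab.symm, hac, hbc, he.trans Sym2.eq_swap, hg, hf⟩
  ne := by
    rintro e f g ⟨a, b, c, hab, hbc, hac, he, hf, hg⟩ rfl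
    rw [he, Sym2.eq_iff] at hf
    tauto
  unique := by
    rintro e f g g' ⟨a, b, c, hab, hbc, hac, he, hf, hg⟩ ⟨a', b', c', hab', hbc', hac', he', hf', hg'⟩
    apply Subtype.ext
    rw [hg, hg']
    rw [he, Sym2.eq_iff] at he'
    rw [hf, Sym2.eq_iff] at hf'
    rw [Sym2.eq_iff]
    grind

lemma card_edgeSlot (n : ℕ) : Fintype.card (EdgeSlot n) = n.choose 2 := by
  rw [Sym2.card_subtype_not_diag, Fintype.card_fin]

lemma card_link_triangleTriples (n : ℕ) (e : EdgeSlot n) :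
    ((triangleTriples n).link e).card = n - 2 := by
  obtain ⟨e, he⟩ := e
  induction e using Sym2.ind with
  | _ u v =>
    have huv : u ≠ v := he
    have hcard : (Finset.univ.filter fun w : Fin n => w ≠ u ∧ w ≠ v).card = n - 2 := by
      have : (Finset.univ.filter fun w : Fin n => w ≠ u ∧ w ≠ v) = Finset.univ \ {u, v} := by
        ext w; simp
      rw [this, Finset.card_sdiff_of_subset (Finset.subset_univ _), Finset.card_pair huv]
      simp
    rw [← hcard]
    symm
    refine Finset.card_bij
      (fun w hw => s((⟨s(v, w), fun h => (Finset.mem_filter.1 hw).2.2 (Eq.symm h)⟩ : EdgeSlot n),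
        ⟨s(u, w), fun h => (Finset.mem_filter.1 hw).2.1 (Eq.symm h)⟩)) ?_ ?_ ?_
    · intro w hw
      have hw' := (Finset.mem_filter.1 hw).2
      exact LinearTriples.mem_link.2 ⟨u, v, w, huv, hw'.2.symm, hw'.1.symm, rfl, rfl, rfl⟩
    · intro w hw w' hw' h
      have h1 := (Finset.mem_filter.1 hw).2
      have h2 := (Finset.mem_filter.1 hw').2
      simp only [Sym2.eq_iff, Subtype.mk.injEq] at h
      grind
    · intro q hq
      induction q using Sym2.ind with
      | _ f g =>
        obtain ⟨a, b, c, hab, hbc, hac, he, hf, hg⟩ := LinearTriples.mem_link.1 hq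
        rcases Sym2.eq_iff.1 he with ⟨rfl, rfl⟩ | ⟨rfl, rfl⟩
        · refine ⟨c, by simp [hac.symm, hbc.symm], ?_⟩
          exact congrArg₂ (fun x y => s(x, y)) (Subtype.ext hf.symm) (Subtype.ext hg.symm)
        · refine ⟨c, by simp [hac.symm, hbc.symm], ?_⟩
          rw [Sym2.eq_swap]
          exact congrArg₂ (fun x y => s(x, y)) (Subtype.ext hf.symm) (Subtype.ext hg.symm)

/-- The edges of a graph as a set of slots. -/
def edgeSlots {n : ℕ} (G : SimpleGraph (Fin n)) : Finset (EdgeSlot n) :=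
  Finset.univ.filter fun e => e.1 ∈ G.edgeSet

lemma mem_edgeSlots {n : ℕ} {G : SimpleGraph (Fin n)} {e : EdgeSlot n} :
    e ∈ edgeSlots G ↔ e.1 ∈ G.edgeSet := by simp [edgeSlots]

lemma edgeSlots_bijective (n : ℕ) : Function.Bijective (edgeSlots (n := n)) := by
  constructor
  · intro G G' h
    refine SimpleGraph.edgeSet_injective (Set.ext fun e => ?_)
    by_cases he : e.IsDiag
    · exact ⟨fun h' => absurd he (G.not_isDiag_of_mem_edgeSet h'),
        fun h' => absurd he (G'.not_isDiag_of_mem_edgeSet h')⟩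
    · have := Finset.ext_iff.1 h ⟨e, he⟩
      simpa [mem_edgeSlots] using this
  · intro S
    refine ⟨SimpleGraph.fromEdgeSet (Subtype.val '' (S : Set (EdgeSlot n))), ?_⟩
    ext e
    rw [mem_edgeSlots, SimpleGraph.edgeSet_fromEdgeSet]
    constructor
    · rintro ⟨⟨e', he', h⟩, -⟩
      rwa [← Subtype.ext h]
    · exact fun h => ⟨⟨e, h, rfl⟩, e.2⟩

lemma card_edgeSlots {n : ℕ} (G : SimpleGraph (Fin n)) : (edgeSlots G).card = edgeCount G := by
  unfold edgeCount
  rw [← Nat.card_eq_finsetCard]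
  refine Nat.card_congr ⟨fun e => ⟨e.1.1, mem_edgeSlots.1 e.2⟩,
    fun e => ⟨⟨e.1, G.not_isDiag_of_mem_edgeSet e.2⟩, mem_edgeSlots.2 e.2⟩, fun _ => rfl,
    fun _ => rfl⟩

lemma triCount_eq_zero_iff {n : ℕ} (G : SimpleGraph (Fin n)) :
    triCount G = 0 ↔ (triangleTriples n).Valid ∅ ∅ (edgeSlots G) := by
  unfold triCount
  rw [Finite.card_eq_zero_iff, isEmpty_subtype]
  constructor
  · refine fun h => ⟨by simp, by simp, ?_⟩
    rintro e he f hf g hg ⟨a, b, c, hab, hbc, hac, h1, h2, h3⟩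
    rw [mem_edgeSlots, h1, SimpleGraph.mem_edgeSet] at he
    rw [mem_edgeSlots, h2, SimpleGraph.mem_edgeSet] at hf
    rw [mem_edgeSlots, h3, SimpleGraph.mem_edgeSet] at hg
    exact h {a, b, c} (SimpleGraph.is3Clique_triple_iff.2 ⟨he, hg, hf⟩)
  · rintro ⟨-, -, h⟩ s hs
    obtain ⟨a, b, c, hab, hac, hbc, -⟩ := SimpleGraph.is3Clique_iff.1 hs
    exact h ⟨s(a, b), hab.ne⟩ (mem_edgeSlots.2 hab) ⟨s(b, c), hbc.ne⟩ (mem_edgeSlots.2 hbc)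
      ⟨s(a, c), hac.ne⟩ (mem_edgeSlots.2 hac) ⟨a, b, c, hab.ne, hbc.ne, hac.ne, rfl, rfl, rfl⟩

lemma erProb_triangle_free (n : ℕ) {p : ℝ} (hp : p < 1) :
    erProb n p {G | triCount G = 0} =
      (1 - p) ^ n.choose 2 * (triangleTriples n).part (p / (1 - p)) ∅ ∅ := by
  unfold erProb LinearTriples.part weightSum
  rw [Finset.mul_sum, ← (Equiv.ofBijective _ (edgeSlots_bijective n)).sum_comp]
  refine Finset.sum_congr rfl fun G _ => ?_
  rw [Equiv.ofBijective_apply, card_edgeSlots]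
  have hle : edgeCount G ≤ n.choose 2 := by
    rw [← card_edgeSlots, ← card_edgeSlot]; exact Finset.card_le_univ _
  have h1 : 1 - p ≠ 0 := by linarith
  by_cases h : triCount G = 0
  · rw [if_pos (show G ∈ {G | triCount G = 0} from h), if_pos ((triCount_eq_zero_iff G).1 h), div_pow, mul_div_assoc']
    rw [eq_div_iff (pow_ne_zero _ h1), mul_assoc, ← pow_add, Nat.sub_add_cancel hle, mul_comm]
  · rw [if_neg (show ¬ G ∈ {G | triCount G = 0} from h),
      if_neg (mt (triCount_eq_zero_iff G).2 h), mul_zero]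

end Triangles

lemma tendsto_sqrt_mul_log {p : ℕ → ℝ} {c : ℝ} (hp : ∀ n, p n ∈ Set.Ioo (0 : ℝ) 1)
    (hpc : Tendsto (fun n : ℕ => Real.sqrt n * p n) atTop (nhds c)) :
    Tendsto (fun n : ℕ => Real.sqrt n * Real.log (1 - p n)) atTop (nhds (-c)) := by
  have hp0 := tendsto_zero_of_sqrt_mul_s1 hpc
  have hlow : Tendsto (fun n : ℕ => Real.sqrt n * p n * (-(1 - p n)⁻¹)) atTop (nhds (-c)) := by
    have := hpc.mul ((tendsto_const_nhds (x := (1 : ℝ))).sub hp0 |>.inv₀ (by norm_num) |>.neg)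
    simpa using this
  have hup : Tendsto (fun n : ℕ => -(Real.sqrt n * p n)) atTop (nhds (-c)) := hpc.neg
  refine tendsto_of_tendsto_of_tendsto_of_le_of_le hlow hup (fun n => ?_) (fun n => ?_)
  · have h1 : 0 < 1 - p n := by linarith [(hp n).2]
    have h2 := Real.one_sub_inv_le_log_of_pos h1
    have h3 : 1 - (1 - p n)⁻¹ = p n * (-(1 - p n)⁻¹) := by field_simp; ring
    rw [h3] at h2
    dsimp only
    rw [mul_assoc]
    exact mul_le_mul_of_nonneg_left h2 (Real.sqrt_nonneg _)
  · have h1 : 0 < 1 - p n := by linarith [(hp n).2]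
    have h2 := Real.log_le_sub_one_of_pos h1
    have h3 := mul_le_mul_of_nonneg_left h2 (Real.sqrt_nonneg n)
    dsimp only
    linarith

lemma rpow_three_halves {x : ℝ} (hx : 0 ≤ x) : x ^ ((3 : ℝ) / 2) = x * Real.sqrt x := by
  rcases hx.eq_or_lt with rfl | h
  · simp
  · rw [show (3 : ℝ) / 2 = 1 + 1 / 2 by norm_num, Real.rpow_add h, Real.rpow_one,
      ← Real.sqrt_eq_rpow]

/-- **Corollary (asymptotics of the probability of triangle-freeness for `c < e^{-1/2}`).** -/
theorem triangle_free_log_asymptotics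
    (W : ℝ → ℝ) (hW : IsLambertW W)
    (c : ℝ) (hc : 0 < c) (hc' : c < Real.exp (-(1 : ℝ) / 2))
    (p : ℕ → ℝ) (hp : ∀ n, p n ∈ Set.Ioo (0 : ℝ) 1)
    (hpc : Tendsto (fun n : ℕ => Real.sqrt n * p n) atTop (nhds c)) :
    Tendsto (fun n : ℕ =>
        Real.log (erProb n (p n) {G | triCount G = 0}) / (n : ℝ) ^ ((3 : ℝ) / 2))
      atTop
      (nhds ((1 / 2) *
        ((W (2 * c ^ 2) ^ ((3 : ℝ) / 2) + 3 * W (2 * c ^ 2) ^ ((1 : ℝ) / 2)) /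
            (3 * Real.sqrt 2) - c))) := by
  obtain ⟨hW0, hWeq, -⟩ := hW (2 * c ^ 2) (by positivity)
  set w := W (2 * c ^ 2) with hw
  have hc2 : 2 * c ^ 2 < 1 := by
    have h1 : c ^ 2 < Real.exp (-1) := by
      have := pow_lt_pow_left₀ hc' hc.le two_ne_zero
      rw [← Real.exp_nat_mul] at this
      norm_num at this ⊢
      exact this
    have h2 : (2 : ℝ) < Real.exp 1 := by linarith [Real.exp_one_gt_d9]
    have h3 : Real.exp (-1) * Real.exp 1 = 1 := by rw [← Real.exp_add]; simp
    nlinarith [Real.exp_pos (-1)]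
  have hwpos : 0 < w := by
    refine hW0.lt_of_ne fun h => ?_
    rw [← h, zero_mul] at hWeq
    have : 0 < 2 * c ^ 2 := by positivity
    linarith
  set X := Real.sqrt (w / 2) with hX
  have hXpos : 0 < X := Real.sqrt_pos.2 (by linarith)
  have hXsq : X ^ 2 = w / 2 := Real.sq_sqrt (by linarith)
  have hXc : X * Real.exp (X ^ 2) = c := by
    refine (pow_left_inj₀ (by positivity) hc.le two_ne_zero).1 ?_
    rw [mul_pow, ← Real.exp_nat_mul, hXsq]
    have : ((2 : ℕ) : ℝ) * (w / 2) = w := by push_cast; ring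
    rw [this]
    linarith
  have hp0 := tendsto_zero_of_sqrt_mul_s1 hpc
  have ht : Tendsto (fun n : ℕ => Real.sqrt n * (p n / (1 - p n))) atTop (nhds c) := by
    have := hpc.div ((tendsto_const_nhds (x := (1 : ℝ))).sub hp0) (by norm_num)
    simp only [sub_zero, div_one] at this
    exact this.congr fun n => mul_div_assoc _ _ _
  have hZ := tendsto_logPart_of_tendsto (H := triangleTriples) card_link_triangleTriples
    card_edgeSlot hXpos hc2 hXc (t := fun n => Real.sqrt n * (p n / (1 - p n))) (by
      filter_upwards [eventually_gt_atTop 0] with n hn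
      have h1 := (hp n).1
      have h2 : 0 < 1 - p n := by linarith [(hp n).2]
      positivity) ht
  have hlog := tendsto_choose_two_div_sq.mul (tendsto_sqrt_mul_log hp hpc)
  have hval : 1 / 2 * -c + 1 / 2 * (X + 2 * X ^ 3 / 3) =
      (1 / 2) * ((w ^ ((3 : ℝ) / 2) + 3 * w ^ ((1 : ℝ) / 2)) / (3 * Real.sqrt 2) - c) := by
    have h2 : Real.sqrt 2 ≠ 0 := by positivity
    have hXs : X = Real.sqrt w / Real.sqrt 2 := Real.sqrt_div hW0 2
    rw [rpow_three_halves hW0, ← Real.sqrt_eq_rpow, pow_succ, hXsq, hXs]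
    field_simp
    ring
  rw [← hval]
  refine (hlog.add hZ).congr' ?_
  filter_upwards [eventually_gt_atTop 0] with n hn
  have h1 : 0 < 1 - p n := by linarith [(hp n).2]
  have hn' : (0 : ℝ) < n := by exact_mod_cast hn
  have hsn : 0 < Real.sqrt n := Real.sqrt_pos.2 hn'
  have hl : 0 ≤ p n / (1 - p n) := div_nonneg (hp n).1.le h1.le
  rw [erProb_triangle_free n (hp n).2, Real.log_mul (pow_ne_zero _ h1.ne')
    (LinearTriples.part_pos hl _ _).ne', Real.log_pow, rpow_three_halves hn'.le, add_div]
  unfold logPart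
  rw [mul_div_cancel_left₀ _ hsn.ne']
  congr 1
  have hsq : Real.sqrt n ^ 2 = n := Real.sq_sqrt hn'.le
  rw [div_mul_eq_mul_div, div_eq_div_iff (by positivity) (by positivity)]
  linear_combination ((n.choose 2 : ℝ) * Real.log (1 - p n) * n) * hsq
end
end
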